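/- Let g be a finite-dimensional complex semisimple Lie algebra with adjoint group G, and ℂ[g]^G the algebra of G-invariant polynomial functions on g. Then for every regular element x ∈ g, the differentials at x of the invariant polynomials span a subspace of g* of dimension equal to rk g; equivalently, if f₁,…,f_r (r = rk g) are homogeneous generators of ℂ[g]^G, their differentials d_x f₁,…,d_x f_r are linearly independent at every regular x. Consequently, the restriction of the adjoint quotient morphism π: g → Spec ℂ[g]^G to the open locus of regular elements is a smooth morphism. -/

import Mathlib

/-!
STATEMENT 8 (Kostant): For a finite-dimensional complex semisimple Lie algebra `g`, at every
regular element `x ∈ g` the differentials of the invariant polynomials span a subspace of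
`g*` of dimension `rk g`; equivalently the differentials of `r = rk g` homogeneous
generators of `ℂ[g]^G` are linearly independent at every regular `x`.  Consequently the
adjoint quotient map `π : g → Spec ℂ[g]^G` is smooth on the regular locus (expressed here as
formal smoothness of the local ring at each regular point over the invariant algebra).
-/

noncomputable section

open Module MvPolynomial LieAlgebra

variable (g : Type) [LieRing g] [LieAlgebra ℂ g] [FiniteDimensional ℂ g]

/-- A choice of basis of `g`. -/
def gBasis : Basis (Module.Free.ChooseBasisIndex ℂ g) ℂ g := Module.Free.chooseBasis ℂ g

/-- The polynomial algebra `ℂ[g]` of polynomial functions on `g`, realized as polynomials in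
the coordinate functions of the chosen basis. -/
abbrev PolyAlg := MvPolynomial (Module.Free.ChooseBasisIndex ℂ g) ℂ

/-- Evaluation of a polynomial function at a point `x ∈ g`. -/
def evalAt (x : g) : PolyAlg g →ₐ[ℂ] ℂ :=
  aeval fun i => (gBasis g).coord i x

/-- The action of `y ∈ g` on `ℂ[g]` by the unique derivation extending the coadjoint action
on linear functions. -/
def coadjointDerivation (y : g) : Derivation ℂ (PolyAlg g) (PolyAlg g) :=
  mkDerivation ℂ fun i => - ∑ j, (gBasis g).coord i ⁅y, gBasis g j⁆ • X j

/-- The subalgebra `ℂ[g]^G` of invariant polynomials: those annihilated by the derivation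
action of `g` (for connected `G` this is exactly `G`-invariance). -/
def invariantPolynomials : Subalgebra ℂ (PolyAlg g) where
  carrier := {p | ∀ y : g, coadjointDerivation g y p = 0}
  mul_mem' := fun {a b} ha hb => by
    intro y
    rw [Derivation.leibniz, ha y, hb y, smul_zero, smul_zero, add_zero]
  add_mem' := fun {a b} ha hb => by
    intro y
    rw [map_add, ha y, hb y, add_zero]
  one_mem' := fun y => Derivation.map_one_eq_zero _
  zero_mem' := fun y => map_zero _
  algebraMap_mem' := fun c y => Derivation.map_algebraMap _ c

/-- The differential `d_x p ∈ g*` of a polynomial function `p ∈ ℂ[g]` at the point `x ∈ g`. -/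
def diffAt (x : g) (p : PolyAlg g) : Module.Dual ℂ g :=
  ∑ i, evalAt g x (pderiv i p) • (gBasis g).coord i

/-- The centralizer `g^x = {y ∈ g : ⁅y, x⁆ = 0}` of an element of a Lie algebra, as a Lie
subalgebra. -/
def elementCentralizer (R L : Type*) [CommRing R] [LieRing L] [LieAlgebra R L] (x : L) :
    LieSubalgebra R L :=
  { LinearMap.ker ((ad R L) x) with
    lie_mem' := fun {a b} ha hb => by
      have ha' : ⁅x, a⁆ = 0 := ha
      have hb' : ⁅x, b⁆ = 0 := hb
      show ⁅x, ⁅a, b⁆⁆ = 0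
      rw [leibniz_lie, ha', hb']
      simp }

/-- An element `x` of a Lie algebra is regular when its centralizer has the minimal possible
dimension, namely the rank, i.e. the dimension of a Cartan subalgebra `t`. -/
def IsRegularElement {L : Type*} [LieRing L] [LieAlgebra ℂ L]
    (t : LieSubalgebra ℂ L) (x : L) : Prop :=
  finrank ℂ (elementCentralizer ℂ L x) = finrank ℂ t

/-- The maximal ideal of the point `x ∈ g`, i.e. the polynomials vanishing at `x`. -/
def pointIdeal (x : g) : Ideal (PolyAlg g) := RingHom.ker (evalAt g x)

instance (x : g) : (pointIdeal g x).IsPrime := RingHom.ker_isPrime (evalAt g x)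

set_option linter.unusedSectionVars false

namespace Kostant

section PolynomialFunctions

/-- The algebra of polynomial functions on a complex vector space. -/
def polyFun (E : Type) [AddCommGroup E] [Module ℂ E] : Subalgebra ℂ (E → ℂ) :=
  Algebra.adjoin ℂ (Set.range fun (l : Dual ℂ E) (x : E) => l x)

variable {E E' : Type} [AddCommGroup E] [Module ℂ E] [AddCommGroup E'] [Module ℂ E']

lemma dual_mem_polyFun (l : Dual ℂ E) : (fun x => l x) ∈ polyFun E :=
  Algebra.subset_adjoin ⟨l, rfl⟩

/-- A map between vector spaces is polynomial if its composites with linear forms are. -/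
def IsPolyMap (θ : E → E') : Prop := ∀ l : Dual ℂ E', (fun x => l (θ x)) ∈ polyFun E

lemma IsPolyMap.comp_mem {θ : E → E'} (hθ : IsPolyMap θ) {F : E' → ℂ} (hF : F ∈ polyFun E') :
    (fun x => F (θ x)) ∈ polyFun E := by
  induction hF using Algebra.adjoin_induction with
  | mem F h => obtain ⟨l, rfl⟩ := h; exact hθ l
  | algebraMap c => exact (polyFun E).algebraMap_mem c
  | add F G _ _ hF hG => exact (polyFun E).add_mem hF hG
  | mul F G _ _ hF hG => exact (polyFun E).mul_mem hF hG

lemma IsPolyMap.of_linear (θ : E →ₗ[ℂ] E') : IsPolyMap θ :=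
  fun l => dual_mem_polyFun (l.comp θ)

lemma IsPolyMap.comp_linear {E'' : Type} [AddCommGroup E''] [Module ℂ E''] {θ : E → E'}
    (hθ : IsPolyMap θ) (φ : E' →ₗ[ℂ] E'') : IsPolyMap fun x => φ (θ x) :=
  fun l => hθ (l.comp φ)

lemma IsPolyMap.add {θ η : E → E'} (hθ : IsPolyMap θ) (hη : IsPolyMap η) :
    IsPolyMap fun x => θ x + η x := fun l => by
  simpa using! (polyFun E).add_mem (hθ l) (hη l)

lemma IsPolyMap.const (c : E') : IsPolyMap fun _ : E => c :=
  fun l => (polyFun E).algebraMap_mem (l c)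

lemma IsPolyMap.sum {κ : Type*} (s : Finset κ) {θ : κ → E → E'} (hθ : ∀ i ∈ s, IsPolyMap (θ i)) :
    IsPolyMap fun x => ∑ i ∈ s, θ i x := fun l => by
  have := (polyFun E).sum_mem (fun i hi => hθ i hi l)
  convert this using 1
  ext x
  simp

lemma IsPolyMap.smul {a : E → ℂ} (ha : a ∈ polyFun E) {θ : E → E'} (hθ : IsPolyMap θ) :
    IsPolyMap fun x => a x • θ x := fun l => by
  simpa using! (polyFun E).mul_mem ha (hθ l)

/-- Polynomials in the coordinates of a basis, viewed as functions. -/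
def coordEval {κ : Type} (b : Basis κ ℂ E) : MvPolynomial κ ℂ →ₐ[ℂ] (E → ℂ) :=
  aeval fun i x => b.coord i x

lemma coordEval_apply {κ : Type} (b : Basis κ ℂ E) (p : MvPolynomial κ ℂ) (x : E) :
    coordEval b p x = aeval (fun i => b.coord i x) p := by
  have : (Pi.evalAlgHom ℂ (fun _ : E => ℂ) x).comp (coordEval b) =
      aeval (fun i => b.coord i x) := by
    ext i; simp [coordEval]
  exact congrArg (fun f => f p) this

lemma coordEval_injective {κ : Type} [Finite κ] (b : Basis κ ℂ E) :
    Function.Injective (coordEval b) := by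
  have := Fintype.ofFinite κ
  intro p q h
  refine MvPolynomial.funext fun v => ?_
  have h1 := congrFun h (b.equivFun.symm v)
  rw [coordEval_apply, coordEval_apply] at h1
  have h2 : (fun i => b.coord i (b.equivFun.symm v)) = v := by
    ext i
    rw [Basis.coord_apply, ← Basis.equivFun_apply, LinearEquiv.apply_symm_apply]
  rw [h2] at h1
  simpa [aeval_eq_eval] using h1

lemma coordEval_range {κ : Type} [Finite κ] (b : Basis κ ℂ E) :
    (coordEval b).range = polyFun E := by
  have := Fintype.ofFinite κ
  apply le_antisymm
  · rintro _ ⟨p, rfl⟩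
    induction p using MvPolynomial.induction_on with
    | C a => simp [coordEval]
    | add p q hp hq => 
      simp only [AlgHom.toRingHom_eq_coe, RingHom.coe_coe, map_add] at hp hq ⊢
      exact add_mem hp hq
    | mul_X p i hp =>
      simp only [AlgHom.toRingHom_eq_coe, RingHom.coe_coe, map_mul] at hp ⊢
      refine mul_mem hp ?_
      simpa [coordEval] using! dual_mem_polyFun (b.coord i)
  · refine Algebra.adjoin_le ?_
    rintro _ ⟨l, rfl⟩
    refine ⟨∑ i, C (l (b i)) * X i, ?_⟩
    ext x
    simp only [AlgHom.toRingHom_eq_coe, RingHom.coe_coe, map_sum, map_mul, Finset.sum_apply,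
      Pi.mul_apply]
    conv_rhs => rw [← b.sum_repr x, map_sum]
    refine Finset.sum_congr rfl fun i _ => ?_
    simp [coordEval_apply, mul_comm]

/-- Polynomial functions are polynomials in the coordinates. -/
def polyFunEquiv {κ : Type} [Finite κ] (b : Basis κ ℂ E) : MvPolynomial κ ℂ ≃ₐ[ℂ] polyFun E :=
  (AlgEquiv.ofInjective _ (coordEval_injective b)).trans
    (Subalgebra.equivOfEq _ _ (coordEval_range b))

instance [FiniteDimensional ℂ E] : IsDomain (polyFun E) :=
  (polyFunEquiv (Module.finBasis ℂ E)).symm.toMulEquiv.isDomain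

end PolynomialFunctions

section Differentials

variable {g}

lemma evalAt_X (x : g) (i) : evalAt g x (X i) = (gBasis g).coord i x := by
  simp [evalAt]

lemma evalAt_eq_coordEval (x : g) (p : PolyAlg g) : evalAt g x p = coordEval (gBasis g) p x :=
  (coordEval_apply _ _ _).symm

lemma evalAt_ext {p q : PolyAlg g} (h : ∀ x, evalAt g x p = evalAt g x q) : p = q := by
  apply coordEval_injective (gBasis g)
  ext x
  simpa only [evalAt_eq_coordEval] using h x

lemma exists_evalAt_eq {F : g → ℂ} (hF : F ∈ polyFun g) : ∃ p : PolyAlg g, ∀ x, evalAt g x p = F x := by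
  rw [← coordEval_range (gBasis g)] at hF
  obtain ⟨p, rfl⟩ := hF
  exact ⟨p, fun x => evalAt_eq_coordEval x p⟩

lemma evalAt_mem_polyFun (p : PolyAlg g) : (fun x => evalAt g x p) ∈ polyFun g := by
  rw [← coordEval_range (gBasis g)]
  exact ⟨p, funext fun x => (evalAt_eq_coordEval x p).symm⟩

/-- The linear map sending a polynomial to its differential at `x`. -/
def diffAtₗ (x : g) : PolyAlg g →ₗ[ℂ] Dual ℂ g where
  toFun := diffAt g x
  map_add' p q := by simp [diffAt, add_smul, Finset.sum_add_distrib]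
  map_smul' c p := by simp [diffAt, mul_smul, Finset.smul_sum]

@[simp] lemma diffAtₗ_apply (x : g) (p : PolyAlg g) : diffAtₗ x p = diffAt g x p := rfl

lemma diffAt_apply (x : g) (p : PolyAlg g) (v : g) :
    diffAt g x p v = ∑ i, evalAt g x (pderiv i p) * (gBasis g).coord i v := by
  simp [diffAt, LinearMap.sum_apply]

lemma diffAt_mul (x : g) (p q : PolyAlg g) :
    diffAt g x (p * q) = evalAt g x p • diffAt g x q + evalAt g x q • diffAt g x p := by
  ext v
  simp only [diffAt_apply, LinearMap.add_apply, LinearMap.smul_apply, smul_eq_mul, Finset.mul_sum,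
    ← Finset.sum_add_distrib, pderiv_mul, map_add, map_mul]
  exact Finset.sum_congr rfl fun i _ => by ring

lemma diffAt_C (x : g) (c : ℂ) : diffAt g x (C c) = 0 := by
  ext v; simp [diffAt_apply]

lemma diffAt_X (x : g) (i) : diffAt g x (X i) = (gBasis g).coord i := by
  classical
  ext v
  simp [diffAt_apply, pderiv_X, Pi.single_apply, apply_ite (evalAt g x)]

lemma evalAt_coadjointDerivation (x y : g) (p : PolyAlg g) :
    evalAt g x (coadjointDerivation g y p) = - diffAt g x p ⁅y, x⁆ := by
  induction p using MvPolynomial.induction_on with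
  | C a =>
    rw [← MvPolynomial.algebraMap_eq, Derivation.map_algebraMap, MvPolynomial.algebraMap_eq, diffAt_C]
    simp
  | add p q hp hq =>
    rw [map_add, map_add, hp, hq, ← diffAtₗ_apply, ← diffAtₗ_apply, ← diffAtₗ_apply, map_add,
      LinearMap.add_apply, neg_add]
  | mul_X p i hp =>
    rw [Derivation.leibniz, diffAt_mul, map_add, smul_eq_mul, smul_eq_mul, map_mul, map_mul, hp,
      diffAt_X, LinearMap.add_apply, LinearMap.smul_apply, LinearMap.smul_apply]
    have : evalAt g x (coadjointDerivation g y (X i)) = - (gBasis g).coord i ⁅y, x⁆ := by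
      have h1 : ⁅y, x⁆ = ∑ j, (gBasis g).repr x j • ⁅y, gBasis g j⁆ := by
        conv_lhs => rw [← (gBasis g).sum_repr x]
        simp only [lie_sum, lie_smul]
      rw [h1]
      simp [coadjointDerivation, mkDerivation_X, evalAt, mul_comm]
    rw [this, smul_eq_mul, smul_eq_mul]
    ring

lemma mem_invariantPolynomials_iff {p : PolyAlg g} :
    p ∈ invariantPolynomials g ↔ ∀ x y : g, diffAt g x p ⁅y, x⁆ = 0 := by
  constructor
  · intro h x y
    have := evalAt_coadjointDerivation x y p
    rw [show coadjointDerivation g y p = 0 from h y, map_zero] at this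
    simpa using this.symm
  · intro h y
    refine evalAt_ext fun x => ?_
    rw [evalAt_coadjointDerivation, h, map_zero, neg_zero]

lemma hasDerivAt_evalAt (p : PolyAlg g) {γ : ℂ → g} {v : g} {s : ℂ}
    (h : ∀ l : Dual ℂ g, HasDerivAt (fun s => l (γ s)) (l v) s) :
    HasDerivAt (fun s => evalAt g (γ s) p) (diffAt g (γ s) p v) s := by
  induction p using MvPolynomial.induction_on with
  | C a =>
    simpa [diffAt_C, evalAt] using hasDerivAt_const s a
  | add p q hp hq =>
    rw [← diffAtₗ_apply, map_add, LinearMap.add_apply]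
    simpa using! hp.add hq
  | mul_X p i hp =>
    rw [diffAt_mul, diffAt_X]
    have := hp.mul (h ((gBasis g).coord i))
    simp only [map_mul, evalAt_X]
    refine this.congr_deriv ?_
    simp only [LinearMap.add_apply, LinearMap.smul_apply, smul_eq_mul]
    ring

lemma hasDerivAt_evalAt_line (p : PolyAlg g) (x v : g) (s : ℂ) :
    HasDerivAt (fun s : ℂ => evalAt g (x + s • v) p) (diffAt g (x + s • v) p v) s := by
  refine hasDerivAt_evalAt p fun l => ?_
  simpa using! ((hasDerivAt_id s).mul_const (l v)).const_add (l x)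

end Differentials

end Kostant

namespace Kostant

/-- A weight basis of `g` relative to a Cartan subalgebra `t`, together with simple roots and the
corresponding `sl₂`-triples. -/
structure RootDatum (t : LieSubalgebra ℂ g) where
  /-- the index type of the weight basis -/
  κ : Type
  /-- the index type of the simple roots -/
  ι : Type
  [fintypeκ : Fintype κ]
  [decκ : DecidableEq κ]
  [fintypeι : Fintype ι]
  [decι : DecidableEq ι]
  /-- the weight basis -/
  B : Module.Basis κ ℂ g
  /-- the weights of the basis vectors -/
  wt : κ → Dual ℂ t
  /-- the simple roots -/
  α : Module.Basis ι ℂ (Dual ℂ t)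
  /-- the simple coroots -/
  h : Module.Basis ι ℂ t
  /-- the positive simple root vectors -/
  e : ι → g
  /-- the negative simple root vectors -/
  f : ι → g
  /-- the coordinates of the weights with respect to the simple roots -/
  coef : κ → ι → ℤ
  lie_B : ∀ (H : t) i, ⁅(H : g), B i⁆ = wt i H • B i
  wt_eq_zero : ∀ i, wt i = 0 ↔ B i ∈ t
  lie_t : ∀ H H' : t, ⁅(H : g), (H' : g)⁆ = 0
  lie_e : ∀ (H : t) j, ⁅(H : g), e j⁆ = α j H • e j
  lie_f : ∀ (H : t) j, ⁅(H : g), f j⁆ = -(α j H • f j)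
  lie_ef : ∀ j, ⁅e j, f j⁆ = h j
  lie_ef_ne : ∀ i j, i ≠ j → ⁅e i, f j⁆ = 0
  α_h : ∀ j, α j (h j) = 2
  wt_eq : ∀ i, wt i = ∑ j, (coef i j : ℂ) • α j
  coef_sign : ∀ i, (∀ j, 0 ≤ coef i j) ∨ (∀ j, coef i j ≤ 0)
  exists_reflection : ∀ i k, ∃ i', wt i' = wt i - wt i (h k) • α k
  reduced : ∀ i k (c : ℂ), wt i = c • α k → c = 0 ∨ c = 1 ∨ c = -1

open LieModule LieAlgebra.IsKilling in
theorem nonempty_rootDatum [LieAlgebra.IsSemisimple ℂ g] (t : LieSubalgebra ℂ g)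
    [t.IsCartanSubalgebra] : Nonempty (RootDatum g t) := by
  classical
  let P := rootSystem t
  obtain ⟨b⟩ := P.nonempty_base
  have hnz : ∀ χ : t.root, χ.1.IsNonZero := fun χ => t.isNonZero_coe_root χ
  let κ := Σ χ : Weight ℂ t g, Fin (finrank ℂ (rootSpace t χ))
  have hInt : DirectSum.IsInternal fun χ : Weight ℂ t g => (rootSpace t χ).toSubmodule := by
    apply DirectSum.isInternal_submodule_of_iSupIndep_of_iSup_eq_top
    · exact LieSubmodule.iSupIndep_toSubmodule.mpr (iSupIndep_genWeightSpace' ℂ t g)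
    · have := iSup_genWeightSpace_eq_top' ℂ t g
      rw [← LieSubmodule.toSubmodule_inj, LieSubmodule.iSup_toSubmodule] at this
      simpa using this
  let B : Module.Basis κ ℂ g := hInt.collectedBasis fun χ => Module.finBasis ℂ (rootSpace t χ)
  have hB : ∀ i : κ, B i ∈ rootSpace t i.1 := fun i =>
    hInt.collectedBasis_mem _ i
  have hlie : ∀ (χ : Weight ℂ t g) {x : g}, x ∈ rootSpace t χ → ∀ H : t,
      ⁅(H : g), x⁆ = (Weight.toLinear ℂ t g χ) H • x := fun χ x hx H => lie_eq_smul_of_mem_rootSpace hx H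
  have hsl := fun j : b.support => exists_isSl2Triple_of_weight_isNonZero (hnz j.1)
  choose h e f hsl he hf using hsl
  have hcor : ∀ j, h j = coroot j.1.1 := fun j => (hsl j).h_eq_coroot (hnz j.1) (he j) (hf j)
  have hcoef : ∀ χ : Weight ℂ t g, ∃ c : b.support → ℤ,
      (Weight.toLinear ℂ t g χ) = ∑ j, (c j : ℂ) • b.toWeightBasis j ∧ ((∀ j, 0 ≤ c j) ∨ (∀ j, c j ≤ 0)) := by
    intro χ
    by_cases hχ : χ.IsZero
    · refine ⟨0, ?_, Or.inl fun _ => le_rfl⟩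
      simpa using Weight.coe_toLinear_eq_zero_iff.mpr hχ
    · obtain ⟨c, -, hc, hs⟩ := b.exists_root_eq_sum_int ⟨χ, by simpa using hχ⟩
      refine ⟨fun j => c j, ?_, ?_⟩
      · simp only [RootPairing.Base.toWeightBasis_apply]
        rw [Finset.sum_coe_sort b.support (fun j => (c j : ℂ) • P.root j)]
        simp only [Int.cast_smul_eq_zsmul]
        exact hs
      · exact hc.imp (fun h j => h.le j) (fun h j => h.le j)
  choose c hc hcs using hcoef
  refine ⟨{ κ := κ, ι := b.support, B := B, wt := fun i => (Weight.toLinear ℂ t g i.1), α := b.toWeightBasis,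
            h := b.toCoweightBasis, e := e, f := f, coef := fun i => c i.1,
            lie_B := fun H i => hlie _ (hB i) H, wt_eq_zero := ?_, lie_t := ?_, 
            lie_e := ?_, lie_f := ?_, lie_ef := ?_, lie_ef_ne := ?_, α_h := ?_, 
            wt_eq := fun i => hc i.1, coef_sign := fun i => hcs i.1, exists_reflection := ?_, 
            reduced := ?_ }⟩
  · intro i
    constructor
    · intro h0
      have h1 := hB i
      have : (⇑i.1 : t → ℂ) = 0 := by
        ext x; exact LinearMap.congr_fun h0 x
      rw [this] at h1
      rw [LieAlgebra.rootSpace_zero_eq] at h1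
      simpa using h1
    · intro hi
      have h1 : B i ∈ rootSpace t (0 : t → ℂ) := by
        rw [LieAlgebra.rootSpace_zero_eq]; simpa using hi
      by_contra hne
      have h2 : (⇑i.1 : t → ℂ) ≠ 0 := fun h0 => hne (by ext x; exact congrFun h0 x)
      have := (iSupIndep_genWeightSpace ℂ t g).pairwiseDisjoint h2
      have h3 := (LieSubmodule.disjoint_toSubmodule.mpr this)
      exact B.ne_zero i (Submodule.disjoint_def.mp h3 _ (hB i) h1)
  · intro H H'
    have := trivial_lie_zero t t H H'
    simpa using congrArg Subtype.val this
  · intro H j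
    rw [RootPairing.Base.toWeightBasis_apply]
    exact hlie _ (he j) H
  · intro H j
    rw [RootPairing.Base.toWeightBasis_apply]
    have := lie_eq_smul_of_mem_rootSpace (hf j) H
    rw [Pi.neg_apply, neg_smul] at this
    exact this
  · intro j
    rw [(hsl j).lie_e_f, hcor, RootPairing.Base.toCoweightBasis_apply]
    rfl
  · intro i j hij
    have h1 : ⁅e i, f j⁆ ∈ rootSpace t ((i.1.1 : t → ℂ) + -(j.1.1 : t → ℂ)) :=
      lie_mem_genWeightSpace_of_mem_genWeightSpace (he i) (hf j)
    by_contra hne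
    have h2 : rootSpace t ((i.1.1 : t → ℂ) + -(j.1.1 : t → ℂ)) ≠ ⊥ := by
      intro h0
      rw [h0] at h1
      exact hne (by simpa using h1)
    let χ : Weight ℂ t g := ⟨_, h2⟩
    have hχ0 : χ.IsNonZero := by
      intro h0
      apply hij
      have : (i.1.1 : t → ℂ) = j.1.1 := by
        have h0' : (i.1.1 : t → ℂ) + -(j.1.1 : t → ℂ) = 0 := h0
        exact add_neg_eq_zero.mp h0'
      exact Subtype.ext (Subtype.ext (DFunLike.coe_injective this))
    apply b.sub_notMem_range_root i.2 j.2
    refine ⟨⟨χ, by simpa using hχ0⟩, ?_⟩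
    ext x
    change (i.1.1 : t → ℂ) x + -(j.1.1 : t → ℂ) x = i.1.1 x - j.1.1 x
    ring
  · intro j
    rw [RootPairing.Base.toWeightBasis_apply, RootPairing.Base.toCoweightBasis_apply]
    exact root_apply_coroot (hnz j.1)
  · intro i k
    rw [RootPairing.Base.toWeightBasis_apply, RootPairing.Base.toCoweightBasis_apply]
    have h1 : ∀ χ : Weight ℂ t g, ∃ i : κ, i.1 = χ := by
      intro χ
      have : 0 < finrank ℂ (rootSpace t χ) := by
        rw [Module.finrank_pos_iff]
        exact (LieSubmodule.nontrivial_iff_ne_bot ℂ t g).mpr χ.genWeightSpace_ne_bot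
      exact ⟨⟨χ, ⟨0, this⟩⟩, rfl⟩
    obtain ⟨i', hi'⟩ := h1 (reflectRoot k.1.1 i.1)
    refine ⟨i', ?_⟩
    rw [hi']
    ext x
    rfl
  · intro i k z hz
    by_cases h0 : i.1.IsZero
    · left
      have h1 : (Weight.toLinear ℂ t g i.1) = 0 := Weight.coe_toLinear_eq_zero_iff.mpr h0
      rw [h1] at hz
      exact (smul_eq_zero.mp hz.symm).resolve_right (b.toWeightBasis.ne_zero k)
    · right
      rw [RootPairing.Base.toWeightBasis_apply] at hz
      have hz' : (i.1 : t → ℂ) = z • (k.1.1 : t → ℂ) := by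
        ext x; exact LinearMap.congr_fun hz x
      have hne : P.root k.1 ≠ 0 := P.ne_zero _
      rcases eq_neg_or_eq_of_eq_smul k.1.1 i.1 h0 z hz' with h1 | h1
      · right
        apply smul_left_injective ℂ hne
        rw [h1] at hz
        simpa using! hz.symm
      · left
        apply smul_left_injective ℂ hne
        rw [h1] at hz
        simpa using! hz.symm

end Kostant

namespace Kostant

section Exponentials

variable {g}

/-- The truncated exponential series `∑_{k < N} (k!)⁻¹ (ad y)^k`. -/
def expAd (N : ℕ) (y : g) : Module.End ℂ g :=
  ∑ k ∈ Finset.range N, (k.factorial : ℂ)⁻¹ • (ad ℂ g y) ^ k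

lemma expAd_apply (N : ℕ) (y x : g) :
    expAd N y x = ∑ k ∈ Finset.range N, (k.factorial : ℂ)⁻¹ • ((ad ℂ g y) ^ k) x := by
  simp [expAd, LinearMap.sum_apply]

lemma exists_expAut {y : g} {N : ℕ} (hN : (ad ℂ g y) ^ N = 0) :
    ∃ u : g ≃ₗ⁅ℂ⁆ g, (∀ x, u x = expAd N y x) ∧ ∀ x, u.symm x = expAd N (-y) x := by
  let _ : Module ℚ g := Module.compHom g (algebraMap ℚ ℂ)
  have hsmul : ∀ (q : ℚ) (x : g), q • x = (q : ℂ) • x := fun q x => rfl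
  let _ : LieAlgebra ℚ g := { lie_smul := fun q x y => by rw [hsmul, hsmul, lie_smul] }
  have hD : (LieDerivation.ad ℂ g y).toLinearMap = ad ℂ g y := by
    ext x; simp
  have hnil : IsNilpotent (LieDerivation.ad ℂ g y).toLinearMap := ⟨N, by rw [hD, hN]⟩
  have key : ∀ z : g, (ad ℂ g z) ^ N = 0 → ∀ x, IsNilpotent.exp (ad ℂ g z) x = expAd N z x := by
    intro z hz x
    rw [IsNilpotent.exp_eq_sum hz, expAd_apply, LinearMap.sum_apply]
    refine Finset.sum_congr rfl fun k _ => ?_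
    rw [LinearMap.smul_apply, hsmul]
    simp
  refine ⟨LieDerivation.exp _ hnil, fun x => ?_, fun x => ?_⟩
  · rw [LieDerivation.exp_map_apply, hD, key y hN]
  · change IsNilpotent.exp (-(LieDerivation.ad ℂ g y).toLinearMap) x = _
    rw [hD, ← map_neg, key]
    rw [map_neg, neg_pow, hN, mul_zero]

lemma expAd_smul_apply (N : ℕ) (s : ℂ) (y x : g) :
    expAd N (s • y) x =
      ∑ k ∈ Finset.range N, s ^ k • ((k.factorial : ℂ)⁻¹ • ((ad ℂ g y) ^ k) x) := by
  rw [expAd_apply]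
  refine Finset.sum_congr rfl fun k _ => ?_
  rw [map_smul, smul_pow, LinearMap.smul_apply, smul_comm]

lemma hasDerivAt_expAd {y : g} {N : ℕ} (hN : (ad ℂ g y) ^ N = 0) (x : g) (l : Dual ℂ g) (s : ℂ) :
    HasDerivAt (fun s : ℂ => l (expAd N (s • y) x)) (l ⁅y, expAd N (s • y) x⁆) s := by
  have h1 : (fun s : ℂ => l (expAd N (s • y) x)) = fun s =>
      ∑ k ∈ Finset.range N, s ^ k * ((k.factorial : ℂ)⁻¹ * l (((ad ℂ g y) ^ k) x)) := by
    ext s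
    simp [expAd_smul_apply]
  rw [h1]
  have h2 : HasDerivAt (fun s : ℂ =>
      ∑ k ∈ Finset.range N, s ^ k * ((k.factorial : ℂ)⁻¹ * l (((ad ℂ g y) ^ k) x)))
      (∑ k ∈ Finset.range N, (k * s ^ (k - 1)) * ((k.factorial : ℂ)⁻¹ * l (((ad ℂ g y) ^ k) x))) s :=
    HasDerivAt.fun_sum fun k _ => (hasDerivAt_pow k s).mul_const _
  refine h2.congr_deriv ?_
  rw [expAd_smul_apply, lie_sum, map_sum]
  obtain _ | N := N
  · simp
  rw [Finset.sum_range_succ', Finset.sum_range_succ]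
  have h3 : ⁅y, (ad ℂ g y ^ N) x⁆ = 0 := by
    have := LinearMap.congr_fun hN x
    rwa [pow_succ', Module.End.mul_apply, ad_apply] at this
  simp only [lie_smul, h3, smul_zero, map_zero, add_zero, Nat.cast_zero, zero_mul]
  refine Finset.sum_congr rfl fun k _ => ?_
  rw [← ad_apply ℂ g y ((ad ℂ g y ^ k) x), ← Module.End.mul_apply, ← pow_succ']
  simp only [map_smul, smul_eq_mul, Nat.add_sub_cancel, Nat.factorial_succ, Nat.cast_mul]
  have : ((k + 1 : ℕ) : ℂ) ≠ 0 := Nat.cast_ne_zero.mpr k.succ_ne_zero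
  field_simp

/-- A Lie algebra automorphism fixing all invariant polynomials. -/
def FixesInvariants (u : g ≃ₗ⁅ℂ⁆ g) : Prop :=
  ∀ p ∈ invariantPolynomials g, ∀ z, evalAt g (u z) p = evalAt g z p

lemma FixesInvariants.trans {u v : g ≃ₗ⁅ℂ⁆ g} (hu : FixesInvariants u) (hv : FixesInvariants v) :
    FixesInvariants (u.trans v) := fun p hp z => by
  rw [LieEquiv.trans_apply, hv p hp, hu p hp]

lemma FixesInvariants.symm {u : g ≃ₗ⁅ℂ⁆ g} (hu : FixesInvariants u) :
    FixesInvariants u.symm := fun p hp z => by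
  rw [← hu p hp, LieEquiv.apply_symm_apply]

lemma fixesInvariants_of_expAd {y : g} {N : ℕ} (hN : (ad ℂ g y) ^ N = 0) {u : g ≃ₗ⁅ℂ⁆ g}
    (hu : ∀ x, u x = expAd N y x) : FixesInvariants u := by
  intro p hp z
  have h1 : ∀ s : ℂ, HasDerivAt (fun s : ℂ => evalAt g (expAd N (s • y) z) p) 0 s := by
    intro s
    have := hasDerivAt_evalAt (γ := fun s => expAd N (s • y) z) p
      (fun l => hasDerivAt_expAd hN z l s)
    rwa [mem_invariantPolynomials_iff.mp hp] at this
  have h2 := is_const_of_deriv_eq_zero (fun s => (h1 s).differentiableAt) (fun s => (h1 s).deriv) 1 0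
  obtain _ | N := N
  · have : Subsingleton g := ⟨fun a b => by
      have h0 := fun a : g => LinearMap.congr_fun hN a
      simp only [pow_zero, Module.End.one_apply, LinearMap.zero_apply] at h0
      rw [h0 a, h0 b]⟩
    rw [Subsingleton.elim (u z) z]
  · simp only [one_smul, ← hu] at h2
    rw [h2, expAd_smul_apply, Finset.sum_range_succ']
    simp

end Exponentials

end Kostant

namespace Kostant

attribute [instance] RootDatum.fintypeκ RootDatum.decκ RootDatum.fintypeι RootDatum.decι

namespace RootDatum

variable {g} {t : LieSubalgebra ℂ g} (D : RootDatum g t)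

/-- The height of a weight. -/
def deg (i : D.κ) : ℤ := ∑ j, D.coef i j

lemma wt_eq_zero_of_deg {i : D.κ} (hi : D.deg i = 0) : D.wt i = 0 := by
  have h0 : ∀ j, D.coef i j = 0 := by
    rcases D.coef_sign i with h | h
    · exact fun j => (Finset.sum_eq_zero_iff_of_nonneg fun j _ => h j).mp hi j (Finset.mem_univ j)
    · exact fun j => (Finset.sum_eq_zero_iff_of_nonpos fun j _ => h j).mp hi j (Finset.mem_univ j)
  rw [D.wt_eq]
  simp [h0]

/-- The element of the Cartan subalgebra on which all simple roots are `1`. -/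
def h₀ : t := (Module.evalEquiv ℂ t).symm (D.α.constr ℂ fun _ => (1 : ℂ))

lemma α_h₀ (j : D.ι) : D.α j D.h₀ = 1 := by
  have : D.α j D.h₀ = Module.evalEquiv ℂ t D.h₀ (D.α j) := rfl
  rw [this, h₀, LinearEquiv.apply_symm_apply, Basis.constr_basis]

lemma wt_h₀ (i : D.κ) : D.wt i D.h₀ = D.deg i := by
  rw [D.wt_eq]
  simp [LinearMap.sum_apply, α_h₀, deg]

lemma lie_h₀_B (i : D.κ) : ⁅(D.h₀ : g), D.B i⁆ = (D.deg i : ℂ) • D.B i := by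
  rw [D.lie_B, wt_h₀]

lemma repr_lie_t (H : t) (x : g) (i : D.κ) :
    D.B.repr ⁅(H : g), x⁆ i = D.wt i H * D.B.repr x i := by
  conv_lhs => rw [← D.B.sum_repr x, lie_sum]
  simp only [lie_smul, D.lie_B, map_sum, map_smul, Basis.repr_self]
  simp [Finsupp.single_apply, mul_comm]

lemma repr_lie_h₀ (x : g) (i : D.κ) :
    D.B.repr ⁅(D.h₀ : g), x⁆ i = D.deg i * D.B.repr x i := by
  rw [repr_lie_t, wt_h₀]

/-- The projection to the homogeneous component of degree `k`. -/
def proj (k : ℤ) : g →ₗ[ℂ] g := D.B.constr ℂ fun i => if D.deg i = k then D.B i else 0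

lemma repr_proj (k : ℤ) (x : g) (i : D.κ) :
    D.B.repr (D.proj k x) i = if D.deg i = k then D.B.repr x i else 0 := by
  rw [proj, Basis.constr_apply_fintype]
  simp only [map_sum, map_smul, Finsupp.coe_finsetSum, Finset.sum_apply, Finsupp.smul_apply,
    Basis.equivFun_apply, smul_eq_mul, apply_ite D.B.repr, map_zero, Basis.repr_self]
  rw [Finset.sum_eq_single i]
  · split_ifs <;> simp
  · intro j _ hj
    split_ifs <;> simp [hj]
  · simp

lemma proj_eq_self_iff {k : ℤ} {x : g} : D.proj k x = x ↔ ⁅(D.h₀ : g), x⁆ = (k : ℂ) • x := by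
  constructor
  · intro h
    apply D.B.ext_elem
    intro i
    rw [repr_lie_h₀, map_smul, Finsupp.smul_apply, ← h, repr_proj]
    split_ifs with h1 <;> simp [h1]
  · intro h
    apply D.B.ext_elem
    intro i
    have := congrArg (fun y => D.B.repr y i) h
    simp only [repr_lie_h₀, map_smul, Finsupp.smul_apply, smul_eq_mul] at this
    rw [repr_proj]
    split_ifs with h1
    · rfl
    · rw [← sub_eq_zero, ← sub_mul, mul_eq_zero, sub_eq_zero, Int.cast_inj] at this
      exact (this.resolve_left h1).symm

lemma proj_proj (k m : ℤ) (x : g) : D.proj k (D.proj m x) = if k = m then D.proj m x else 0 := by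
  apply D.B.ext_elem
  intro i
  rw [repr_proj, repr_proj]
  split_ifs <;> simp_all [repr_proj]

lemma lie_h₀_proj (k : ℤ) (x : g) : ⁅(D.h₀ : g), D.proj k x⁆ = (k : ℂ) • D.proj k x := by
  rw [← proj_eq_self_iff, proj_proj, if_pos rfl]

/-- The finite set of degrees of the grading. -/
def degrees : Finset ℤ := Finset.univ.image D.deg

lemma proj_eq_zero {k : ℤ} (hk : k ∉ D.degrees) (x : g) : D.proj k x = 0 := by
  apply D.B.ext_elem
  intro i
  rw [repr_proj, if_neg]
  · simp
  · rintro rfl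
    exact hk (Finset.mem_image_of_mem _ (Finset.mem_univ i))

lemma sum_proj (x : g) : ∑ k ∈ D.degrees, D.proj k x = x := by
  apply D.B.ext_elem
  intro i
  rw [map_sum, Finsupp.coe_finsetSum, Finset.sum_apply]
  simp only [repr_proj]
  rw [Finset.sum_ite_eq, if_pos]
  exact Finset.mem_image_of_mem _ (Finset.mem_univ i)

lemma ext_proj {x y : g} (h : ∀ k, D.proj k x = D.proj k y) : x = y := by
  rw [← D.sum_proj x, ← D.sum_proj y]
  exact Finset.sum_congr rfl fun k _ => h k

lemma proj_lie_of_left {m : ℤ} {a : g} (ha : D.proj m a = a) (k : ℤ) (x : g) :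
    D.proj (k + m) ⁅a, x⁆ = ⁅a, D.proj k x⁆ := by
  have h1 : ∀ j, D.proj (j + m) ⁅a, D.proj j x⁆ = ⁅a, D.proj j x⁆ := by
    intro j
    rw [proj_eq_self_iff, leibniz_lie, lie_h₀_proj, D.proj_eq_self_iff.mp ha]
    simp only [smul_lie, lie_smul]
    rw [← add_smul]
    push_cast
    rw [add_comm]
  conv_lhs => rw [← D.sum_proj x]
  rw [lie_sum, map_sum]
  have h2 : ∀ j ∈ D.degrees, D.proj (k + m) ⁅a, D.proj j x⁆ =
      if k = j then ⁅a, D.proj j x⁆ else 0 := by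
    intro j _
    rw [← h1 j, proj_proj]
    simp
  rw [Finset.sum_congr rfl h2, Finset.sum_ite_eq]
  split_ifs with h
  · rfl
  · rw [D.proj_eq_zero h, lie_zero]

/-- The increasing filtration associated with the grading. -/
def fil (k : ℤ) : Submodule ℂ g where
  carrier := {x | ∀ m, k < m → D.proj m x = 0}
  add_mem' := fun {a b} ha hb m hm => by rw [map_add, ha m hm, hb m hm, add_zero]
  zero_mem' := fun m _ => map_zero _
  smul_mem' := fun c x hx m hm => by rw [map_smul, hx m hm, smul_zero]

lemma mem_fil {k : ℤ} {x : g} : x ∈ D.fil k ↔ ∀ m, k < m → D.proj m x = 0 := Iff.rfl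

lemma fil_mono {k m : ℤ} (h : k ≤ m) : D.fil k ≤ D.fil m := fun _ hx j hj => hx j (h.trans_lt hj)

lemma proj_mem_fil {k m : ℤ} (h : k ≤ m) (x : g) : D.proj k x ∈ D.fil m := fun j hj => by
  rw [proj_proj, if_neg (by omega)]

lemma mem_fil_of_proj {k : ℤ} {x : g} (h : D.proj k x = x) : x ∈ D.fil k :=
  h ▸ D.proj_mem_fil le_rfl x

lemma proj_mem_fil_of_mem {k m : ℤ} {x : g} (hx : x ∈ D.fil m) : D.proj k x ∈ D.fil m :=
  fun j hj => by
    rw [proj_proj]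
    split_ifs with h
    · exact hx k (h ▸ hj)
    · rfl

lemma sub_proj_mem {k : ℤ} {x : g} (hx : x ∈ D.fil k) : x - D.proj k x ∈ D.fil (k - 1) := by
  intro m hm
  rw [map_sub, proj_proj]
  split_ifs with h
  · rw [h, sub_self]
  · rw [hx m (by omega), sub_zero]

lemma mem_fil_of_proj_eq_zero {k : ℤ} {x : g} (hx : x ∈ D.fil k) (h : D.proj k x = 0) :
    x ∈ D.fil (k - 1) := by
  simpa [h] using D.sub_proj_mem hx

lemma lie_mem_fil {k m : ℤ} {x y : g} (hx : x ∈ D.fil k) (hy : y ∈ D.fil m) :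
    ⁅x, y⁆ ∈ D.fil (k + m) := by
  rw [← D.sum_proj x, sum_lie]
  refine sum_mem fun j _ => ?_
  by_cases hj : k < j
  · rw [hx j hj, zero_lie]
    exact zero_mem _
  · intro l hl
    have := D.proj_lie_of_left (a := D.proj j x) (m := j) (by rw [proj_proj, if_pos rfl]) (l - j) y
    rw [sub_add_cancel] at this
    rw [this, hy _ (by omega), lie_zero]

/-- A bound for the degrees. -/
def bound : ℕ := ∑ i, (D.deg i).natAbs + 2

lemma abs_lt_bound {k : ℤ} (hk : k ∈ D.degrees) : |k| < D.bound := by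
  obtain ⟨i, -, rfl⟩ := Finset.mem_image.mp hk
  have := Finset.single_le_sum (f := fun i => (D.deg i).natAbs) (fun i _ => Nat.zero_le _)
    (Finset.mem_univ i)
  rw [Int.abs_eq_natAbs, bound]
  exact_mod_cast Nat.lt_succ_of_lt (Nat.lt_succ_of_le this)

lemma fil_bound {k : ℤ} (hk : D.bound ≤ k) (x : g) : x ∈ D.fil k := by
  intro m hm
  refine D.proj_eq_zero (fun h => ?_) x
  have := (abs_lt.mp (D.abs_lt_bound h)).2
  omega

lemma eq_zero_of_mem_fil {k : ℤ} (hk : k ≤ -D.bound) {x : g} (hx : x ∈ D.fil k) : x = 0 := by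
  rw [← D.sum_proj x]
  refine Finset.sum_eq_zero fun m hm => hx m ?_
  have := (abs_lt.mp (D.abs_lt_bound hm)).1
  omega

lemma ad_pow_mem_fil {k m : ℤ} {y x : g} (hy : y ∈ D.fil k) (hx : x ∈ D.fil m) (n : ℕ) :
    ((ad ℂ g y) ^ n) x ∈ D.fil (m + n * k) := by
  induction n with
  | zero => simpa using hx
  | succ n ih =>
    rw [pow_succ', Module.End.mul_apply, ad_apply]
    have := D.lie_mem_fil hy ih
    convert this using 2
    push_cast
    ring

lemma ad_pow_eq_zero {y : g} (hy : y ∈ D.fil (-1)) : (ad ℂ g y) ^ (2 * D.bound) = 0 := by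
  ext x
  refine D.eq_zero_of_mem_fil (k := -D.bound) le_rfl ?_
  have := D.ad_pow_mem_fil hy (D.fil_bound le_rfl x) (2 * D.bound)
  convert this using 2
  push_cast
  ring

/-! ### The principal nilpotent element -/

/-- The principal nilpotent element. -/
def e₀ : g := ∑ j, D.e j

lemma proj_e (j : D.ι) : D.proj 1 (D.e j) = D.e j := by
  rw [proj_eq_self_iff, D.lie_e, α_h₀, Int.cast_one]

lemma proj_f (j : D.ι) : D.proj (-1) (D.f j) = D.f j := by
  rw [proj_eq_self_iff, D.lie_f, α_h₀, Int.cast_neg, Int.cast_one, neg_smul]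

lemma proj_e₀ : D.proj 1 D.e₀ = D.e₀ := by
  rw [e₀, map_sum]
  exact Finset.sum_congr rfl fun j _ => D.proj_e j

lemma proj_t (H : t) : D.proj 0 (H : g) = H := by
  rw [proj_eq_self_iff, D.lie_t, Int.cast_zero, zero_smul]

lemma proj_zero_mem_t (x : g) : D.proj 0 x ∈ t := by
  rw [proj, Basis.constr_apply_fintype]
  refine sum_mem fun i _ => t.smul_mem _ ?_
  split_ifs with h
  · exact (D.wt_eq_zero i).mp (D.wt_eq_zero_of_deg h)
  · exact t.zero_mem

lemma exists_f₀ : ∃ f₀ : g, D.proj (-1) f₀ = f₀ ∧ ⁅D.e₀, f₀⁆ = (2 : ℂ) • (D.h₀ : g) := by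
  refine ⟨∑ j, D.h.repr ((2 : ℂ) • D.h₀) j • D.f j, ?_, ?_⟩
  · rw [map_sum]
    exact Finset.sum_congr rfl fun j _ => by rw [map_smul, proj_f]
  · have h1 : ∀ j, ⁅D.e₀, D.f j⁆ = D.h j := by
      intro j
      rw [e₀, sum_lie, Finset.sum_eq_single j, D.lie_ef]
      · intro i _ hij
        exact D.lie_ef_ne i j hij
      · simp
    simp only [lie_sum, lie_smul, h1]
    have := congrArg (fun x : t => (x : g)) (D.h.sum_repr ((2 : ℂ) • D.h₀))
    simpa using this

lemma eq_zero_of_lie_e₀ {k : ℤ} (hk : k < 0) {x : g} (hx : D.proj k x = x) (h : ⁅D.e₀, x⁆ = 0) :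
    x = 0 := by
  have hx' := D.proj_eq_self_iff.mp hx
  have hkc : (k : ℂ) ≠ 0 := Int.cast_ne_zero.mpr hk.ne
  by_cases h0 : (D.h₀ : g) = 0
  · rw [h0, zero_lie] at hx'
    exact (smul_eq_zero.mp hx'.symm).resolve_left hkc
  obtain ⟨f₀, hf, hef⟩ := D.exists_f₀
  have ht : IsSl2Triple ((2 : ℂ) • (D.h₀ : g)) D.e₀ f₀ :=
    { h_ne_zero := smul_ne_zero two_ne_zero h0
      lie_e_f := hef
      lie_h_e_nsmul := by
        rw [smul_lie, D.proj_eq_self_iff.mp D.proj_e₀]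
        simp [two_smul]
      lie_h_f_nsmul := by
        rw [smul_lie, D.proj_eq_self_iff.mp hf]
        simp [two_smul] }
  by_contra hne
  have hP : IsSl2Triple.HasPrimitiveVectorWith (R := ℂ) (M := g) ht x ((2 * k : ℤ) : ℂ) :=
    { ne_zero := hne
      lie_h := by rw [smul_lie, hx', smul_smul]; push_cast; rfl
      lie_e := h }
  obtain ⟨n, hn⟩ := hP.exists_nat
  have : 2 * k = n := by exact_mod_cast hn
  omega

lemma lie_e₀_injective {x : g} (hx : x ∈ D.fil (-1)) (h : ⁅D.e₀, x⁆ = 0) : x = 0 := by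
  refine D.ext_proj fun k => ?_
  rw [map_zero]
  by_cases hk : k < 0
  · refine D.eq_zero_of_lie_e₀ hk (by rw [proj_proj, if_pos rfl]) ?_
    rw [← D.proj_lie_of_left D.proj_e₀, h, map_zero]
  · exact hx k (by omega)

end RootDatum

end Kostant

namespace Kostant

lemma IsPolyMap.lie {g : Type} [LieRing g] [LieAlgebra ℂ g] [FiniteDimensional ℂ g]
    {E : Type} [AddCommGroup E] [Module ℂ E] {θ η : E → g}
    (hθ : IsPolyMap θ) (hη : IsPolyMap η) : IsPolyMap fun x => ⁅θ x, η x⁆ := by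
  have h1 : ∀ x, ⁅θ x, η x⁆ = ∑ i, (Module.finBasis ℂ g).coord i (θ x) •
      ad ℂ g (Module.finBasis ℂ g i) (η x) := by
    intro x
    conv_lhs => rw [← (Module.finBasis ℂ g).sum_repr (θ x), sum_lie]
    exact Finset.sum_congr rfl fun i _ => by rw [smul_lie, ad_apply, Basis.coord_apply]
  simp only [h1]
  exact IsPolyMap.sum _ fun i _ => IsPolyMap.smul (hθ _) (hη.comp_linear _)

lemma IsPolyMap.expAd {g : Type} [LieRing g] [LieAlgebra ℂ g] [FiniteDimensional ℂ g]
    {E : Type} [AddCommGroup E] [Module ℂ E] {θ η : E → g} (N : ℕ)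
    (hθ : IsPolyMap θ) (hη : IsPolyMap η) : IsPolyMap fun x => expAd N (θ x) (η x) := by
  simp only [expAd_apply]
  have h : ∀ k, IsPolyMap fun x => ((ad ℂ g (θ x)) ^ k) (η x) := by
    intro k
    induction k with
    | zero => simpa using hη
    | succ k ih =>
      simp only [pow_succ', Module.End.mul_apply, ad_apply]
      exact hθ.lie ih
  exact IsPolyMap.sum _ fun k _ => IsPolyMap.smul ((polyFun E).algebraMap_mem _) (h k)

lemma IsPolyMap.comp {E E' E'' : Type} [AddCommGroup E] [Module ℂ E] [AddCommGroup E']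
    [Module ℂ E'] [AddCommGroup E''] [Module ℂ E''] {φ : E' → E''} {θ : E → E'}
    (hφ : IsPolyMap φ) (hθ : IsPolyMap θ) : IsPolyMap fun x => φ (θ x) :=
  fun l => hθ.comp_mem (hφ l)

namespace RootDatum

variable {g} {t : LieSubalgebra ℂ g} (D : RootDatum g t)

lemma exists_section : ∃ η : g →ₗ[ℂ] g, (∀ y ∈ D.fil (-1), η ⁅D.e₀, y⁆ = y) ∧
    (∀ x, η x ∈ D.fil (-1)) ∧ ∀ x k, k < 0 → D.proj k (η x) = η (D.proj (k + 1) x) := by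
  have hker : LinearMap.ker ((ad ℂ g D.e₀).domRestrict (D.fil (-1))) = ⊥ := by
    rw [LinearMap.ker_eq_bot']
    intro y hy
    exact Subtype.ext (D.lie_e₀_injective y.2 hy)
  obtain ⟨L, hL⟩ := LinearMap.exists_leftInverse_of_injective _ hker
  have hL' : ∀ y ∈ D.fil (-1), (L ⁅D.e₀, y⁆ : g) = y := fun y hy =>
    congrArg Subtype.val (LinearMap.congr_fun hL ⟨y, hy⟩)
  let η : g →ₗ[ℂ] g := ∑ k ∈ D.degrees.filter (· < 0),
    D.proj k ∘ₗ (D.fil (-1)).subtype ∘ₗ L ∘ₗ D.proj (k + 1)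
  have hη : ∀ x, η x = ∑ k ∈ D.degrees.filter (· < 0), D.proj k (L (D.proj (k + 1) x)) := by
    intro x; simp [η, LinearMap.sum_apply]
  have hp : ∀ x k, k < 0 → D.proj k (η x) = D.proj k (L (D.proj (k + 1) x)) := by
    intro x k hk
    rw [hη, map_sum]
    simp only [proj_proj]
    rw [Finset.sum_ite_eq]
    split_ifs with h
    · rfl
    · rw [D.proj_eq_zero]
      simpa [hk] using h
  have hm : ∀ x, η x ∈ D.fil (-1) := by
    intro x
    rw [hη]
    refine sum_mem fun k hk => D.proj_mem_fil ?_ _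
    have := (Finset.mem_filter.mp hk).2
    omega
  refine ⟨η, ?_, hm, ?_⟩
  · intro y hy
    refine D.ext_proj fun k => ?_
    by_cases hk : k < 0
    · rw [hp _ _ hk, D.proj_lie_of_left D.proj_e₀, hL' _ (D.proj_mem_fil (by omega) _), proj_proj,
        if_pos rfl]
    · rw [hy k (by omega), hm _ k (by omega)]
  · intro x k hk
    refine D.ext_proj fun j => ?_
    by_cases hj : j < 0
    · rw [hp _ j hj, proj_proj, proj_proj, hp _ k hk]
      by_cases h : j = k
      · subst h; simp
      · rw [if_neg h, if_neg (by omega), map_zero, ZeroMemClass.coe_zero, map_zero]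
    · rw [hm _ j (by omega), proj_proj, if_neg (by omega)]

/-- A graded left inverse of the adjoint action of the principal nilpotent on the negative part. -/
def η : g →ₗ[ℂ] g := D.exists_section.choose

lemma η_lie {y : g} (hy : y ∈ D.fil (-1)) : D.η ⁅D.e₀, y⁆ = y :=
  D.exists_section.choose_spec.1 y hy

lemma η_mem (x : g) : D.η x ∈ D.fil (-1) := D.exists_section.choose_spec.2.1 x

lemma proj_η (x : g) {k : ℤ} (hk : k < 0) : D.proj k (D.η x) = D.η (D.proj (k + 1) x) :=
  D.exists_section.choose_spec.2.2 x k hk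

lemma η_mem_fil {k : ℤ} {x : g} (hx : x ∈ D.fil k) : D.η x ∈ D.fil (k - 1) := by
  intro m hm
  by_cases h : m < 0
  · rw [proj_η _ _ h, hx _ (by omega), map_zero]
  · exact D.η_mem x m (by omega)

/-- A graded complement of `⁅e₀, 𝔫₋⁆` in the non-positive part. -/
def slice : Submodule ℂ g := LinearMap.ker D.η ⊓ D.fil 0

lemma proj_mem_slice {x : g} (hx : x ∈ D.slice) (k : ℤ) : D.proj k x ∈ D.slice := by
  refine ⟨?_, D.proj_mem_fil_of_mem hx.2⟩
  by_cases hk : k ≤ 0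
  · have := D.proj_η x (k := k - 1) (by omega)
    rw [sub_add_cancel, show D.η x = 0 from hx.1, map_zero] at this
    exact this.symm
  · rw [hx.2 k (by omega)]
    exact zero_mem _

lemma eq_zero_of_lie_mem_slice {y : g} (hy : y ∈ D.fil (-1)) (h : ⁅D.e₀, y⁆ ∈ D.slice) : y = 0 := by
  rw [← D.η_lie hy]
  exact h.1

lemma finrank_slice : finrank ℂ D.slice = finrank ℂ t := by
  have h1 : finrank ℂ (D.fil 0) = finrank ℂ t + finrank ℂ (D.fil (-1)) := by
    let π : D.fil 0 →ₗ[ℂ] t :=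
      ((D.proj 0).domRestrict (D.fil 0)).codRestrict t.toSubmodule fun x => D.proj_zero_mem_t x
    have hπ : LinearMap.range π = ⊤ := by
      rw [LinearMap.range_eq_top]
      intro H
      exact ⟨⟨H, D.mem_fil_of_proj (D.proj_t H)⟩, Subtype.ext (D.proj_t H)⟩
    have hk : LinearMap.ker π = (D.fil (-1)).comap (D.fil 0).subtype := by
      ext x
      rw [LinearMap.mem_ker, Submodule.mem_comap]
      constructor
      · intro h
        exact D.mem_fil_of_proj_eq_zero (k := 0) x.2 (congrArg Subtype.val h)
      · intro h
        exact Subtype.ext (h 0 (by omega))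
    have h2 := LinearMap.finrank_range_add_finrank_ker π
    rw [hπ, hk, finrank_top,
      (Submodule.comapSubtypeEquivOfLe (D.fil_mono (by omega))).finrank_eq] at h2
    exact h2.symm
  let ρ : D.fil 0 →ₗ[ℂ] D.fil (-1) := (D.η.domRestrict _).codRestrict _ fun x => D.η_mem x
  have hρ : LinearMap.range ρ = ⊤ := by
    rw [LinearMap.range_eq_top]
    intro y
    refine ⟨⟨⁅D.e₀, (y : g)⁆, ?_⟩, Subtype.ext (D.η_lie y.2)⟩
    have := D.lie_mem_fil (D.mem_fil_of_proj D.proj_e₀) y.2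
    simpa using this
  have hk : LinearMap.ker ρ = D.slice.comap (D.fil 0).subtype := by
    ext x
    rw [LinearMap.mem_ker, Submodule.mem_comap]
    constructor
    · intro h
      exact ⟨congrArg Subtype.val h, x.2⟩
    · intro h
      exact Subtype.ext h.1
  have h2 := LinearMap.finrank_range_add_finrank_ker ρ
  rw [hρ, hk, finrank_top, (Submodule.comapSubtypeEquivOfLe (show D.slice ≤ D.fil 0 from inf_le_right)).finrank_eq, h1] at h2
  omega

/-- An automorphism is unipotent if it fixes all invariants and induces the identity on the
associated graded of the filtration. -/
structure Unipotent (u : g ≃ₗ⁅ℂ⁆ g) : Prop where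
  fixes : FixesInvariants u
  sub_mem : ∀ k, ∀ x ∈ D.fil k, u x - x ∈ D.fil (k - 1)
  symm_sub_mem : ∀ k, ∀ x ∈ D.fil k, u.symm x - x ∈ D.fil (k - 1)

variable {D} in
lemma Unipotent.mem_fil {u : g ≃ₗ⁅ℂ⁆ g} (hu : D.Unipotent u) {k : ℤ} {x : g} (hx : x ∈ D.fil k) :
    u x ∈ D.fil k := by
  have := add_mem (D.fil_mono (by omega : k - 1 ≤ k) (hu.sub_mem k x hx)) hx
  simpa using this

variable {D} in
lemma Unipotent.symm {u : g ≃ₗ⁅ℂ⁆ g} (hu : D.Unipotent u) : D.Unipotent u.symm :=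
  ⟨hu.fixes.symm, hu.symm_sub_mem, hu.sub_mem⟩

variable {D} in
lemma Unipotent.trans {u v : g ≃ₗ⁅ℂ⁆ g} (hu : D.Unipotent u) (hv : D.Unipotent v) :
    D.Unipotent (u.trans v) := by
  refine ⟨hu.fixes.trans hv.fixes, fun k x hx => ?_, fun k x hx => ?_⟩
  · have := add_mem (hv.sub_mem k _ (hu.mem_fil hx)) (hu.sub_mem k x hx)
    simpa using this
  · have := add_mem (hu.symm_sub_mem k _ (hv.symm.mem_fil hx)) (hv.symm_sub_mem k x hx)
    simpa using this

lemma unipotent_refl : D.Unipotent LieEquiv.refl :=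
  ⟨fun _ _ _ => rfl, fun k x _ => by simp, fun k x _ => by simp [LieEquiv.refl_symm]⟩

lemma expAd_sub_mem {y : g} (hy : y ∈ D.fil (-1)) (N : ℕ) {k : ℤ} {x : g} (hx : x ∈ D.fil k) :
    expAd (N + 1) y x - x ∈ D.fil (k - 1) := by
  rw [expAd_apply, Finset.sum_range_succ']
  simp only [pow_zero, Nat.factorial_zero, Nat.cast_one, inv_one, one_smul, Module.End.one_apply,
    add_sub_cancel_right]
  refine sum_mem fun j _ => Submodule.smul_mem _ _ ?_
  refine D.fil_mono ?_ (D.ad_pow_mem_fil hy hx (j + 1))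
  push_cast
  omega

/-- The exponential of the adjoint action on the negative part. -/
def exp (y : g) : Module.End ℂ g := expAd (2 * D.bound) y

lemma exists_two_mul_bound : ∃ N, 2 * D.bound = N + 1 := ⟨2 * D.bound - 1, by unfold bound; omega⟩

lemma exists_unipotent_exp {y : g} (hy : y ∈ D.fil (-1)) :
    ∃ u : g ≃ₗ⁅ℂ⁆ g, D.Unipotent u ∧ ∀ x, u x = D.exp y x := by
  obtain ⟨u, hu, hu'⟩ := exists_expAut (D.ad_pow_eq_zero hy)
  obtain ⟨N, hN⟩ := D.exists_two_mul_bound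
  refine ⟨u, ⟨fixesInvariants_of_expAd (D.ad_pow_eq_zero hy) hu, fun k x hx => ?_,
    fun k x hx => ?_⟩, hu⟩
  · rw [hu, hN]
    exact D.expAd_sub_mem hy N hx
  · rw [hu', hN]
    exact D.expAd_sub_mem (neg_mem hy) N hx

/-- One step in the reduction of `e₀ + b` to the slice. -/
def step (b : g) : g := D.exp (D.η b) (D.e₀ + b) - D.e₀

lemma isPolyMap_step : IsPolyMap D.step := by
  have h := IsPolyMap.expAd (2 * D.bound) (IsPolyMap.of_linear D.η)
    ((IsPolyMap.const (E := g) D.e₀).add (IsPolyMap.of_linear LinearMap.id))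
  have h' := h.add (IsPolyMap.const (-D.e₀))
  simp only [← sub_eq_add_neg] at h'
  exact h'

lemma e₀_mem : D.e₀ ∈ D.fil 1 := D.mem_fil_of_proj D.proj_e₀

lemma step_mem {b : g} (hb : b ∈ D.fil 0) : D.step b ∈ D.fil 0 := by
  obtain ⟨u, hu, hue⟩ := D.exists_unipotent_exp (D.η_mem b)
  rw [step, ← hue, map_add, add_sub_right_comm]
  exact add_mem (hu.sub_mem 1 _ D.e₀_mem) (hu.mem_fil hb)

lemma η_step_mem {b : g} (hb : b ∈ D.fil 0) {k : ℤ} (hk : 1 ≤ k) (h : D.η b ∈ D.fil (-k)) :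
    D.η (D.step b) ∈ D.fil (-k - 1) := by
  obtain ⟨N, hN⟩ := D.exists_two_mul_bound
  obtain ⟨M, rfl⟩ : ∃ M, N = M + 1 := ⟨N - 1, by unfold bound at hN; omega⟩
  have hstep : D.step b = (b - ⁅D.e₀, D.η b⁆) + (⁅D.η b, b⁆ +
      ∑ j ∈ Finset.range M, ((j + 2).factorial : ℂ)⁻¹ • (ad ℂ g (D.η b) ^ (j + 2)) (D.e₀ + b)) := by
    rw [step, exp, hN, expAd_apply, Finset.sum_range_succ', Finset.sum_range_succ',
      ← lie_skew D.e₀ (D.η b)]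
    simp only [pow_zero, Nat.factorial_zero, Nat.cast_one, inv_one, one_smul, Module.End.one_apply,
      zero_add, pow_one, Nat.factorial_one, ad_apply, lie_add, add_assoc, Nat.reduceAdd]
    abel
  rw [hstep, map_add, map_sub, D.η_lie (D.η_mem b), sub_self, zero_add]
  apply D.η_mem_fil
  refine add_mem (by simpa using D.lie_mem_fil h hb) (sum_mem fun j _ => Submodule.smul_mem _ _ ?_)
  have := D.ad_pow_mem_fil h (add_mem D.e₀_mem (D.fil_mono (by omega) hb)) (j + 2)
  refine D.fil_mono ?_ this
  push_cast
  nlinarith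

lemma iterate_step {b : g} (hb : b ∈ D.fil 0) (n : ℕ) :
    D.step^[n] b ∈ D.fil 0 ∧ D.η (D.step^[n] b) ∈ D.fil (-n - 1) ∧
      ∃ u, D.Unipotent u ∧ u (D.e₀ + b) = D.e₀ + D.step^[n] b := by
  induction n with
  | zero => exact ⟨hb, by simpa using D.η_mem b, LieEquiv.refl, D.unipotent_refl, rfl⟩
  | succ n ih =>
    obtain ⟨h1, h2, u, hu, hu'⟩ := ih
    rw [Function.iterate_succ_apply']
    refine ⟨D.step_mem h1, ?_, ?_⟩
    · have := D.η_step_mem h1 (k := n + 1) (by omega) (by convert h2 using 2; ring)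
      convert this using 2
      push_cast
      ring
    · obtain ⟨v, hv, hv'⟩ := D.exists_unipotent_exp (D.η_mem (D.step^[n] b))
      refine ⟨u.trans v, hu.trans hv, ?_⟩
      rw [LieEquiv.trans_apply, hu', hv', step]
      abel

/-- The reduction of `e₀ + b` to the slice. -/
def reduce (b : g) : g := D.step^[D.bound] b

lemma isPolyMap_reduce : IsPolyMap D.reduce := by
  have : ∀ n, IsPolyMap D.step^[n] := by
    intro n
    induction n with
    | zero => exact IsPolyMap.of_linear LinearMap.id
    | succ n ih =>
      rw [Function.iterate_succ']
      exact D.isPolyMap_step.comp ih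
  exact this _

lemma reduce_mem {b : g} (hb : b ∈ D.fil 0) : D.reduce b ∈ D.slice := by
  obtain ⟨h1, h2, -⟩ := D.iterate_step hb D.bound
  exact ⟨D.eq_zero_of_mem_fil (by omega) h2, h1⟩

lemma exists_unipotent_reduce {b : g} (hb : b ∈ D.fil 0) :
    ∃ u, D.Unipotent u ∧ u (D.e₀ + b) = D.e₀ + D.reduce b :=
  (D.iterate_step hb D.bound).2.2

end RootDatum

end Kostant

namespace Kostant

namespace RootDatum

variable {g} {t : LieSubalgebra ℂ g} (D : RootDatum g t)

lemma proj_proj_self (k : ℤ) (x : g) : D.proj k (D.proj k x) = D.proj k x := by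
  rw [proj_proj, if_pos rfl]

lemma proj_lie_of_right {m : ℤ} {a : g} (ha : D.proj m a = a) (k : ℤ) (x : g) :
    D.proj (k + m) ⁅x, a⁆ = ⁅D.proj k x, a⁆ := by
  rw [← lie_skew, map_neg, D.proj_lie_of_left ha, lie_skew]

/-- The degree `-k` part of an endomorphism. -/
def symbol (φ : g →ₗ[ℂ] g) (k : ℤ) : g →ₗ[ℂ] g :=
  ∑ j ∈ D.degrees, D.proj (j - k) ∘ₗ φ ∘ₗ D.proj j

lemma symbol_apply {φ : g →ₗ[ℂ] g} (k : ℤ) {j : ℤ} {x : g} (hx : D.proj j x = x) :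
    D.symbol φ k x = D.proj (j - k) (φ x) := by
  have : ∀ i ∈ D.degrees, D.proj (i - k) (φ (D.proj i x)) =
      if j = i then D.proj (j - k) (φ x) else 0 := by
    intro i _
    split_ifs with h
    · rw [← h, hx]
    · rw [← hx, proj_proj, if_neg (Ne.symm h), map_zero, map_zero]
  simp only [symbol, LinearMap.sum_apply, LinearMap.comp_apply]
  rw [Finset.sum_congr rfl this, Finset.sum_ite_eq]
  split_ifs with h
  · rfl
  · rw [← hx, D.proj_eq_zero h, map_zero, map_zero]

lemma symbol_lie {u : g ≃ₗ⁅ℂ⁆ g} {k : ℤ} (hk : 1 ≤ k)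
    (h : ∀ j, ∀ x ∈ D.fil j, u x - x ∈ D.fil (j - k)) (x y : g) :
    D.symbol (u.toLinearMap - LinearMap.id) k ⁅x, y⁆ =
      ⁅x, D.symbol (u.toLinearMap - LinearMap.id) k y⁆ -
      ⁅y, D.symbol (u.toLinearMap - LinearMap.id) k x⁆ := by
  set φ : g →ₗ[ℂ] g := u.toLinearMap - LinearMap.id
  have hφ : ∀ z, φ z = u z - z := fun z => rfl
  have key : ∀ i j x y, D.proj i x = x → D.proj j y = y →
      D.symbol φ k ⁅x, y⁆ = ⁅x, D.symbol φ k y⁆ - ⁅y, D.symbol φ k x⁆ := by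
    intro i j x y hx hy
    have hxy : D.proj (i + j) ⁅x, y⁆ = ⁅x, y⁆ := by rw [D.proj_lie_of_right hy, hx]
    rw [D.symbol_apply k hxy, D.symbol_apply k hx, D.symbol_apply k hy,
      ← lie_skew y, sub_neg_eq_add]
    have h1 : φ ⁅x, y⁆ = ⁅x, φ y⁆ + ⁅φ x, y⁆ + ⁅φ x, φ y⁆ := by
      simp only [hφ, LieEquiv.map_lie, lie_sub, sub_lie]
      abel
    have h2 : D.proj (i + j - k) ⁅φ x, φ y⁆ = 0 :=
      D.lie_mem_fil (h i x (D.mem_fil_of_proj hx)) (h j y (D.mem_fil_of_proj hy)) _ (by omega)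
    rw [h1, map_add, map_add, h2, add_zero, show i + j - k = (j - k) + i by ring,
      D.proj_lie_of_left hx, show (j - k) + i = (i - k) + j by ring, D.proj_lie_of_right hy]
  conv_lhs => rw [← D.sum_proj x, ← D.sum_proj y]
  conv_rhs => rw [← D.sum_proj x, ← D.sum_proj y]
  simp only [lie_sum, sum_lie, map_sum]
  rw [Finset.sum_comm (f := fun i j => ⁅D.proj j y, D.symbol φ k (D.proj i x)⁆),
    ← Finset.sum_sub_distrib]
  refine Finset.sum_congr rfl fun j _ => ?_
  rw [← Finset.sum_sub_distrib]
  refine Finset.sum_congr rfl fun i _ => ?_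
  exact key _ _ _ _ (D.proj_proj_self _ _) (D.proj_proj_self _ _)

section Uniqueness

variable [LieAlgebra.IsSemisimple ℂ g]

lemma exists_symbol_eq_lie {u : g ≃ₗ⁅ℂ⁆ g} {k : ℤ} (hk : 1 ≤ k)
    (h : ∀ j, ∀ x ∈ D.fil j, u x - x ∈ D.fil (j - k)) :
    ∃ y, D.proj (-k) y = y ∧ ∀ x, D.symbol (u.toLinearMap - LinearMap.id) k x = ⁅y, x⁆ := by
  obtain ⟨y, hy⟩ := LieDerivation.IsKilling.exists_eq_ad
    (⟨D.symbol (u.toLinearMap - LinearMap.id) k, D.symbol_lie hk h⟩ : LieDerivation ℂ g g)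
  have hy' : ∀ x, D.symbol (u.toLinearMap - LinearMap.id) k x = ⁅y, x⁆ := by
    intro x
    have := congrArg (fun d => d x) hy
    simpa using this.symm
  refine ⟨D.proj (-k) y, D.proj_proj_self _ _, fun x => ?_⟩
  rw [← D.sum_proj x, map_sum, lie_sum]
  refine Finset.sum_congr rfl fun j _ => ?_
  have hj := D.proj_proj_self j x
  rw [← D.proj_lie_of_right hj, ← hy', D.symbol_apply k hj, D.proj_proj, if_pos]
  ring

lemma slice_unique {u : g ≃ₗ⁅ℂ⁆ g} (hu : D.Unipotent u) {b b' : g} (hb : b ∈ D.slice)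
    (hb' : b' ∈ D.slice) (h : u (D.e₀ + b) = D.e₀ + b') : b = b' := by
  have key : ∀ n : ℕ, ∀ j, ∀ x ∈ D.fil j, u x - x ∈ D.fil (j - (n + 1)) := by
    intro n
    induction n with
    | zero => simpa using hu.sub_mem
    | succ n ih =>
      obtain ⟨y, hy, hyx⟩ := D.exists_symbol_eq_lie (k := n + 1) (by omega) ih
      have h1 : D.proj (1 - (n + 1 : ℤ)) (b' - b) = ⁅y, D.e₀⁆ := by
        rw [← hyx, D.symbol_apply _ D.proj_e₀, LinearMap.sub_apply, LinearMap.id_apply]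
        have h2 : u D.e₀ - D.e₀ = (b' - b) - (u b - b) := by
          rw [map_add] at h
          rw [eq_sub_of_add_eq h]
          abel
        change _ = D.proj _ (u D.e₀ - D.e₀)
        rw [h2, map_sub (D.proj _) (b' - b) (u b - b), ih 0 b hb.2 _ (by omega), sub_zero]
      have hy0 : y = 0 := by
        refine D.eq_zero_of_lie_mem_slice
          (D.fil_mono (by omega) (D.mem_fil_of_proj hy)) ?_
        rw [← lie_skew, ← h1]
        exact neg_mem (D.proj_mem_slice (sub_mem hb' hb) _)
      intro j x hx
      have h3 : u (D.proj j x) - D.proj j x ∈ D.fil (j - (n + 1) - 1) := by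
        refine D.mem_fil_of_proj_eq_zero (ih j _ (D.proj_mem_fil le_rfl x)) ?_
        have := hyx (D.proj j x)
        rw [D.symbol_apply _ (D.proj_proj_self j x), hy0, zero_lie] at this
        exact this
      have h4 := ih (j - 1) _ (D.sub_proj_mem hx)
      have h5 : u x - x = (u (D.proj j x) - D.proj j x) +
          (u (x - D.proj j x) - (x - D.proj j x)) := by
        rw [map_sub]; abel
      rw [h5]
      refine add_mem (D.fil_mono ?_ h3) (D.fil_mono ?_ h4) <;> push_cast <;> omega
  have h0 : ∀ x, u x - x = 0 := fun x => by
    refine D.eq_zero_of_mem_fil (k := -D.bound) le_rfl ?_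
    refine D.fil_mono ?_ (key (2 * D.bound) D.bound x (D.fil_bound le_rfl x))
    push_cast
    omega
  have h1 := h0 (D.e₀ + b)
  rw [h, sub_eq_zero] at h1
  exact (add_left_cancel h1).symm

end Uniqueness

/-! ### The restriction of the slice to the Cartan subalgebra -/

/-- The polynomial map from the Cartan subalgebra to the slice. -/
def toSlice (H : t) : g := D.reduce H

lemma isPolyMap_toSlice : IsPolyMap D.toSlice :=
  D.isPolyMap_reduce.comp (IsPolyMap.of_linear t.toSubmodule.subtype)

lemma t_mem_fil (H : t) : (H : g) ∈ D.fil 0 := D.mem_fil_of_proj (D.proj_t H)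

lemma toSlice_mem (H : t) : D.toSlice H ∈ D.slice := D.reduce_mem (D.t_mem_fil H)

lemma exists_unipotent_toSlice (H : t) :
    ∃ u, D.Unipotent u ∧ u (D.e₀ + H) = D.e₀ + D.toSlice H :=
  D.exists_unipotent_reduce (D.t_mem_fil H)

/-- The simple reflections. -/
def refl (j : D.ι) (H : t) : t := H - D.α j H • D.h j

lemma exists_unipotent_refl (j : D.ι) (H : t) :
    ∃ u, D.Unipotent u ∧ u (D.e₀ + H) = D.e₀ + D.refl j H := by
  have hf : D.α j H • D.f j ∈ D.fil (-1) :=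
    Submodule.smul_mem _ _ (D.mem_fil_of_proj (D.proj_f j))
  obtain ⟨u, hu, hue⟩ := D.exists_unipotent_exp hf
  refine ⟨u, hu, ?_⟩
  set c := D.α j H
  have h0 : ⁅D.f j, D.e₀⁆ = -(D.h j : g) := by
    rw [e₀, lie_sum, Finset.sum_eq_single j, ← lie_skew, D.lie_ef]
    · intro i _ hij
      rw [← lie_skew, D.lie_ef_ne i j hij, neg_zero]
    · simp
  have h1 : ⁅c • D.f j, D.e₀ + (H : g)⁆ = (-c) • (D.h j : g) + (c * c) • D.f j := by
    rw [smul_lie, lie_add, h0, ← lie_skew, D.lie_f, smul_add, neg_neg, smul_smul]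
    simp [c]
  have h2 : ⁅c • D.f j, (-c) • (D.h j : g) + (c * c) • D.f j⁆ = (-(2 * (c * c))) • D.f j := by
    rw [smul_lie, lie_add, lie_smul, lie_smul, lie_self, ← lie_skew, D.lie_f, D.α_h, smul_zero,
      add_zero, neg_neg, smul_smul, smul_smul]
    ring_nf
  have h3 : ⁅c • D.f j, (-(2 * (c * c))) • D.f j⁆ = 0 := by
    rw [smul_lie, lie_smul, lie_self, smul_zero, smul_zero]
  have h4 : ∀ k, (ad ℂ g (c • D.f j) ^ (k + 3)) (D.e₀ + (H : g)) = 0 := by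
    intro k
    rw [pow_add, Module.End.mul_apply]
    simp only [pow_succ', pow_zero, Module.End.mul_apply, Module.End.one_apply, ad_apply, h1, h2,
      h3, map_zero]
  obtain ⟨M, hM⟩ : ∃ M, 2 * D.bound = M + 3 := ⟨2 * D.bound - 3, by unfold bound; omega⟩
  have h5 : (1 / 2 : ℂ) • (2 * (c * c)) • D.f j = (c * c) • D.f j := by
    rw [smul_smul]
    congr 1
    ring
  have h6 : ∑ k ∈ Finset.range M, ((k + 1 + 1 + 1).factorial : ℂ)⁻¹ •
      (ad ℂ g (c • D.f j) ^ (k + 1 + 1 + 1)) (D.e₀ + (H : g)) = 0 :=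
    Finset.sum_eq_zero fun k _ => by rw [h4 k, smul_zero]
  rw [hue, exp, hM, expAd_apply, Finset.sum_range_succ', Finset.sum_range_succ',
    Finset.sum_range_succ', h6]
  simp only [zero_add, pow_succ', pow_zero, Module.End.mul_apply, Module.End.one_apply, ad_apply,
    h1, h2, Nat.factorial]
  norm_num
  rw [h5]
  change _ = D.e₀ + ((H : g) - c • (D.h j : g))
  abel

lemma toSlice_refl [LieAlgebra.IsSemisimple ℂ g] (j : D.ι) (H : t) :
    D.toSlice (D.refl j H) = D.toSlice H := by
  obtain ⟨u, hu, hu'⟩ := D.exists_unipotent_refl j H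
  obtain ⟨v, hv, hv'⟩ := D.exists_unipotent_toSlice H
  obtain ⟨w, hw, hw'⟩ := D.exists_unipotent_toSlice (D.refl j H)
  refine (D.slice_unique ((hv.symm.trans hu).trans hw) (D.toSlice_mem _) (D.toSlice_mem _) ?_).symm
  rw [LieEquiv.trans_apply, LieEquiv.trans_apply, ← hv', LieEquiv.symm_apply_apply, hu', hw']

lemma evalAt_e₀_add {p : PolyAlg g} (hp : p ∈ invariantPolynomials g) (H : t) :
    evalAt g (D.e₀ + H) p = evalAt g H p := by
  have h1 : ∀ s : ℂ, HasDerivAt (fun s : ℂ => evalAt g ((H : g) + s • D.e₀) p)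
      (diffAt g ((H : g) + s • D.e₀) p D.e₀) s := fun s => hasDerivAt_evalAt_line p _ _ s
  have h2 : ∀ s : ℂ, s ≠ 0 → diffAt g ((H : g) + s • D.e₀) p D.e₀ = 0 := by
    intro s hs
    have := mem_invariantPolynomials_iff.mp hp ((H : g) + s • D.e₀) D.h₀
    rw [lie_add, D.lie_t, lie_smul, D.proj_eq_self_iff.mp D.proj_e₀, zero_add] at this
    simpa [hs] using this
  have h3 : Differentiable ℂ (fun s : ℂ => evalAt g ((H : g) + s • D.e₀) p) :=
    fun s => (h1 s).differentiableAt
  have h4 : ∀ s : ℂ, deriv (fun s : ℂ => evalAt g ((H : g) + s • D.e₀) p) s = 0 := by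
    have hc : Continuous (deriv (fun s : ℂ => evalAt g ((H : g) + s • D.e₀) p)) :=
      (h3.contDiff (n := 1)).continuous_deriv le_rfl
    have hd : Dense ({0}ᶜ : Set ℂ) := dense_compl_singleton 0
    have := Continuous.ext_on hd hc continuous_const (g := fun _ => (0 : ℂ))
      (fun s hs => by rw [(h1 s).deriv, h2 s hs])
    exact congrFun this
  have := is_const_of_deriv_eq_zero h3 h4 1 0
  simpa [add_comm] using this

lemma evalAt_toSlice {p : PolyAlg g} (hp : p ∈ invariantPolynomials g) (H : t) :
    evalAt g (D.e₀ + D.toSlice H) p = evalAt g H p := by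
  obtain ⟨u, hu, hu'⟩ := D.exists_unipotent_toSlice H
  rw [← hu', hu.fixes p hp, D.evalAt_e₀_add hp]

lemma evalAt_refl {p : PolyAlg g} (hp : p ∈ invariantPolynomials g) (j : D.ι) (H : t) :
    evalAt g (D.refl j H) p = evalAt g H p := by
  obtain ⟨u, hu, hu'⟩ := D.exists_unipotent_refl j H
  rw [← D.evalAt_e₀_add hp, ← hu', hu.fixes p hp, D.evalAt_e₀_add hp]

end RootDatum

end Kostant

namespace Kostant

lemma totalDegree_pderiv_le {σ : Type*} {p : MvPolynomial σ ℂ} {n : ℕ} (h : p.totalDegree ≤ n + 1)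
    (i : σ) : (pderiv i p).totalDegree ≤ n := by
  rw [← sum_homogeneousComponent p, map_sum]
  refine totalDegree_finsetSum_le fun k hk => ?_
  refine ((homogeneousComponent_isHomogeneous k p).pderiv (i := i)).totalDegree_le.trans ?_
  have := Finset.mem_range.mp hk
  omega

lemma eq_zero_of_forall_pderiv {σ : Type*} (S : (σ → ℂ) → Prop) (x₀ : σ → ℂ) (hx₀ : S x₀)
    (hS : ∀ p : MvPolynomial σ ℂ, (∀ x, S x → aeval x p = 0) →
      ∀ i x, S x → aeval x (pderiv i p) = 0) (p : MvPolynomial σ ℂ)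
    (hp : ∀ x, S x → aeval x p = 0) : p = 0 := by
  classical
  have key : ∀ n (p : MvPolynomial σ ℂ), p.totalDegree ≤ n → (∀ x, S x → aeval x p = 0) → p = 0 := by
    intro n
    induction n with
    | zero =>
      intro p hn hp
      rw [totalDegree_eq_zero_iff_eq_C.mp (Nat.le_zero.mp hn)] at hp ⊢
      have := hp x₀ hx₀
      rw [aeval_C] at this
      rw [show p.coeff 0 = 0 from this, C_0]
    | succ n ih =>
      intro p hn hp
      have h0 : ∀ i, pderiv i p = 0 := fun i =>
        ih _ (totalDegree_pderiv_le hn i) fun x hx => hS p hp i x hx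
      have hc : p = C (p.coeff 0) := by
        ext m
        rw [coeff_C]
        split_ifs with hm
        · rw [hm]
        · obtain ⟨i, hi⟩ : ∃ i, m i ≠ 0 := by
            by_contra! hcon
            exact hm (Finsupp.ext hcon).symm
          have := congrArg (coeff (m - Finsupp.single i 1)) (h0 i)
          rw [coeff_pderiv, coeff_zero] at this
          have h2 : m - Finsupp.single i 1 + Finsupp.single i 1 = m :=
            tsub_add_cancel_of_le (by simpa [Nat.one_le_iff_ne_zero] using hi)
          rw [h2] at this
          refine (mul_eq_zero.mp this).resolve_right ?_
          exact Nat.cast_add_one_ne_zero _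
      rw [hc] at hp ⊢
      have := hp x₀ hx₀
      rw [aeval_C] at this
      rw [show p.coeff 0 = 0 from this, C_0]
  exact key _ p le_rfl hp

namespace RootDatum

variable {g} {t : LieSubalgebra ℂ g} (D : RootDatum g t)

lemma ad_pow_eq_zero_of_proj {k : ℤ} (hk : k ≠ 0) {y : g} (hy : D.proj k y = y) :
    (ad ℂ g y) ^ (2 * D.bound) = 0 := by
  have h1 : ∀ (n : ℕ) (j : ℤ) x, D.proj j x = x → D.proj (j + n * k) ((ad ℂ g y ^ n) x) = (ad ℂ g y ^ n) x := by
    intro n j x hx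
    induction n with
    | zero => simpa using hx
    | succ n ih =>
      rw [pow_succ', Module.End.mul_apply, ad_apply, show j + (n + 1 : ℕ) * k = j + n * k + k by
        push_cast; ring, D.proj_lie_of_left hy, ih]
  ext x
  rw [LinearMap.zero_apply, ← D.sum_proj x, map_sum]
  refine Finset.sum_eq_zero fun j hj => ?_
  rw [← h1 _ j _ (D.proj_proj_self j x)]
  refine D.proj_eq_zero (fun h => ?_) _
  have h2 := abs_lt.mp (D.abs_lt_bound hj)
  have h3 := abs_lt.mp (D.abs_lt_bound h)
  push_cast at h3
  rcases lt_or_gt_of_ne hk with hk | hk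
  · nlinarith
  · nlinarith

lemma proj_B (i : D.κ) : D.proj (D.deg i) (D.B i) = D.B i := by
  rw [proj_eq_self_iff, D.lie_h₀_B]

open scoped Classical in
/-- A regularity function on the Cartan subalgebra. -/
def disc (H : t) : ℂ := ∏ i ∈ Finset.univ.filter fun i => D.wt i ≠ 0, D.wt i H

open scoped Classical in
lemma disc_mem : D.disc ∈ polyFun t := by
  have := (polyFun t).prod_mem (t := Finset.univ.filter fun i => D.wt i ≠ 0)
    (f := fun i (H : t) => D.wt i H) fun i _ => dual_mem_polyFun _
  convert this using 1
  ext H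
  simp [disc]

open scoped Classical in
lemma disc_ne_zero : (⟨D.disc, D.disc_mem⟩ : polyFun t) ≠ 0 := by
  have : (⟨D.disc, D.disc_mem⟩ : polyFun t) =
      ∏ i ∈ Finset.univ.filter fun i => D.wt i ≠ 0, ⟨fun H => D.wt i H, dual_mem_polyFun _⟩ := by
    ext H
    simp [disc]
  rw [this, Finset.prod_ne_zero_iff]
  intro i hi h
  refine (Finset.mem_filter.mp hi).2 ?_
  ext H
  exact congrFun (congrArg Subtype.val h) H

lemma eq_zero_of_disc_mul {F : t → ℂ} (hF : F ∈ polyFun t) (h : ∀ H, D.disc H ≠ 0 → F H = 0) :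
    F = 0 := by
  have : (⟨D.disc, D.disc_mem⟩ : polyFun t) * ⟨F, hF⟩ = 0 := by
    ext H
    change D.disc H * F H = 0
    by_cases h0 : D.disc H = 0
    · rw [h0, zero_mul]
    · rw [h H h0, mul_zero]
  exact congrArg Subtype.val ((mul_eq_zero.mp this).resolve_left D.disc_ne_zero)

lemma exists_fixes_curve {i : D.κ} (hi : D.wt i ≠ 0) (s : ℂ) :
    ∃ u : g ≃ₗ⁅ℂ⁆ g, FixesInvariants u ∧ ∀ x, u x = expAd (2 * D.bound) (s • D.B i) x := by
  have h0 : (ad ℂ g (s • D.B i)) ^ (2 * D.bound) = 0 := by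
    rw [map_smul, smul_pow, D.ad_pow_eq_zero_of_proj (fun h => hi (D.wt_eq_zero_of_deg h))
      (D.proj_B i), smul_zero]
  obtain ⟨u, hu, -⟩ := exists_expAut h0
  exact ⟨u, fixesInvariants_of_expAd h0 hu, hu⟩

/-- An invariant polynomial is determined by its restriction to the Cartan subalgebra; more
generally, a polynomial vanishing on the saturation of the Cartan subalgebra is zero. -/
theorem eq_zero_of_vanish (D : RootDatum g t) (p : PolyAlg g)
    (hp : ∀ (u : g ≃ₗ⁅ℂ⁆ g) (_ : FixesInvariants u) (H : t), evalAt g (u H) p = 0) : p = 0 := by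
  classical
  refine eq_zero_of_forall_pderiv
    (fun v => ∃ (u : g ≃ₗ⁅ℂ⁆ g) (_ : FixesInvariants u) (H : t),
      v = fun i => (gBasis g).coord i (u H)) _
    ⟨LieEquiv.refl, fun _ _ _ => rfl, 0, rfl⟩ ?_ p ?_
  · rintro q hq j _ ⟨u, hu, H, rfl⟩
    have hq' : ∀ (u : g ≃ₗ⁅ℂ⁆ g) (_ : FixesInvariants u) (H : t), evalAt g (u H) q = 0 :=
      fun u hu H => hq _ ⟨u, hu, H, rfl⟩
    change evalAt g (u H) (pderiv j q) = 0
    have hmem : (fun H : t => evalAt g (u H) (pderiv j q)) ∈ polyFun t :=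
      (IsPolyMap.of_linear (u.toLinearMap ∘ₗ t.toSubmodule.subtype)).comp_mem
        (evalAt_mem_polyFun (pderiv j q))
    refine congrFun (D.eq_zero_of_disc_mul hmem fun H hH => ?_) H
    have hd : diffAt g (u H) q ∘ₗ u.toLinearMap = 0 := by
      refine D.B.ext fun i => ?_
      change diffAt g (u H) q (u (D.B i)) = 0
      by_cases hi : D.wt i = 0
      · have h1 := hasDerivAt_evalAt_line q (u H) (u (D.B i)) 0
        have h2 : (fun s : ℂ => evalAt g (u H + s • u (D.B i)) q) = fun _ => 0 := by
          ext s
          have := hq' u hu (H + s • ⟨D.B i, (D.wt_eq_zero i).mp hi⟩)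
          simpa using this
        rw [h2, zero_smul, add_zero] at h1
        exact h1.unique (hasDerivAt_const _ _)
      · have hnil := D.ad_pow_eq_zero_of_proj (fun h => hi (D.wt_eq_zero_of_deg h)) (D.proj_B i)
        have h1 := hasDerivAt_evalAt (γ := fun s => u (expAd (2 * D.bound) (s • D.B i) H))
          (v := u ⁅D.B i, expAd (2 * D.bound) ((0 : ℂ) • D.B i) (H : g)⁆) (s := 0) q
          (fun l => hasDerivAt_expAd hnil (H : g) (l ∘ₗ u.toLinearMap) 0)
        have h2 : (fun s : ℂ => evalAt g (u (expAd (2 * D.bound) (s • D.B i) H)) q) =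
            fun _ => 0 := by
          ext s
          obtain ⟨v, hv, hvx⟩ := D.exists_fixes_curve hi s
          have := hq' (v.trans u) (hv.trans hu) H
          rwa [LieEquiv.trans_apply, hvx] at this
        have h3 : expAd (2 * D.bound) ((0 : ℂ) • D.B i) (H : g) = H := by
          obtain ⟨N, hN⟩ := D.exists_two_mul_bound
          rw [hN, expAd_smul_apply, Finset.sum_range_succ']
          simp
        rw [h2, h3] at h1
        have h4 := h1.unique (hasDerivAt_const _ _)
        have hwt : D.wt i H ≠ 0 :=
          Finset.prod_ne_zero_iff.mp hH i (Finset.mem_filter.mpr ⟨Finset.mem_univ _, hi⟩)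
        rw [← lie_skew, D.lie_B, map_neg, map_smul, map_neg, map_smul, neg_eq_zero,
          smul_eq_mul] at h4
        exact (mul_eq_zero.mp h4).resolve_left hwt
    have := LinearMap.congr_fun hd (u.symm (gBasis g j))
    simp only [LinearMap.comp_apply, LinearMap.zero_apply] at this
    change diffAt g (u H) q (u (u.symm (gBasis g j))) = 0 at this
    rw [LieEquiv.apply_symm_apply, diffAt_apply] at this
    simpa [Finsupp.single_apply] using this
  · rintro _ ⟨u, hu, H, rfl⟩
    exact hp u hu H

theorem invariant_eq_zero (D : RootDatum g t) {p : PolyAlg g} (hp : p ∈ invariantPolynomials g)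
    (h : ∀ H : t, evalAt g H p = 0) : p = 0 :=
  D.eq_zero_of_vanish p fun u hu H => by rw [hu p hp, h]

end RootDatum

end Kostant

namespace Kostant

section Newton

variable {R J : Type*} [CommRing R] [Algebra ℂ R] [Fintype J]

lemma aeval_esymm_mem (S : Subalgebra ℂ R) (a : J → R) (h : ∀ k, ∑ i, a i ^ k ∈ S) (k : ℕ) :
    aeval a (esymm J ℂ k) ∈ S := by
  induction k using Nat.strong_induction_on with
  | _ k ih =>
    rcases Nat.eq_zero_or_pos k with rfl | hk
    · simp
    · have hN := congrArg (aeval a) (mul_esymm_eq_sum J ℂ k)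
      have hmem : (k : R) * aeval a (esymm J ℂ k) ∈ S := by
        have : (k : R) * aeval a (esymm J ℂ k) = aeval a ((k : MvPolynomial J ℂ) * esymm J ℂ k) := by simp
        rw [this, hN, map_mul, map_sum]
        refine S.mul_mem (by simpa using S.pow_mem (S.neg_mem S.one_mem) _) (S.sum_mem fun b hb => ?_)
        have hb' := (Finset.mem_filter.mp hb).2
        rw [map_mul, map_mul]
        refine S.mul_mem (S.mul_mem (by simpa using S.pow_mem (S.neg_mem S.one_mem) _) (ih _ hb')) ?_
        simpa [psum] using h b.2
      have := S.smul_mem hmem ((k : ℂ)⁻¹)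
      rwa [← nsmul_eq_mul, ← Nat.cast_smul_eq_nsmul ℂ, smul_smul,
        inv_mul_cancel₀ (by exact_mod_cast hk.ne'), one_smul] at this

theorem coeff_prod_mem (S : Subalgebra ℂ R) (a : J → R) (h : ∀ k, ∑ i, a i ^ k ∈ S) (k : ℕ) :
    (∏ i, (Polynomial.X - Polynomial.C (a i))).coeff k ∈ S := by
  have e : ∏ i, (Polynomial.X - Polynomial.C (a i)) =
      ((Finset.univ.val.map a).map fun r => Polynomial.X - Polynomial.C r).prod := by
    rw [Multiset.map_map]; rfl
  rw [e, Multiset.prod_X_sub_X_eq_sum_esymm, Polynomial.finsetSum_coeff]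
  refine S.sum_mem fun j _ => ?_
  rw [← aeval_esymm_eq_multiset_esymm J ℂ]
  have hs : ((-1 : Polynomial R) ^ j * (Polynomial.C (aeval a (esymm J ℂ j)) *
      Polynomial.X ^ ((Finset.univ.val.map a).card - j))).coeff k =
      (-1) ^ j * (aeval a (esymm J ℂ j) *
        (Polynomial.X ^ ((Finset.univ.val.map a).card - j) : Polynomial R).coeff k) := by
    rw [show (-1 : Polynomial R) ^ j = Polynomial.C ((-1) ^ j) by simp, Polynomial.coeff_C_mul,
      Polynomial.coeff_C_mul]
  rw [hs, Polynomial.coeff_X_pow]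
  refine S.mul_mem (S.pow_mem (S.neg_mem S.one_mem) _) (S.mul_mem (aeval_esymm_mem S a h j) ?_)
  split_ifs
  · exact S.one_mem
  · exact S.zero_mem

lemma prod_map_eq (τ : R →ₐ[ℂ] R) (a : J → R) (h : ∀ k, τ (∑ i, a i ^ k) = ∑ i, a i ^ k) :
    ∏ i, (Polynomial.X - Polynomial.C (τ (a i))) = ∏ i, (Polynomial.X - Polynomial.C (a i)) := by
  have : (∏ i, (Polynomial.X - Polynomial.C (a i))).map (τ : R →+* R) =
      ∏ i, (Polynomial.X - Polynomial.C (a i)) := by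
    ext k
    rw [Polynomial.coeff_map]
    exact coeff_prod_mem (AlgHom.equalizer τ (AlgHom.id ℂ R)) a h k
  rw [← this, Polynomial.map_prod]
  simp

theorem exists_eq_of_fixed [IsDomain R] (τ : R →ₐ[ℂ] R) (a : J → R)
    (h : ∀ k, τ (∑ i, a i ^ k) = ∑ i, a i ^ k) (i : J) : ∃ i', τ (a i) = a i' := by
  have h1 := congrArg (Polynomial.eval (τ (a i))) (prod_map_eq τ a h)
  rw [Polynomial.eval_prod, Polynomial.eval_prod,
    Finset.prod_eq_zero (Finset.mem_univ i) (by simp)] at h1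
  obtain ⟨i', -, hi'⟩ := Finset.prod_eq_zero_iff.mp h1.symm
  exact ⟨i', by simpa [sub_eq_zero] using hi'⟩

theorem exists_eq_of_fixed' [IsDomain R] (τ : R →ₐ[ℂ] R) (a : J → R)
    (h : ∀ k, τ (∑ i, a i ^ k) = ∑ i, a i ^ k) (i : J) : ∃ i', a i = τ (a i') := by
  have h1 := congrArg (Polynomial.eval (a i)) (prod_map_eq τ a h)
  have h2 : ∏ j, (Polynomial.X - Polynomial.C (a j)).eval (a i) = 0 :=
    Finset.prod_eq_zero (Finset.mem_univ i) (by simp)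
  rw [Polynomial.eval_prod, Polynomial.eval_prod, h2] at h1
  obtain ⟨i', -, hi'⟩ := Finset.prod_eq_zero_iff.mp h1
  exact ⟨i', by simpa [sub_eq_zero] using hi'⟩

end Newton

section Traces

variable {g} {J : Type} [Fintype J] [DecidableEq J]

lemma matrix_entry_polyFun (ρ : g →ₗ[ℂ] Matrix J J ℂ) (k : ℕ) (a b : J) :
    (fun x => (ρ x ^ k) a b) ∈ polyFun g := by
  induction k generalizing b with
  | zero =>
    simp only [pow_zero]
    exact (polyFun g).algebraMap_mem ((1 : Matrix J J ℂ) a b)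
  | succ k ih =>
    have : (fun x => (ρ x ^ (k + 1)) a b) =
        ∑ c, (fun x => (ρ x ^ k) a c) * fun x => (ρ x) c b := by
      ext x; simp [pow_succ, Matrix.mul_apply]
    rw [this]
    refine (polyFun g).sum_mem fun c _ => (polyFun g).mul_mem (ih c) ?_
    exact dual_mem_polyFun ((LinearMap.proj b ∘ₗ LinearMap.proj c ∘ₗ ρ : g →ₗ[ℂ] ℂ))

lemma hasDerivAt_matrix_pow (X Y : Matrix J J ℂ) (k : ℕ) (a b : J) :
    HasDerivAt (fun s : ℂ => ((X + s • (Y * X - X * Y)) ^ k) a b)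
      ((Y * X ^ k - X ^ k * Y) a b) 0 := by
  induction k generalizing b with
  | zero => simpa using hasDerivAt_const (0 : ℂ) _
  | succ k ih =>
    have h1 : ∀ c, HasDerivAt (fun s : ℂ => (X + s • (Y * X - X * Y)) c b)
        ((Y * X - X * Y) c b) 0 := fun c => by
      simpa using ((hasDerivAt_id (0 : ℂ)).mul_const ((Y * X - X * Y) c b)).const_add (X c b)
    have h2 := HasDerivAt.fun_sum (u := Finset.univ) fun c _ => (ih c).fun_mul (h1 c)
    have h3 : (fun s : ℂ => ((X + s • (Y * X - X * Y)) ^ (k + 1)) a b) = fun s => ∑ c,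
        ((X + s • (Y * X - X * Y)) ^ k) a c * (X + s • (Y * X - X * Y)) c b := by
      ext s; rw [pow_succ, Matrix.mul_apply]
    rw [h3]
    refine h2.congr_deriv ?_
    have : Y * X ^ (k + 1) - X ^ (k + 1) * Y =
        (Y * X ^ k - X ^ k * Y) * X + X ^ k * (Y * X - X * Y) := by noncomm_ring
    rw [this]
    simp [Matrix.mul_apply, Finset.sum_add_distrib, Matrix.add_apply]

theorem exists_invariant_trace (ρ : g →ₗ[ℂ] Matrix J J ℂ)
    (hρ : ∀ x y, ρ ⁅x, y⁆ = ρ x * ρ y - ρ y * ρ x) (k : ℕ) :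
    ∃ p ∈ invariantPolynomials g, ∀ x, evalAt g x p = (ρ x ^ k).trace := by
  have hmem : (fun x => (ρ x ^ k).trace) ∈ polyFun g := by
    have : (fun x => (ρ x ^ k).trace) = ∑ a, fun x => (ρ x ^ k) a a := by
      ext x; simp [Matrix.trace]
    rw [this]
    exact (polyFun g).sum_mem fun a _ => matrix_entry_polyFun ρ k a a
  obtain ⟨p, hp⟩ := exists_evalAt_eq hmem
  refine ⟨p, mem_invariantPolynomials_iff.mpr fun x y => ?_, hp⟩
  have h1 := hasDerivAt_evalAt_line p x ⁅y, x⁆ 0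
  have h2 : HasDerivAt (fun s : ℂ => evalAt g (x + s • ⁅y, x⁆) p)
      ((ρ y * ρ x ^ k - ρ x ^ k * ρ y).trace) 0 := by
    have := HasDerivAt.fun_sum (u := Finset.univ) fun a _ =>
      hasDerivAt_matrix_pow (ρ x) (ρ y) k a a
    have e : (fun s : ℂ => evalAt g (x + s • ⁅y, x⁆) p) = fun s => ∑ a,
        ((ρ x + s • (ρ y * ρ x - ρ x * ρ y)) ^ k) a a := by
      ext s
      rw [hp, map_add, map_smul, hρ]
      rfl
    rw [e]
    exact this
  have h3 := h1.unique h2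
  rw [Matrix.trace_sub, Matrix.trace_mul_comm, sub_self] at h3
  simpa using h3

end Traces

namespace RootDatum

variable {g} {t : LieSubalgebra ℂ g} (D : RootDatum g t)

theorem exists_invariant_weights {J : Type} [Fintype J] (ρ : g →ₗ[ℂ] Matrix J J ℂ)
    [DecidableEq J] (hρ : ∀ x y, ρ ⁅x, y⁆ = ρ x * ρ y - ρ y * ρ x) (μ : J → Dual ℂ t)
    (hμ : ∀ H : t, ρ H = Matrix.diagonal fun a => μ a H) (k : ℕ) :
    ∃ p ∈ invariantPolynomials g, ∀ H : t, evalAt g H p = ∑ a, μ a H ^ k := by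
  obtain ⟨p, hp, h⟩ := exists_invariant_trace ρ hρ k
  refine ⟨p, hp, fun H => ?_⟩
  rw [h, hμ, Matrix.diagonal_pow, Matrix.trace_diagonal]
  rfl

theorem exists_invariant_wt (k : ℕ) :
    ∃ p ∈ invariantPolynomials g, ∀ H : t, evalAt g H p = ∑ i, D.wt i H ^ k := by
  refine exists_invariant_weights
    ((LinearMap.toMatrix D.B D.B).toLinearMap ∘ₗ (ad ℂ g : g →ₗ[ℂ] Module.End ℂ g)) ?_ D.wt ?_ k
  · intro x y
    simp only [LinearMap.comp_apply, LinearEquiv.coe_coe, LieHom.coe_toLinearMap, LieHom.map_lie]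
    rw [LieRing.of_associative_ring_bracket, map_sub, LinearMap.toMatrix_mul, LinearMap.toMatrix_mul]
  · intro H
    ext a b
    simp only [LinearMap.comp_apply, LinearEquiv.coe_coe, LieHom.coe_toLinearMap,
      LinearMap.toMatrix_apply, Matrix.diagonal_apply]
    rw [ad_apply ℂ g, D.lie_B]
    by_cases h : a = b
    · subst h; simp
    · simp [h]

end RootDatum

end Kostant

namespace Kostant

section Galois

lemma isIntegrallyClosed_of_quotients {R : Type*} [CommRing R] [IsDomain R] [IsIntegrallyClosed R]
    (A : Type*) [CommRing A] [IsDomain A] [Algebra A R]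
    (hinj : Function.Injective (algebraMap A R))
    (h : ∀ a b : A, b ≠ 0 → ∀ c : R, algebraMap A R a = algebraMap A R b * c →
      ∃ d, algebraMap A R d = c) : IsIntegrallyClosed A := by
  rw [isIntegrallyClosed_iff (FractionRing A)]
  intro x hx
  have hinj' : Function.Injective (algebraMap A (FractionRing R)) := by
    rw [IsScalarTower.algebraMap_eq A R (FractionRing R)]
    exact (IsFractionRing.injective R (FractionRing R)).comp hinj
  let θ : FractionRing A →ₐ[A] FractionRing R :=
    IsFractionRing.liftAlgHom (g := Algebra.ofId A (FractionRing R)) hinj'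
  have h1 : IsIntegral R (θ x) := (hx.map θ).tower_top
  obtain ⟨c, hc⟩ := IsIntegrallyClosed.isIntegral_iff.mp h1
  obtain ⟨a, b, hb, rfl⟩ := IsFractionRing.div_surjective (A := A) x
  have hb0 : b ≠ 0 := nonZeroDivisors.ne_zero hb
  have hbK : algebraMap A (FractionRing A) b ≠ 0 := by simpa using hb0
  have h2 : algebraMap A R a = algebraMap A R b * c := by
    apply IsFractionRing.injective R (FractionRing R)
    rw [map_mul, hc, map_div₀, θ.commutes, θ.commutes, ← IsScalarTower.algebraMap_apply,
      ← IsScalarTower.algebraMap_apply, mul_div_cancel₀]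
    rw [Ne, ← map_zero (algebraMap A (FractionRing R)), hinj'.eq_iff]
    exact hb0
  obtain ⟨d, rfl⟩ := h a b hb0 c h2
  refine ⟨d, ?_⟩
  rw [← map_mul] at h2
  rw [hinj h2, map_mul, mul_div_cancel_left₀ _ hbK]

variable {A P : Type*} [CommRing A] [IsDomain A] [CommRing P] [IsDomain P] [Algebra A P]
  {J : Type*} [Fintype J] (a : J → P)

lemma mem_range_of_fixed_aux (K L : Type*) [Field K] [Field L] [Algebra A K] [IsFractionRing A K]
    [Algebra P L] [IsFractionRing P L] [Algebra A L] [IsScalarTower A P L] [Algebra K L]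
    [IsScalarTower A K L] [CharZero K] [IsIntegrallyClosed A]
    (hinj : Function.Injective (algebraMap A P))
    (ha : Algebra.adjoin A (Set.range a) = ⊤) (Q : Polynomial A)
    (hQ : Q.map (algebraMap A P) = ∏ i, (Polynomial.X - Polynomial.C (a i)))
    (φ : P) (hφ : ∀ τ : P →ₐ[A] P, τ φ = φ) : ∃ c, algebraMap A P c = φ := by
  have hPL := IsFractionRing.injective P L
  have hQL : (Q.map (algebraMap A K)).map (algebraMap K L) =
      ∏ i, (Polynomial.X - Polynomial.C (algebraMap P L (a i))) := by
    rw [Polynomial.map_map, ← IsScalarTower.algebraMap_eq, IsScalarTower.algebraMap_eq A P L,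
      ← Polynomial.map_map, hQ, Polynomial.map_prod]
    simp
  have hQ0 : (Q.map (algebraMap A K)).map (algebraMap K L) ≠ 0 := by
    rw [hQL]
    exact Finset.prod_ne_zero_iff.mpr fun i _ => Polynomial.X_sub_C_ne_zero _
  have hQ0' : Q.map (algebraMap A K) ≠ 0 := fun h => hQ0 (by rw [h, Polynomial.map_zero])
  have hroot : ∀ x : L, Polynomial.aeval x (Q.map (algebraMap A K)) = 0 →
      ∃ i, x = algebraMap P L (a i) := by
    intro x hx
    rw [Polynomial.aeval_def, ← Polynomial.eval_map, hQL, Polynomial.eval_prod,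
      Finset.prod_eq_zero_iff] at hx
    obtain ⟨i, -, hi⟩ := hx
    exact ⟨i, by simpa [sub_eq_zero] using hi⟩
  have hroot' : ∀ i, Polynomial.aeval (algebraMap P L (a i)) (Q.map (algebraMap A K)) = 0 := by
    intro i
    rw [Polynomial.aeval_def, ← Polynomial.eval_map, hQL, Polynomial.eval_prod]
    exact Finset.prod_eq_zero (Finset.mem_univ i) (by simp)
  have hmem : ∀ E : IntermediateField K L, (∀ i, algebraMap P L (a i) ∈ E) →
      ∀ p, algebraMap P L p ∈ E := by
    intro E hE p
    have hp : p ∈ Algebra.adjoin A (Set.range a) := by rw [ha]; trivial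
    induction hp using Algebra.adjoin_induction with
    | mem x hx => obtain ⟨i, rfl⟩ := hx; exact hE i
    | algebraMap r =>
      rw [← IsScalarTower.algebraMap_apply, IsScalarTower.algebraMap_apply A K L]
      exact E.algebraMap_mem _
    | add x y _ _ hx hy => rw [map_add]; exact E.add_mem hx hy
    | mul x y _ _ hx hy => rw [map_mul]; exact E.mul_mem hx hy
  have hsplit : Polynomial.IsSplittingField K L (Q.map (algebraMap A K)) := by
    rw [isSplittingField_iff_intermediateField]
    refine ⟨?_, ?_⟩
    · rw [hQL]
      exact Polynomial.Splits.prod fun i _ => Polynomial.Splits.X_sub_C _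
    · rw [eq_top_iff]
      intro x _
      obtain ⟨p, q, -, rfl⟩ := IsFractionRing.div_surjective (A := P) x
      have hall := hmem (IntermediateField.adjoin K ((Q.map (algebraMap A K)).rootSet L))
        fun i => IntermediateField.subset_adjoin _ _
          ((Polynomial.mem_rootSet_of_ne hQ0').mpr (hroot' i))
      exact IntermediateField.div_mem _ (hall p) (hall q)
  have hnorm : Normal K L := Normal.of_isSplittingField (Q.map (algebraMap A K))
  have hfin : FiniteDimensional K L :=
    Polynomial.IsSplittingField.finiteDimensional L (Q.map (algebraMap A K))
  have hgal : IsGalois K L := { }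
  have hfix : ∀ τ : Gal(L/K), τ (algebraMap P L φ) = algebraMap P L φ := by
    intro τ
    have hτ : ∀ p, τ (algebraMap P L p) ∈ (IsScalarTower.toAlgHom A P L).range := by
      intro p
      have hp : p ∈ Algebra.adjoin A (Set.range a) := by rw [ha]; trivial
      induction hp using Algebra.adjoin_induction with
      | mem x hx =>
        obtain ⟨i, rfl⟩ := hx
        obtain ⟨i', hi'⟩ := hroot (τ (algebraMap P L (a i))) (by
          rw [← AlgEquiv.coe_toAlgHom, Polynomial.aeval_algHom_apply, hroot', map_zero])
        exact ⟨a i', hi'.symm⟩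
      | algebraMap r =>
        rw [← IsScalarTower.algebraMap_apply, IsScalarTower.algebraMap_apply A K L, τ.commutes,
          ← IsScalarTower.algebraMap_apply]
        exact Subalgebra.algebraMap_mem _ r
      | add x y _ _ hx hy => rw [map_add, map_add]; exact Subalgebra.add_mem _ hx hy
      | mul x y _ _ hx hy => rw [map_mul, map_mul]; exact Subalgebra.mul_mem _ hx hy
    let τ₁ : P →ₐ[A] L := ((τ : L →ₐ[K] L).restrictScalars A).comp (IsScalarTower.toAlgHom A P L)
    let ε := AlgEquiv.ofInjective (IsScalarTower.toAlgHom A P L) hPL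
    let τ' : P →ₐ[A] P := (ε.symm : _ →ₐ[A] P).comp (τ₁.codRestrict _ hτ)
    have h1 : ε (τ' φ) = τ₁.codRestrict _ hτ φ := ε.apply_symm_apply _
    rw [hφ τ'] at h1
    exact (congrArg Subtype.val h1).symm
  obtain ⟨k, hk⟩ := IntermediateField.mem_bot.mp ((IsGalois.mem_bot_iff_fixed _).mpr hfix)
  have hmonic : Q.Monic := by
    refine Polynomial.monic_of_injective hinj ?_
    rw [hQ]
    exact Polynomial.monic_prod_of_monic _ _ fun i _ => Polynomial.monic_X_sub_C _
  have h_int : IsIntegral A φ := by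
    have hall : Algebra.IsIntegral A P := by
      refine ⟨fun p => ?_⟩
      have : Algebra.adjoin A (Set.range a) ≤ integralClosure A P := by
        refine Algebra.adjoin_le ?_
        rintro _ ⟨i, rfl⟩
        refine ⟨Q, hmonic, ?_⟩
        rw [← Polynomial.eval_map, hQ, Polynomial.eval_prod]
        exact Finset.prod_eq_zero (Finset.mem_univ i) (by simp)
      rw [ha] at this
      exact this trivial
    exact hall.isIntegral φ
  have hkint : IsIntegral A k := by
    have : IsIntegral A (algebraMap K L k) := by
      rw [hk]
      exact h_int.map (IsScalarTower.toAlgHom A P L)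
    exact (isIntegral_algebraMap_iff (algebraMap K L).injective).mp this
  obtain ⟨c, rfl⟩ := IsIntegrallyClosed.isIntegral_iff.mp hkint
  refine ⟨c, hPL ?_⟩
  rw [← hk, ← IsScalarTower.algebraMap_apply, ← IsScalarTower.algebraMap_apply]

theorem mem_range_of_fixed [CharZero A] [IsIntegrallyClosed A]
    (hinj : Function.Injective (algebraMap A P))
    (ha : Algebra.adjoin A (Set.range a) = ⊤) (Q : Polynomial A)
    (hQ : Q.map (algebraMap A P) = ∏ i, (Polynomial.X - Polynomial.C (a i)))
    (φ : P) (hφ : ∀ τ : P →ₐ[A] P, τ φ = φ) : ∃ c, algebraMap A P c = φ := by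
  have hfs : FaithfulSMul A P := (faithfulSMul_iff_algebraMap_injective A P).mpr hinj
  let := FractionRing.liftAlgebra A (FractionRing P)
  have := FractionRing.isScalarTower_liftAlgebra A (FractionRing P)
  have : CharZero (FractionRing A) := charZero_of_injective_algebraMap
    (IsFractionRing.injective A (FractionRing A))
  exact mem_range_of_fixed_aux a (FractionRing A) (FractionRing P) hinj ha Q hQ φ hφ

theorem mem_range_of_fixed_algHom {A P J : Type*} [CommRing A] [IsDomain A] [CommRing P]
    [IsDomain P] [Algebra ℂ A] [Algebra ℂ P] [Fintype J] [IsIntegrallyClosed A] (r : A →ₐ[ℂ] P)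
    (hinj : Function.Injective r) (a : J → P) (ha : Algebra.adjoin ℂ (Set.range a) = ⊤)
    (hsum : ∀ k, ∑ i, a i ^ k ∈ r.range) (φ : P)
    (hφ : ∀ τ : P →ₐ[ℂ] P, (∀ x, τ (r x) = r x) → τ φ = φ) : ∃ c, r c = φ := by
  let : Algebra A P := r.toRingHom.toAlgebra
  have : IsScalarTower ℂ A P := IsScalarTower.of_algebraMap_eq fun c => (r.commutes c).symm
  have hadj : Algebra.adjoin A (Set.range a) = ⊤ := by
    rw [eq_top_iff]
    intro x _
    have hx : x ∈ Algebra.adjoin ℂ (Set.range a) := by rw [ha]; trivial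
    induction hx using Algebra.adjoin_induction with
    | mem y hy => exact Algebra.subset_adjoin hy
    | algebraMap c =>
      rw [IsScalarTower.algebraMap_apply ℂ A P]
      exact Subalgebra.algebraMap_mem _ _
    | add y z _ _ hy hz => exact Subalgebra.add_mem _ (hy trivial) (hz trivial)
    | mul y z _ _ hy hz => exact Subalgebra.mul_mem _ (hy trivial) (hz trivial)
  obtain ⟨Q, hQ⟩ : ∃ Q : Polynomial A, Q.map (algebraMap A P) =
      ∏ i, (Polynomial.X - Polynomial.C (a i)) :=
    (Polynomial.mem_lifts _).mp ((Polynomial.lifts_iff_coeff_lifts (f := algebraMap A P)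
      (∏ i, (Polynomial.X - Polynomial.C (a i)))).mpr fun k => coeff_prod_mem r.range a hsum k)
  have : CharZero A := charZero_of_injective_algebraMap (algebraMap ℂ A).injective
  exact mem_range_of_fixed a hinj hadj Q hQ φ fun τ => hφ (τ.restrictScalars ℂ) τ.commutes

end Galois

variable {g}

instance : IsDomain (invariantPolynomials g) := inferInstance

instance isIntegrallyClosed_invariants : IsIntegrallyClosed (invariantPolynomials g) := by
  refine isIntegrallyClosed_of_quotients (R := PolyAlg g) _ Subtype.val_injective ?_
  intro a b hb c hc
  refine ⟨⟨c, fun y => ?_⟩, rfl⟩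
  have hc' : (a : PolyAlg g) = b * c := hc
  have h := a.2 y
  rw [hc', Derivation.leibniz, b.2 y, smul_zero, add_zero, smul_eq_mul] at h
  exact (mul_eq_zero.mp h).resolve_left fun h0 => hb (Subtype.ext h0)

end Kostant

namespace Kostant

/-- The ring of invariants acts on polynomial functions on a subalgebra through restriction. -/
def restr {g : Type} [LieRing g] [LieAlgebra ℂ g] [FiniteDimensional ℂ g]
    (t : LieSubalgebra ℂ g) : invariantPolynomials g →ₐ[ℂ] polyFun t where
  toFun p := ⟨fun H => evalAt g H p,
    IsPolyMap.comp_mem (IsPolyMap.of_linear t.toSubmodule.subtype) (evalAt_mem_polyFun (p : PolyAlg g))⟩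
  map_one' := by ext H; simp
  map_mul' _ _ := by ext H; simp
  map_zero' := by ext H; simp
  map_add' _ _ := by ext H; simp
  commutes' c := by ext H; exact AlgHom.commutes _ c

lemma restr_apply {t : LieSubalgebra ℂ g} (p : invariantPolynomials g) (H : t) :
    (restr t p : t → ℂ) H = evalAt g H p := rfl

namespace RootDatum

variable {g} {t : LieSubalgebra ℂ g} (D : RootDatum g t)

lemma exists_wt_of_lie {x : g} (hx : x ≠ 0) {χ : Dual ℂ t}
    (h : ∀ H : t, ⁅(H : g), x⁆ = χ H • x) : ∃ i, D.wt i = χ := by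
  obtain ⟨i, hi⟩ : ∃ i, D.B.repr x i ≠ 0 := by
    by_contra! h0
    exact hx (D.B.repr.map_eq_zero_iff.mp (Finsupp.ext h0))
  refine ⟨i, LinearMap.ext fun H => ?_⟩
  have h1 := D.repr_lie_t H x i
  rw [h, map_smul, Finsupp.smul_apply, smul_eq_mul] at h1
  exact (mul_right_cancel₀ hi h1).symm

lemma e_ne_zero (j : D.ι) : D.e j ≠ 0 := fun h => D.h.ne_zero j (by
  have := D.lie_ef j
  rw [h, zero_lie] at this
  exact Subtype.ext this.symm)

lemma f_ne_zero (j : D.ι) : D.f j ≠ 0 := fun h => D.h.ne_zero j (by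
  have := D.lie_ef j
  rw [h, lie_zero] at this
  exact Subtype.ext this.symm)

lemma exists_wt_eq_α (j : D.ι) : ∃ i, D.wt i = D.α j :=
  D.exists_wt_of_lie (D.e_ne_zero j) fun H => D.lie_e H j

/-- A linear form on `t` as a polynomial function. -/
def lin (l : Dual ℂ t) : polyFun t := ⟨fun H => l H, dual_mem_polyFun l⟩

lemma adjoin_wt : Algebra.adjoin ℂ (Set.range fun i => lin (D.wt i)) = ⊤ := by
  rw [eq_top_iff]
  rintro ⟨F, hF⟩ -
  have key : ∀ l : Dual ℂ t, lin l ∈ Algebra.adjoin ℂ (Set.range fun i => lin (D.wt i)) := by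
    intro l
    have e : lin l = ∑ j, D.α.repr l j • lin (D.α j) := by
      apply Subtype.ext
      funext H
      have := congrArg (fun l => l H) (D.α.sum_repr l)
      simp only [LinearMap.sum_apply, LinearMap.smul_apply] at this
      simpa only [lin, AddSubmonoidClass.coe_finsetSum, SetLike.val_smul, Finset.sum_apply,
        Pi.smul_apply] using this.symm
    rw [e]
    refine Subalgebra.sum_mem _ fun j _ => Subalgebra.smul_mem _ ?_ _
    obtain ⟨i, hi⟩ := D.exists_wt_eq_α j
    rw [← hi]
    exact Algebra.subset_adjoin ⟨i, rfl⟩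
  induction hF using Algebra.adjoin_induction with
  | mem x hx => obtain ⟨l, rfl⟩ := hx; exact key l
  | algebraMap r => exact Subalgebra.algebraMap_mem _ r
  | add x y hx' hy' hx hy => exact Subalgebra.add_mem _ hx hy
  | mul x y hx' hy' hx hy => exact Subalgebra.mul_mem _ hx hy

theorem restr_injective (D : RootDatum g t) : Function.Injective (restr t) := by
  rw [injective_iff_map_eq_zero]
  intro p hp
  refine Subtype.ext (D.invariant_eq_zero p.2 fun H => ?_)
  rw [← restr_apply, hp]
  rfl

lemma exists_linear (D : RootDatum g t) (T : polyFun t →ₐ[ℂ] polyFun t)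
    (hT : ∀ j, ∃ i, T (lin (D.α j)) = lin (D.wt i)) :
    ∃ σ : t →ₗ[ℂ] t, ∀ (F : polyFun t) H, (T F : t → ℂ) H = (F : t → ℂ) (σ H) := by
  choose π hπ using hT
  let σ : t →ₗ[ℂ] t := ∑ j, (D.wt (π j)).smulRight ((evalEquiv ℂ t).symm (D.α.coord j))
  have hσ : ∀ j H, D.α j (σ H) = D.wt (π j) H := by
    intro j H
    simp [σ, Finsupp.single_apply]
  refine ⟨σ, ?_⟩
  let C : polyFun t →ₐ[ℂ] polyFun t :=
    { toFun := fun F => ⟨fun H => (F : t → ℂ) (σ H), IsPolyMap.comp_mem (IsPolyMap.of_linear σ) F.2⟩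
      map_one' := rfl
      map_mul' := fun _ _ => rfl
      map_zero' := rfl
      map_add' := fun _ _ => rfl
      commutes' := fun _ => rfl }
  suffices h : T = C by intro F H; rw [h]; rfl
  refine AlgHom.ext_of_adjoin_eq_top D.adjoin_wt ?_
  rintro _ ⟨i, rfl⟩
  have e : lin (D.wt i) = ∑ j, (D.coef i j : ℂ) • lin (D.α j) := by
    apply Subtype.ext
    funext H
    simp [lin, D.wt_eq i]
  simp only [e, map_sum, map_smul]
  refine Finset.sum_congr rfl fun j _ => ?_
  rw [hπ]
  congr 1
  apply Subtype.ext
  funext H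
  exact (hσ j H).symm

lemma exists_wt_of_fixes (D : RootDatum g t) (T : polyFun t →ₐ[ℂ] polyFun t)
    (hT : ∀ p, T (restr t p) = restr t p) (i : D.κ) : ∃ i', T (lin (D.wt i)) = lin (D.wt i') := by
  refine exists_eq_of_fixed T (fun i => lin (D.wt i)) (fun k => ?_) i
  obtain ⟨p, hp, h⟩ := D.exists_invariant_wt k
  have : ∑ i, lin (D.wt i) ^ k = restr t ⟨p, hp⟩ := by
    apply Subtype.ext
    funext H
    simp [restr_apply, h, lin]
  rw [this, hT]

theorem exists_invariant_of_fixed (D : RootDatum g t) {φ : t → ℂ} (hφ : φ ∈ polyFun t)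
    (h : ∀ σ : t →ₗ[ℂ] t, (∀ p ∈ invariantPolynomials g, ∀ H, evalAt g (σ H) p = evalAt g H p) →
      ∀ H, φ (σ H) = φ H) : ∃ p ∈ invariantPolynomials g, ∀ H : t, evalAt g H p = φ H := by
  have hsum : ∀ k, ∑ i, lin (D.wt i) ^ k ∈ (restr t).range := by
    intro k
    obtain ⟨p, hp, h⟩ := D.exists_invariant_wt k
    refine ⟨⟨p, hp⟩, ?_⟩
    apply Subtype.ext
    funext H
    change evalAt g H p = _
    simp [h, lin]
  have hfix : ∀ τ : polyFun t →ₐ[ℂ] polyFun t, (∀ x, τ (restr t x) = restr t x) →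
      τ ⟨φ, hφ⟩ = ⟨φ, hφ⟩ := by
    intro τ hτ
    obtain ⟨σ, hσ⟩ := D.exists_linear τ fun j => by
      obtain ⟨i, hi⟩ := D.exists_wt_eq_α j
      rw [← hi]
      exact D.exists_wt_of_fixes _ hτ i
    apply Subtype.ext
    funext H
    refine (hσ ⟨φ, hφ⟩ H).trans (h σ (fun p hp H => ?_) H)
    have := hσ (restr t ⟨p, hp⟩) H
    rw [hτ] at this
    exact this.symm
  obtain ⟨p, hp⟩ := mem_range_of_fixed_algHom (restr t) D.restr_injective
    (fun i => lin (D.wt i)) D.adjoin_wt hsum ⟨φ, hφ⟩ hfix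
  exact ⟨p, p.2, fun H => congrFun (congrArg Subtype.val hp) H⟩

end RootDatum

end Kostant

namespace Kostant

section Determinant

variable {M n : Type*} [CommRing M] [Algebra ℂ M] [Fintype n] [DecidableEq n]

lemma derivation_prod (d : Derivation ℂ M M) (s : Finset n) (f : n → M) :
    d (∏ i ∈ s, f i) = ∑ i ∈ s, ∏ k ∈ s, Function.update f i (d (f i)) k := by
  induction s using Finset.induction_on with
  | empty => simp
  | insert a s ha ih =>
    rw [Finset.prod_insert ha, Derivation.leibniz, ih, Finset.sum_insert ha, Finset.prod_insert ha,
      Function.update_self, Finset.prod_congr rfl fun k hk => Function.update_of_ne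
        (ne_of_mem_of_not_mem hk ha) _ _, add_comm, smul_eq_mul, smul_eq_mul, mul_comm]
    congr 1
    rw [Finset.mul_sum]
    refine Finset.sum_congr rfl fun i hi => ?_
    rw [Finset.prod_insert ha, Function.update_of_ne (ne_of_mem_of_not_mem hi ha).symm]

lemma derivation_det (d : Derivation ℂ M M) (A : Matrix n n M) :
    d A.det = ∑ i, (A.updateCol i fun k => d (A k i)).det := by
  simp only [Matrix.det_apply, map_sum, Units.smul_def, map_zsmul, derivation_prod]
  simp only [Finset.smul_sum]
  rw [Finset.sum_comm]
  refine Finset.sum_congr rfl fun i _ => ?_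
  refine Finset.sum_congr rfl fun σ _ => ?_
  congr 1
  refine Finset.prod_congr rfl fun k _ => ?_
  by_cases h : k = i
  · subst h; simp
  · simp [h]

lemma derivation_det_of_mul (d : Derivation ℂ M M) (A : Matrix n n M) (N : Matrix n n ℂ)
    (h : ∀ k i, d (A k i) = ∑ j, N j i • A k j) : d A.det = N.trace • A.det := by
  rw [derivation_det, Matrix.trace, Finset.sum_smul]
  refine Finset.sum_congr rfl fun i _ => ?_
  have := Matrix.det_updateCol_sum A i fun j => algebraMap ℂ M (N j i)
  rw [Matrix.diag_apply, Algebra.smul_def, ← smul_eq_mul, ← this]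
  congr
  funext k
  rw [h]
  simp [Algebra.smul_def]

end Determinant

namespace RootDatum

variable {g} {t : LieSubalgebra ℂ g} (D : RootDatum g t)

section Action

variable (Ψ : Type) [Fintype Ψ]

/-- The polynomial algebra on several copies of `g`. -/
abbrev Copies := MvPolynomial (Ψ × D.κ) ℂ

/-- The inclusion of a copy of `g` as linear forms. -/
def copy (l : Ψ) : g →ₗ[ℂ] D.Copies Ψ := D.B.constr ℂ fun a => X (l, a)

lemma copy_B (l : Ψ) (a : D.κ) : D.copy Ψ l (D.B a) = X (l, a) := by simp [copy]

/-- The action of `g` by derivations. -/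
def actDer (y : g) : Derivation ℂ (D.Copies Ψ) (D.Copies Ψ) :=
  mkDerivation ℂ fun la => D.copy Ψ la.1 ⁅y, D.B la.2⁆

lemma actDer_copy (y : g) (l : Ψ) (x : g) :
    D.actDer Ψ y (D.copy Ψ l x) = D.copy Ψ l ⁅y, x⁆ := by
  have : (D.actDer Ψ y).toLinearMap ∘ₗ D.copy Ψ l = D.copy Ψ l ∘ₗ (ad ℂ g y) := by
    refine D.B.ext fun a => ?_
    simp [copy_B, actDer, mkDerivation_X]
  exact LinearMap.congr_fun this x

lemma actDer_X (y : g) (l : Ψ) (a : D.κ) :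
    D.actDer Ψ y (X (l, a)) = D.copy Ψ l ⁅y, D.B a⁆ := mkDerivation_X _ _ _

/-- The representation of `g` on the polynomial algebra on several copies of `g`. -/
def act : g →ₗ[ℂ] Module.End ℂ (D.Copies Ψ) where
  toFun y := (D.actDer Ψ y).toLinearMap
  map_add' y z := by
    have : D.actDer Ψ (y + z) = D.actDer Ψ y + D.actDer Ψ z :=
      derivation_ext fun ⟨l, a⟩ => by simp [actDer_X]
    rw [this]; rfl
  map_smul' c y := by
    have : D.actDer Ψ (c • y) = c • D.actDer Ψ y :=
      derivation_ext fun ⟨l, a⟩ => by simp [actDer_X]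
    rw [this]; rfl

lemma act_apply (y : g) (m : D.Copies Ψ) : D.act Ψ y m = D.actDer Ψ y m := rfl

lemma act_lie (y z : g) (m : D.Copies Ψ) :
    D.act Ψ ⁅y, z⁆ m = D.act Ψ y (D.act Ψ z m) - D.act Ψ z (D.act Ψ y m) := by
  have : D.actDer Ψ ⁅y, z⁆ = ⁅D.actDer Ψ y, D.actDer Ψ z⁆ :=
    derivation_ext fun ⟨l, a⟩ => by
      rw [Derivation.commutator_apply, actDer_X, actDer_X, actDer_X, actDer_copy, actDer_copy,
        ← map_sub, lie_lie]
  simp only [act_apply]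
  rw [this, Derivation.commutator_apply]

lemma act_mem_homogeneous (y : g) {n : ℕ} {m : D.Copies Ψ}
    (hm : m ∈ restrictTotalDegree (Ψ × D.κ) ℂ n) :
    D.act Ψ y m ∈ restrictTotalDegree (Ψ × D.κ) ℂ n := by
  rw [mem_restrictTotalDegree] at hm ⊢
  have hs : ∀ (d : Ψ × D.κ → Derivation ℂ (D.Copies Ψ) (D.Copies Ψ)) p,
      (∑ i, d i) p = ∑ i, d i p := fun d p => by
    have := map_sum (Derivation.coeFnAddMonoidHom (R := ℂ) (A := D.Copies Ψ) (M := D.Copies Ψ))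
      d Finset.univ
    exact (congrFun this p).trans (Finset.sum_apply _ _ _)
  have e : D.actDer Ψ y m = ∑ i, pderiv i m * D.actDer Ψ y (X i) := by
    have : D.actDer Ψ y = ∑ i, D.actDer Ψ y (X i) • pderiv i := by
      refine derivation_ext fun i => ?_
      rw [hs, Finset.sum_eq_single i]
      · simp
      · intro j _ hj
        simp [pderiv_X_of_ne hj.symm]
      · simp
    conv_lhs => rw [this, hs]
    simp [mul_comm]
  rw [act_apply, e]
  refine totalDegree_finsetSum_le fun i _ => ?_
  rcases Nat.eq_zero_or_pos n with rfl | hn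
  · rw [totalDegree_eq_zero_iff_eq_C.mp (Nat.le_zero.mp hm)]
    simp
  obtain ⟨n, rfl⟩ := Nat.exists_eq_succ_of_ne_zero hn.ne'
  have h1 := totalDegree_pderiv_le hm i
  have h2 := totalDegree_mul (pderiv i m) (D.actDer Ψ y (X i))
  suffices h3 : (D.actDer Ψ y (X i)).totalDegree ≤ 1 by omega
  obtain ⟨l, a⟩ := i
  rw [actDer_X, ← D.B.sum_repr ⁅y, D.B a⁆, map_sum]
  refine totalDegree_finsetSum_le fun b _ => ?_
  rw [map_smul, copy_B]
  exact (totalDegree_smul_le _ _).trans (totalDegree_X _).le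

end Action

end RootDatum

end Kostant

namespace Kostant

namespace RootDatum

variable {g} {t : LieSubalgebra ℂ g} (D : RootDatum g t) (j : D.ι)

/-- The weights of the nilradical of the maximal parabolic subalgebra attached to a simple root. -/
abbrev Nil : Type := {i : D.κ // 0 < D.coef i j}

/-- The wedge of the weight vectors of the nilradical, as a determinant. -/
def hwVec : D.Copies (D.Nil j) :=
  (Matrix.of fun l a : D.Nil j => D.copy (D.Nil j) l (D.B a)).det

/-- The weight of `hwVec`. -/
def hwWt : Dual ℂ t := ∑ a : D.Nil j, D.wt a

lemma hwVec_ne_zero : D.hwVec j ≠ 0 := by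
  intro h
  have h1 := congrArg (aeval fun la : D.Nil j × D.κ => if (la.1 : D.κ) = la.2 then (1 : ℂ) else 0) h
  rw [hwVec, map_zero, AlgHom.map_det] at h1
  have : (aeval fun la : D.Nil j × D.κ => if (la.1 : D.κ) = la.2 then (1 : ℂ) else 0).mapMatrix
      (Matrix.of fun l a : D.Nil j => D.copy (D.Nil j) l (D.B a)) = 1 := by
    ext l a
    simp [copy_B, Matrix.one_apply, Subtype.ext_iff]
  rw [this, Matrix.det_one] at h1
  exact one_ne_zero h1

lemma act_hwVec {y : g}
    (hy : ∀ a : D.Nil j, ∀ b, ¬ 0 < D.coef b j → D.B.repr ⁅y, D.B a⁆ b = 0) :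
    D.act (D.Nil j) y (D.hwVec j) =
      (∑ a : D.Nil j, D.B.repr ⁅y, D.B a⁆ a) • D.hwVec j := by
  rw [act_apply, hwVec, derivation_det_of_mul (d := D.actDer (D.Nil j) y)
    (N := Matrix.of fun b a : D.Nil j => D.B.repr ⁅y, D.B a⁆ b)]
  · rfl
  · intro l a
    simp only [Matrix.of_apply]
    rw [actDer_copy]
    conv_lhs => rw [← D.B.sum_repr ⁅y, D.B a⁆, map_sum]
    simp only [map_smul]
    rw [← Finset.sum_subtype (Finset.univ.filter fun b => 0 < D.coef b j) (by simp)
      fun b => D.B.repr ⁅y, D.B a⁆ b • D.copy (D.Nil j) l (D.B b)]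
    refine (Finset.sum_filter_of_ne fun b _ hb => ?_).symm
    by_contra h
    rw [hy a b h, zero_smul] at hb
    exact hb rfl

lemma act_hwVec_t (H : t) :
    D.act (D.Nil j) H (D.hwVec j) = D.hwWt j H • D.hwVec j := by
  rw [act_hwVec]
  · simp [D.lie_B, hwWt]
  · intro a b hb
    rw [D.lie_B, map_smul, Basis.repr_self, Finsupp.smul_apply, Finsupp.single_apply, if_neg,
      smul_zero]
    rintro rfl
    exact hb a.2

lemma coef_eq_of_wt {i : D.κ} {c : D.ι → ℤ} (h : D.wt i = ∑ k, (c k : ℂ) • D.α k) (k : D.ι) :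
    D.coef i k = c k := by
  rw [D.wt_eq i] at h
  have := congrArg (fun l => D.α.repr l k) h
  simp [Finsupp.single_apply] at this
  exact this

lemma exists_act_hwVec_of_lie {y : g} {χ : D.ι → ℤ} (hχ : 0 ≤ χ j)
    (h : ∀ H : t, ⁅(H : g), y⁆ = (∑ k, (χ k : ℂ) • D.α k) H • y) :
    ∃ c : ℂ, D.act (D.Nil j) y (D.hwVec j) = c • D.hwVec j := by
  refine ⟨_, D.act_hwVec j fun a b hb => ?_⟩
  by_contra hne
  apply hb
  have hw : D.wt b = ∑ k, ((χ k + D.coef a k : ℤ) : ℂ) • D.α k := by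
    ext H
    have h1 := D.repr_lie_t H ⁅y, D.B a⁆ b
    rw [leibniz_lie, h, D.lie_B, smul_lie, lie_smul, ← add_smul, map_smul, Finsupp.smul_apply,
      smul_eq_mul] at h1
    rw [← mul_right_cancel₀ hne h1, D.wt_eq a]
    simp [add_mul, Finset.sum_add_distrib]
  rw [D.coef_eq_of_wt hw]
  have := a.2
  omega

lemma exists_act_hwVec {i : D.κ} (hi : 0 ≤ D.deg i) :
    ∃ c : ℂ, D.act (D.Nil j) (D.B i) (D.hwVec j) = c • D.hwVec j := by
  refine D.exists_act_hwVec_of_lie j (χ := D.coef i) ?_ fun H => by rw [D.lie_B, ← D.wt_eq]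
  rcases D.coef_sign i with h | h
  · exact h j
  · have : D.deg i = 0 := le_antisymm (Finset.sum_nonpos fun k _ => h k) hi
    exact ((Finset.sum_eq_zero_iff_of_nonpos fun k _ => h k).mp this j (Finset.mem_univ j)).ge

lemma hwWt_h {k : D.ι} (hk : k ≠ j) : D.hwWt j (D.h k) = 0 := by
  obtain ⟨c, hc⟩ := D.exists_act_hwVec_of_lie j (y := D.e k) (χ := Pi.single k 1)
    (by simp [hk.symm]) fun H => by
      rw [D.lie_e]
      simp [Pi.single_apply]
  obtain ⟨c', hc'⟩ := D.exists_act_hwVec_of_lie j (y := D.f k) (χ := Pi.single k (-1))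
    (by simp [hk.symm]) fun H => by
      rw [D.lie_f]
      simp [Pi.single_apply]
  have h := D.act_hwVec_t j (D.h k)
  rw [← D.lie_ef, act_lie, hc, hc', map_smul, map_smul, hc, hc', smul_smul, smul_smul, mul_comm,
    sub_self] at h
  exact (smul_eq_zero.mp h.symm).resolve_right (D.hwVec_ne_zero j)

lemma hwWt_ne_zero : D.hwWt j ≠ 0 := by
  intro h
  obtain ⟨i, hi⟩ := D.exists_wt_eq_α j
  have hij : D.coef i j = 1 := by
    have := D.coef_eq_of_wt (i := i) (c := Pi.single j 1) (by rw [hi]; simp [Pi.single_apply]) j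
    simpa using this
  have h1 : (D.α.repr (D.hwWt j) j) = ((∑ a : D.Nil j, D.coef a j : ℤ) : ℂ) := by
    simp [hwWt, D.wt_eq, Finsupp.single_apply]
  rw [h] at h1
  have h2 : (∑ a : D.Nil j, D.coef a j : ℤ) = 0 := by
    have : ((∑ a : D.Nil j, D.coef a j : ℤ) : ℂ) = 0 := by rw [← h1]; simp
    exact_mod_cast this
  have h3 : 0 < ∑ a : D.Nil j, D.coef a j :=
    Finset.sum_pos (fun a _ => a.2) ⟨⟨i, by rw [hij]; exact one_pos⟩, Finset.mem_univ _⟩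
  omega

/-- The vectors obtained from `hwVec` by lowering operators, with their weights. -/
inductive Lowered : D.Copies (D.Nil j) → Dual ℂ t → Prop
  | base : Lowered (D.hwVec j) (D.hwWt j)
  | step {m μ} (i : D.κ) (hi : D.deg i < 0) (hm : Lowered m μ) :
    Lowered (D.act (D.Nil j) (D.B i) m) (μ + D.wt i)

/-- The module generated by `hwVec`. -/
def hwMod : Submodule ℂ (D.Copies (D.Nil j)) := Submodule.span ℂ {m | ∃ μ, D.Lowered j m μ}

variable {j}

lemma Lowered.act_t {m μ} (h : D.Lowered j m μ) (H : t) : D.act (D.Nil j) H m = μ H • m := by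
  induction h with
  | base => exact D.act_hwVec_t j H
  | @step m μ i hi hm ih =>
    have h := D.act_lie (D.Nil j) H (D.B i) m
    rw [D.lie_B, eq_sub_iff_add_eq, map_smul, LinearMap.smul_apply, ih, map_smul] at h
    rw [← h, LinearMap.add_apply, add_smul, add_comm]

lemma Lowered.exists_sub {m μ} (h : D.Lowered j m μ) :
    ∃ n : D.ι → ℕ, D.hwWt j - μ = ∑ k, (n k : ℂ) • D.α k := by
  induction h with
  | base => exact ⟨0, by simp⟩
  | @step m μ i hi hm ih =>
    obtain ⟨n, hn⟩ := ih
    have hneg : ∀ k, D.coef i k ≤ 0 := (D.coef_sign i).resolve_left fun h =>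
      absurd (Finset.sum_nonneg fun k (_ : k ∈ Finset.univ) => h k) (not_le.mpr hi)
    refine ⟨fun k => n k + (-D.coef i k).toNat, ?_⟩
    have e : ∀ k, (((-D.coef i k).toNat : ℕ) : ℂ) = -(D.coef i k : ℂ) := fun k => by
      have : (((-D.coef i k).toNat : ℕ) : ℤ) = -D.coef i k := Int.toNat_of_nonneg (by linarith [hneg k])
      exact_mod_cast this
    rw [← sub_sub, hn, D.wt_eq i, ← Finset.sum_sub_distrib]
    refine Finset.sum_congr rfl fun k _ => ?_
    push_cast
    rw [e, add_smul, neg_smul, sub_eq_add_neg]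

lemma act_mem_hwMod_of_deg_neg {i : D.κ} (hi : D.deg i < 0) {m} (hm : m ∈ D.hwMod j) :
    D.act (D.Nil j) (D.B i) m ∈ D.hwMod j := by
  induction hm using Submodule.span_induction with
  | mem x hx => obtain ⟨μ, h⟩ := hx; exact Submodule.subset_span ⟨_, .step i hi h⟩
  | zero => rw [map_zero]; exact Submodule.zero_mem _
  | add x y _ _ hx hy => rw [map_add]; exact Submodule.add_mem _ hx hy
  | smul c x _ hx => rw [map_smul]; exact Submodule.smul_mem _ _ hx

lemma act_mem_of_basis {V : Submodule ℂ (D.Copies (D.Nil j))} {m : D.Copies (D.Nil j)}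
    (h : ∀ i, D.act (D.Nil j) (D.B i) m ∈ V) (y : g) : D.act (D.Nil j) y m ∈ V := by
  rw [← D.B.sum_repr y, map_sum, LinearMap.sum_apply]
  refine Submodule.sum_mem _ fun i _ => ?_
  rw [map_smul, LinearMap.smul_apply]
  exact Submodule.smul_mem _ _ (h i)

lemma Lowered.act_mem {m μ} (h : D.Lowered j m μ) (y : g) :
    D.act (D.Nil j) y m ∈ D.hwMod j := by
  induction h generalizing y with
  | base =>
    refine D.act_mem_of_basis (fun i => ?_) y
    rcases lt_or_ge (D.deg i) 0 with hi | hi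
    · exact Submodule.subset_span ⟨_, .step i hi .base⟩
    · obtain ⟨c, hc⟩ := D.exists_act_hwVec j hi
      rw [hc]
      exact Submodule.smul_mem _ _ (Submodule.subset_span ⟨_, .base⟩)
  | @step m μ i hi hm ih =>
    have := D.act_lie (D.Nil j) y (D.B i) m
    rw [eq_sub_iff_add_eq] at this
    rw [← this]
    exact Submodule.add_mem _ (ih _) (D.act_mem_hwMod_of_deg_neg hi (ih y))

lemma act_mem_hwMod (y : g) {m} (hm : m ∈ D.hwMod j) : D.act (D.Nil j) y m ∈ D.hwMod j := by
  induction hm using Submodule.span_induction with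
  | mem x hx => obtain ⟨μ, h⟩ := hx; exact h.act_mem D y
  | zero => rw [map_zero]; exact Submodule.zero_mem _
  | add x y _ _ hx hy => rw [map_add]; exact Submodule.add_mem _ hx hy
  | smul c x _ hx => rw [map_smul]; exact Submodule.smul_mem _ _ hx

lemma finite_hwMod : Module.Finite ℂ (D.hwMod j) := by
  have h : D.hwMod j ≤ restrictTotalDegree (D.Nil j × D.κ) ℂ (D.hwVec j).totalDegree := by
    refine Submodule.span_le.mpr ?_
    rintro m ⟨μ, hm⟩
    induction hm with
    | base => exact (mem_restrictTotalDegree _ _ _).mpr le_rfl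
    | step i hi hm ih => exact D.act_mem_homogeneous _ _ ih
  exact Submodule.finiteDimensional_of_le h

variable (j)

theorem exists_rep : ∃ (J : Type) (_ : Fintype J) (_ : DecidableEq J) (ρ : g →ₗ[ℂ] Matrix J J ℂ)
    (μ : J → Dual ℂ t), (∀ x y, ρ ⁅x, y⁆ = ρ x * ρ y - ρ y * ρ x) ∧
      (∀ H : t, ρ H = Matrix.diagonal fun a => μ a H) ∧
      (∀ a, ∃ n : D.ι → ℕ, D.hwWt j - μ a = ∑ k, (n k : ℂ) • D.α k) ∧
      ∃ a, μ a = D.hwWt j := by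
  classical
  obtain ⟨b, hb, hspan, hli⟩ := exists_linearIndependent ℂ {m | ∃ μ, D.Lowered j m μ}
  have hfin := D.finite_hwMod (j := j)
  have hmod : Submodule.span ℂ b = D.hwMod j := hspan
  choose μ hμ using fun m : b => hb m.2
  let c : Module.Basis b ℂ (D.hwMod j) := (Basis.span hli).map
    (LinearEquiv.ofEq _ _ (by rw [Subtype.range_coe, hmod]))
  have hc : ∀ m : b, (c m : D.Copies (D.Nil j)) = m := fun m => by
    simp [c, Basis.span_apply]
  have hfb : Finite b := Module.Finite.finite_basis c
  have : Fintype b := Fintype.ofFinite b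
  let ρ' : g →ₗ[ℂ] Module.End ℂ (D.hwMod j) :=
    { toFun := fun y => (D.act (D.Nil j) y).restrict fun m hm => D.act_mem_hwMod y hm
      map_add' := fun y z => by ext m; simp [LinearMap.restrict_apply]
      map_smul' := fun a y => by ext m; simp [LinearMap.restrict_apply] }
  have hρ' : ∀ y m, (ρ' y m : D.Copies (D.Nil j)) = D.act (D.Nil j) y m := fun _ _ => rfl
  have hρt : ∀ (H : t) m, ρ' H (c m) = μ m H • c m := fun H m => by
    apply Subtype.ext
    rw [hρ', Submodule.coe_smul, hc]
    exact (hμ m).act_t D H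
  refine ⟨b, inferInstance, inferInstance, (LinearMap.toMatrix c c).toLinearMap ∘ₗ ρ', μ, ?_, ?_,
    fun a => (hμ a).exists_sub D, ?_⟩
  · intro x y
    simp only [LinearMap.comp_apply, LinearEquiv.coe_coe]
    rw [← LinearMap.toMatrix_mul, ← LinearMap.toMatrix_mul, ← map_sub]
    congr 1
    ext m
    simp [hρ', act_lie]
  · intro H
    ext a b
    simp only [LinearMap.comp_apply, LinearEquiv.coe_coe, LinearMap.toMatrix_apply,
      Matrix.diagonal_apply, hρt]
    by_cases h : a = b
    · subst h; simp
    · simp [h]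
  · let v : D.hwMod j := ⟨D.hwVec j, Submodule.subset_span ⟨_, .base⟩⟩
    have hv : v ≠ 0 := fun h => D.hwVec_ne_zero j (congrArg Subtype.val h)
    obtain ⟨a, ha⟩ : ∃ a, c.repr v a ≠ 0 := by
      by_contra! h0
      exact hv (c.repr.map_eq_zero_iff.mp (Finsupp.ext h0))
    refine ⟨a, LinearMap.ext fun H => ?_⟩
    have h1 : ρ' H v = D.hwWt j H • v := Subtype.ext (D.act_hwVec_t j H)
    have h2 := congrArg (fun w => c.repr w a) h1
    have h3 : c.repr (ρ' H v) a = μ a H * c.repr v a := by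
      conv_lhs => rw [← c.sum_repr v, map_sum]
      simp only [map_smul, hρt, map_sum]
      simp [Finsupp.single_apply, mul_comm]
    simp only [h3, map_smul, Finsupp.smul_apply, smul_eq_mul] at h2
    exact mul_right_cancel₀ ha h2

end RootDatum

end Kostant

namespace Kostant

namespace RootDatum

variable {g} {t : LieSubalgebra ℂ g}

/-- A linear endomorphism of `t` preserves the restrictions of all invariant polynomials. -/
def Fixes (σ : t →ₗ[ℂ] t) : Prop :=
  ∀ p ∈ invariantPolynomials g, ∀ H, evalAt g (σ H) p = evalAt g H p

/-- Composition with a linear endomorphism, on polynomial functions. -/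
def subst (σ : t →ₗ[ℂ] t) : polyFun t →ₐ[ℂ] polyFun t where
  toFun F := ⟨fun H => (F : t → ℂ) (σ H), (IsPolyMap.of_linear σ).comp_mem F.2⟩
  map_one' := by ext H; simp
  map_mul' _ _ := by ext H; simp
  map_zero' := by ext H; simp
  map_add' _ _ := by ext H; simp
  commutes' _ := by ext H; rfl

lemma lin_injective : Function.Injective (lin : Dual ℂ t → polyFun t) := fun _ _ h =>
  LinearMap.ext fun H => congrFun (congrArg Subtype.val h) H

section Weights

variable {J : Type} [Fintype J] {μ : J → Dual ℂ t}
  {σ : t →ₗ[ℂ] t}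

lemma subst_sum_pow (hμ : ∀ k : ℕ, ∃ p ∈ invariantPolynomials g, ∀ H : t,
      evalAt g H p = ∑ a, μ a H ^ k) (hσ : Fixes σ) (k : ℕ) :
    subst σ (∑ a, lin (μ a) ^ k) = ∑ a, lin (μ a) ^ k := by
  obtain ⟨p, hp, h⟩ := hμ k
  have e : ∑ a, lin (μ a) ^ k = restr t ⟨p, hp⟩ := by
    apply Subtype.ext
    funext H
    simp [restr_apply, h, lin]
  rw [e]
  apply Subtype.ext
  funext H
  exact hσ p hp H

lemma exists_weight_comp (hμ : ∀ k : ℕ, ∃ p ∈ invariantPolynomials g, ∀ H : t,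
      evalAt g H p = ∑ a, μ a H ^ k) (hσ : Fixes σ) (a : J) : ∃ a', μ a ∘ₗ σ = μ a' := by
  obtain ⟨a', h⟩ := exists_eq_of_fixed (subst σ) (fun a => lin (μ a)) (subst_sum_pow hμ hσ) a
  exact ⟨a', lin_injective h⟩

lemma exists_eq_weight_comp (hμ : ∀ k : ℕ, ∃ p ∈ invariantPolynomials g, ∀ H : t,
      evalAt g H p = ∑ a, μ a H ^ k) (hσ : Fixes σ) (a : J) : ∃ a', μ a = μ a' ∘ₗ σ := by
  obtain ⟨a', h⟩ := exists_eq_of_fixed' (subst σ) (fun a => lin (μ a)) (subst_sum_pow hμ hσ) a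
  exact ⟨a', lin_injective h⟩

end Weights

variable (D : RootDatum g t)

lemma ext_α {H H' : t} (h : ∀ k, D.α k H = D.α k H') : H = H' := by
  rw [← sub_eq_zero]
  refine (Module.forall_dual_apply_eq_zero_iff ℂ _).mp fun l => ?_
  rw [← D.α.sum_repr l, LinearMap.sum_apply]
  exact Finset.sum_eq_zero fun k _ => by
    rw [LinearMap.smul_apply, map_sub, h, sub_self, smul_zero]

lemma α_repr_wt (i : D.κ) (k : D.ι) : D.α.repr (D.wt i) k = D.coef i k := by
  rw [D.wt_eq i]
  simp [Finsupp.single_apply]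

/-- The simple reflections, as linear maps. -/
def reflₗ (k : D.ι) : t →ₗ[ℂ] t := LinearMap.id - (D.α k).smulRight (D.h k)

lemma coef_nonneg {i : D.κ} {k : D.ι} (h : 0 < D.coef i k) (l : D.ι) : 0 ≤ D.coef i l :=
  (D.coef_sign i).resolve_right (fun h' => absurd (h' k) (not_le.mpr h)) l

lemma exists_coef_pos {i : D.κ} (hi : 0 < D.deg i) : ∃ k, 0 < D.coef i k := by
  by_contra! h
  exact absurd (Finset.sum_nonpos fun k (_ : k ∈ Finset.univ) => h k) (not_le.mpr hi)

lemma deg_pos {i : D.κ} {k : D.ι} (h : 0 < D.coef i k) : 0 < D.deg i :=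
  Finset.sum_pos' (fun l _ => D.coef_nonneg h l) ⟨k, Finset.mem_univ k, h⟩

lemma exists_wt_reflection {i : D.κ} (hi : 0 < D.deg i) {k : D.ι} (hk : D.wt i ≠ D.α k) :
    ∃ i', 0 < D.deg i' ∧ D.wt i' = D.wt i - D.wt i (D.h k) • D.α k := by
  obtain ⟨i', hi'⟩ := D.exists_reflection i k
  refine ⟨i', ?_, hi'⟩
  obtain ⟨l₀, hl₀⟩ := D.exists_coef_pos hi
  have hnn := D.coef_nonneg hl₀
  obtain ⟨l, hlk, hl⟩ : ∃ l, l ≠ k ∧ 0 < D.coef i l := by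
    by_contra! h
    have e : D.wt i = (D.coef i k : ℂ) • D.α k := by
      rw [D.wt_eq i]
      refine Finset.sum_eq_single k (fun l _ hl => ?_) (by simp)
      rw [le_antisymm (h l hl) (hnn l), Int.cast_zero, zero_smul]
    have hlk : l₀ = k := by
      by_contra hne
      exact absurd (h l₀ hne) (not_le.mpr hl₀)
    subst hlk
    rcases D.reduced i l₀ _ e with h | h | h
    · have : D.coef i l₀ = 0 := by exact_mod_cast h
      omega
    · exact hk (by rw [e, h, one_smul])
    · have : D.coef i l₀ = -1 := by exact_mod_cast h
      omega
  refine D.deg_pos (k := l) ?_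
  have : (D.coef i' l : ℂ) = D.coef i l := by
    rw [← α_repr_wt, ← α_repr_wt, hi']
    simp [hlk.symm]
  rw [show D.coef i' l = D.coef i l by exact_mod_cast this]
  exact hl

open scoped Classical in
/-- The positive roots taking a negative value at a point of `t`. -/
def negRoots (H : t) : Finset (Dual ℂ t) :=
  (Finset.univ.filter fun i => 0 < D.deg i ∧ (D.wt i H).re < 0).image D.wt

lemma mem_negRoots {H : t} {β : Dual ℂ t} :
    β ∈ D.negRoots H ↔ ∃ i, 0 < D.deg i ∧ D.wt i = β ∧ (β H).re < 0 := by
  simp only [negRoots, Finset.mem_image, Finset.mem_filter, Finset.mem_univ, true_and]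
  constructor
  · rintro ⟨i, ⟨h1, h2⟩, rfl⟩; exact ⟨i, h1, rfl, h2⟩
  · rintro ⟨i, h1, rfl, h2⟩; exact ⟨i, ⟨h1, h2⟩, rfl⟩

lemma coef_of_wt_eq_α {i : D.κ} {k : D.ι} (hi : D.wt i = D.α k) : D.coef i k = 1 := by
  have := D.α_repr_wt i k
  rw [hi, Basis.repr_self, Finsupp.single_eq_same] at this
  exact_mod_cast this.symm

lemma card_negRoots_refl {H : t} {k : D.ι} (hk : (D.α k H).re < 0) :
    (D.negRoots (D.refl k H)).card < (D.negRoots H).card := by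
  classical
  let s : Dual ℂ t → Dual ℂ t := fun β => β - β (D.h k) • D.α k
  have hs : ∀ β, s (s β) = β := fun β => by
    simp only [s, LinearMap.sub_apply, LinearMap.smul_apply, D.α_h, smul_eq_mul, sub_smul]
    module
  have hsH : ∀ β : Dual ℂ t, β (D.refl k H) = s β H := fun β => by
    simp [s, refl, mul_comm]
  have hsα : s (D.α k) = -D.α k := by
    simp only [s, D.α_h]
    module
  rw [← Finset.card_image_of_injective _ (Function.LeftInverse.injective hs)]
  refine Finset.card_lt_card ((Finset.ssubset_iff_of_subset ?_).mpr ⟨D.α k, ?_, ?_⟩)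
  · intro β hβ
    obtain ⟨γ, hγ, rfl⟩ := Finset.mem_image.mp hβ
    obtain ⟨i, hi, rfl, hneg⟩ := D.mem_negRoots.mp hγ
    rw [hsH] at hneg
    obtain ⟨i', hi', h⟩ := D.exists_wt_reflection hi (k := k) (by
      intro h
      rw [h, hsα, LinearMap.neg_apply, Complex.neg_re] at hneg
      linarith)
    exact D.mem_negRoots.mpr ⟨i', hi', h, hneg⟩
  · obtain ⟨i, hi⟩ := D.exists_wt_eq_α k
    exact D.mem_negRoots.mpr ⟨i, D.deg_pos (k := k) (by rw [D.coef_of_wt_eq_α hi]; exact one_pos),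
      hi, hk⟩
  · intro h
    obtain ⟨γ, hγ, h⟩ := Finset.mem_image.mp h
    obtain ⟨i, hi, rfl, hneg⟩ := D.mem_negRoots.mp hγ
    have h' : D.wt i = -D.α k := by rw [← hs (D.wt i), h, hsα]
    obtain ⟨l, hl⟩ := D.exists_coef_pos hi
    have e := D.α_repr_wt i l
    rw [h', map_neg, Basis.repr_self, Finsupp.neg_apply, Finsupp.single_apply] at e
    split_ifs at e with hkl
    · have : D.coef i l = -1 := by exact_mod_cast e.symm
      omega
    · have : D.coef i l = 0 := by
        rw [neg_zero] at e
        exact_mod_cast e.symm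
      omega

lemma exists_dominant {σ : t →ₗ[ℂ] t} (hσ : Fixes σ) :
    ∃ σ' : t →ₗ[ℂ] t, Fixes σ' ∧ (∀ φ : t → ℂ, (∀ k H, φ (D.refl k H) = φ H) →
      ∀ H, φ (σ' H) = φ (σ H)) ∧ ∀ k, 0 ≤ (D.α k (σ' D.h₀)).re := by
  induction hn : (D.negRoots (σ D.h₀)).card using Nat.strong_induction_on generalizing σ with
  | _ n ih =>
    by_cases h : ∀ k, 0 ≤ (D.α k (σ D.h₀)).re
    · exact ⟨σ, hσ, fun _ _ _ => rfl, h⟩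
    · push Not at h
      obtain ⟨k, hk⟩ := h
      have hlt := D.card_negRoots_refl hk
      obtain ⟨σ', h1, h2, h3⟩ := ih _ (hn ▸ hlt) (σ := D.reflₗ k ∘ₗ σ)
        (fun p hp H => (D.evalAt_refl hp k _).trans (hσ p hp H)) rfl
      exact ⟨σ', h1, fun φ hφ H => (h2 φ hφ H).trans (hφ k _), h3⟩

lemma α_dominant {σ : t →ₗ[ℂ] t} (hσ : Fixes σ) (hdom : ∀ k, 0 ≤ (D.α k (σ D.h₀)).re) (k : D.ι) :
    D.α k (σ D.h₀) = 1 := by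
  have hinj : Function.Injective σ := by
    rw [injective_iff_map_eq_zero]
    intro H hH
    have : ∀ j, D.α j H = 0 := fun j => by
      obtain ⟨i, hi⟩ := D.exists_wt_eq_α j
      obtain ⟨i', hi'⟩ := exists_eq_weight_comp D.exists_invariant_wt hσ i
      rw [← hi, hi', LinearMap.comp_apply, hH, map_zero]
    exact D.ext_α fun j => by rw [this, map_zero]
  have hsurj : Function.Surjective σ := LinearMap.injective_iff_surjective.mp hinj
  have hdeg : ∀ k, ∃ d : ℤ, 0 < d ∧ D.α k (σ D.h₀) = d := by
    intro k
    obtain ⟨i, hi⟩ := D.exists_wt_eq_α k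
    obtain ⟨i', hi'⟩ := exists_weight_comp D.exists_invariant_wt hσ i
    have h1 : D.α k (σ D.h₀) = D.deg i' := by rw [← D.wt_h₀, ← hi', hi]; rfl
    refine ⟨D.deg i', lt_of_le_of_ne ?_ fun h0 => ?_, h1⟩
    · have := hdom k
      rw [h1, Complex.intCast_re] at this
      exact_mod_cast this
    · have h2 : D.wt i' = 0 := D.wt_eq_zero_of_deg h0.symm
      refine D.α.ne_zero k (LinearMap.ext fun H => ?_)
      obtain ⟨H', rfl⟩ := hsurj H
      rw [← hi, ← LinearMap.comp_apply, hi', h2]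
      rfl
  choose d hd hdα using hdeg
  have hperm : ∀ j, ∃ k, D.α j = D.α k ∘ₗ σ ∧ d k = 1 := by
    intro j
    obtain ⟨i, hi⟩ := D.exists_wt_eq_α j
    obtain ⟨i', hi'⟩ := exists_eq_weight_comp D.exists_invariant_wt hσ i
    have hs : ∑ k, D.coef i' k * d k = 1 := by
      have h1 := D.α_h₀ j
      rw [← hi, hi', D.wt_eq i'] at h1
      simp only [LinearMap.comp_apply, LinearMap.sum_apply, LinearMap.smul_apply, hdα,
        smul_eq_mul] at h1
      exact_mod_cast h1
    obtain ⟨k, -, hk⟩ : ∃ k ∈ Finset.univ, 0 < D.coef i' k * d k := by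
      by_contra! h
      have := Finset.sum_nonpos h
      omega
    have hk' : 0 < D.coef i' k := pos_of_mul_pos_left hk (hd k).le
    have hnn : ∀ l, 0 ≤ D.coef i' l * d l := fun l => mul_nonneg (D.coef_nonneg hk' l) (hd l).le
    rw [← Finset.add_sum_erase _ _ (Finset.mem_univ k)] at hs
    have h0 : ∑ l ∈ Finset.univ.erase k, D.coef i' l * d l = 0 :=
      le_antisymm (by linarith) (Finset.sum_nonneg fun l _ => hnn l)
    rw [h0, add_zero] at hs
    have h1 : D.coef i' k = 1 :=
      Int.eq_one_of_mul_eq_one_right hk'.le hs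
    refine ⟨k, ?_, by rwa [h1, one_mul] at hs⟩
    rw [← hi, hi', D.wt_eq i', Finset.sum_eq_single k, h1, Int.cast_one, one_smul]
    · intro l _ hl
      have := (Finset.sum_eq_zero_iff_of_nonneg fun l _ => hnn l).mp h0 l (by simp [hl])
      rw [(mul_eq_zero.mp this).resolve_right (hd l).ne', Int.cast_zero, zero_smul]
    · simp
  choose π hπ hπ' using hperm
  have hπinj : Function.Injective π := fun a b hab => D.α.injective (by rw [hπ a, hπ b, hab])
  obtain ⟨j, rfl⟩ := Finite.injective_iff_surjective.mp hπinj k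
  rw [hdα, hπ', Int.cast_one]

theorem comp_eq_of_fixes {σ : t →ₗ[ℂ] t} (hσ : Fixes σ) {φ : t → ℂ}
    (hφ : ∀ k H, φ (D.refl k H) = φ H) (H : t) : φ (σ H) = φ H := by
  obtain ⟨σ', h1, h2, h3⟩ := D.exists_dominant hσ
  rw [← h2 φ hφ H]
  congr 1
  have hh₀ : σ' D.h₀ = D.h₀ := D.ext_α fun k => by rw [D.α_dominant h1 h3, D.α_h₀]
  have hw : ∀ j H, D.hwWt j (σ' H) = D.hwWt j H := by
    intro j H
    obtain ⟨J, _, _, ρ, μ, hρ, hμ, hn, a, ha⟩ := D.exists_rep j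
    obtain ⟨a', ha'⟩ := exists_weight_comp (exists_invariant_weights ρ hρ μ hμ) h1 a
    obtain ⟨n, hn⟩ := hn a'
    have h0 := congrArg (fun l => l D.h₀) hn
    simp only [← ha', ha, LinearMap.sub_apply, LinearMap.comp_apply, hh₀, sub_self,
      LinearMap.sum_apply, LinearMap.smul_apply, D.α_h₀, smul_eq_mul, mul_one] at h0
    have h0' : ∑ k, n k = 0 := by exact_mod_cast h0.symm
    have hn0 : ∀ k, n k = 0 := fun k => Finset.sum_eq_zero_iff.mp h0' k (Finset.mem_univ k)
    rw [← ha', ha] at hn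
    have := congrArg (fun l => l H) hn
    simp only [hn0, Nat.cast_zero, zero_smul, Finset.sum_const_zero, LinearMap.sub_apply,
      LinearMap.comp_apply, LinearMap.zero_apply, sub_eq_zero] at this
    exact this.symm
  have hcoord : ∀ j H, D.hwWt j H = D.h.repr H j * D.hwWt j (D.h j) := by
    intro j H
    conv_lhs => rw [← D.h.sum_repr H, map_sum]
    rw [Finset.sum_eq_single j]
    · rw [map_smul, smul_eq_mul]
    · intro k _ hk
      rw [map_smul, D.hwWt_h j hk, smul_zero]
    · simp
  have hne : ∀ j, D.hwWt j (D.h j) ≠ 0 := fun j h0 => D.hwWt_ne_zero j (LinearMap.ext fun H => by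
    rw [hcoord, h0, mul_zero, LinearMap.zero_apply])
  refine D.h.repr.injective (Finsupp.ext fun j => mul_right_cancel₀ (hne j) ?_)
  rw [← hcoord, ← hcoord, hw]

theorem exists_invariant_of_refl {φ : t → ℂ} (hφ : φ ∈ polyFun t)
    (h : ∀ k H, φ (D.refl k H) = φ H) :
    ∃ p ∈ invariantPolynomials g, ∀ H : t, evalAt g H p = φ H :=
  D.exists_invariant_of_fixed hφ fun _ hσ H => D.comp_eq_of_fixes hσ h H

end RootDatum

end Kostant

namespace Kostant

lemma derivation_eq_sum {κ : Type*} [Fintype κ] (d : Derivation ℂ (MvPolynomial κ ℂ) (MvPolynomial κ ℂ))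
    (p : MvPolynomial κ ℂ) : d p = ∑ i, pderiv i p * d (X i) := by
  classical
  have : d = ∑ i, d (X i) • pderiv i := by
    refine derivation_ext fun j => ?_
    rw [← Derivation.coeFnAddMonoidHom_apply (∑ i, d (X i) • pderiv i), map_sum, Finset.sum_apply]
    simp [pderiv_X, Pi.single_apply]
  conv_lhs => rw [this]
  rw [← Derivation.coeFnAddMonoidHom_apply, map_sum, Finset.sum_apply]
  simp [mul_comm]

section Homogeneous

variable {g}

lemma coadjointDerivation_isHomogeneous (y : g) {p : PolyAlg g} {n : ℕ} (hp : p.IsHomogeneous n) :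
    (coadjointDerivation g y p).IsHomogeneous n := by
  rcases n with _ | n
  · rw [← totalDegree_zero_iff_isHomogeneous, totalDegree_eq_zero_iff_eq_C] at hp
    rw [hp, ← algebraMap_eq, Derivation.map_algebraMap]
    exact isHomogeneous_zero _ _ _
  · rw [derivation_eq_sum]
    refine IsHomogeneous.sum _ _ _ fun i _ => (hp.pderiv (i := i)).mul ?_
    rw [coadjointDerivation, mkDerivation_X]
    refine (IsHomogeneous.sum _ _ _ fun j _ => ?_).neg
    rw [smul_eq_C_mul]
    exact (isHomogeneous_X ℂ j).C_mul _

lemma homogeneousComponent_mem_invariants {p : PolyAlg g} (hp : p ∈ invariantPolynomials g) (n : ℕ) :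
    homogeneousComponent n p ∈ invariantPolynomials g := by
  intro y
  have h0 : coadjointDerivation g y p = 0 := hp y
  have h := congrArg (homogeneousComponent n) (congrArg (coadjointDerivation g y)
    (sum_homogeneousComponent p))
  rw [h0, map_zero, map_sum, map_sum, Finset.sum_congr rfl fun m _ =>
    homogeneousComponent_of_mem (coadjointDerivation_isHomogeneous y
      (homogeneousComponent_isHomogeneous m p))] at h
  by_cases hn : n ∈ Finset.range (p.totalDegree + 1)
  · rw [Finset.sum_ite_eq, if_pos hn] at h
    exact h
  · rw [homogeneousComponent_eq_zero, map_zero]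
    simpa using hn

lemma exists_homogeneous_linearIndependent (x : g) {r : ℕ} {f : Fin r → PolyAlg g}
    (hf : ∀ i, f i ∈ invariantPolynomials g) (hli : LinearIndependent ℂ fun i => diffAt g x (f i)) :
    ∃ f' : Fin r → PolyAlg g, (∀ i, f' i ∈ invariantPolynomials g) ∧
      (∀ i, ∃ d, (f' i).IsHomogeneous d) ∧ LinearIndependent ℂ fun i => diffAt g x (f' i) := by
  classical
  let S : Set (Dual ℂ g) :=
    {l | ∃ p ∈ invariantPolynomials g, (∃ d, p.IsHomogeneous d) ∧ diffAt g x p = l}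
  obtain ⟨b, hb, hspan, hbli⟩ := exists_linearIndependent ℂ S
  have hmem : ∀ i, diffAt g x (f i) ∈ Submodule.span ℂ b := by
    intro i
    rw [hspan, ← sum_homogeneousComponent (f i), ← diffAtₗ_apply, map_sum]
    exact Submodule.sum_mem _ fun d _ => Submodule.subset_span
      ⟨_, homogeneousComponent_mem_invariants (hf i) d,
        ⟨d, homogeneousComponent_isHomogeneous d _⟩, rfl⟩
  have hbfin : Finite b := hbli.finite
  have := Fintype.ofFinite b
  have hcard : Fintype.card (Fin r) ≤ Fintype.card b := by
    have h1 : LinearIndependent ℂ (fun i => (⟨_, hmem i⟩ : Submodule.span ℂ b)) :=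
      LinearIndependent.of_comp (Submodule.span ℂ b).subtype hli
    have h2 := h1.fintype_card_le_finrank
    rwa [finrank_span_set_eq_card hbli, Set.toFinset_card] at h2
  obtain ⟨e⟩ := Function.Embedding.nonempty_of_card_le hcard
  choose q hq hhom hdiff using fun m : b => hb m.2
  refine ⟨fun i => q (e i), fun i => hq _, fun i => hhom _, ?_⟩
  simp only [hdiff]
  exact hbli.comp e e.injective

end Homogeneous

section Transcendence

variable {R : Type} [CommRing R] [IsDomain R] [Algebra ℂ R] {J : Type} [Fintype J]

lemma isIntegral_of_sum_pow_mem (S : Subalgebra ℂ R) (a : J → R) (h : ∀ k, ∑ i, a i ^ k ∈ S)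
    (i : J) : IsIntegral S (a i) := by
  have hl : ∏ i, (Polynomial.X - Polynomial.C (a i)) ∈ Polynomial.lifts (algebraMap S R) := by
    rw [Polynomial.lifts_iff_coeff_lifts]
    intro k
    exact ⟨⟨_, coeff_prod_mem S a h k⟩, rfl⟩
  obtain ⟨q, hq, -, hm⟩ := Polynomial.lifts_and_natDegree_eq_and_monic hl
    (Polynomial.monic_prod_of_monic _ _ fun i _ => Polynomial.monic_X_sub_C _)
  refine ⟨q, hm, ?_⟩
  rw [← Polynomial.eval_map, hq, Polynomial.eval_prod]
  exact Finset.prod_eq_zero (Finset.mem_univ i) (by simp)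

lemma algebraicIndependent_of_sum_pow_mem {I : Type} [Finite I] (x : I → R)
    (hI : Cardinal.mk I ≤ Algebra.trdeg ℂ R) (a : J → R)
    (ha : Algebra.adjoin ℂ (Set.range a) = ⊤)
    (h : ∀ k, ∑ i, a i ^ k ∈ Algebra.adjoin ℂ (Set.range x)) : AlgebraicIndependent ℂ x := by
  have h_int : Algebra.IsIntegral (Algebra.adjoin ℂ (Set.range x)) R := ⟨fun z => by
    have hz : z ∈ Algebra.adjoin ℂ (Set.range a) := by rw [ha]; trivial
    induction hz using Algebra.adjoin_induction with
    | mem z hz => obtain ⟨i, rfl⟩ := hz; exact isIntegral_of_sum_pow_mem _ a h i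
    | algebraMap c => exact isIntegral_algebraMap (x := algebraMap ℂ _ c)
    | add u v _ _ hu hv => exact hu.add hv
    | mul u v _ _ hu hv => exact hu.mul hv⟩
  have : Algebra.IsAlgebraic (Algebra.adjoin ℂ (Set.range x)) R := h_int.isAlgebraic
  have : FaithfulSMul ℂ R := (faithfulSMul_iff_algebraMap_injective ℂ R).mpr
    (algebraMap ℂ R).injective
  exact (Algebra.IsAlgebraic.isTranscendenceBasis_of_le_trdeg_of_finite ℂ x hI).1

end Transcendence

namespace RootDatum

variable {g} {t : LieSubalgebra ℂ g} (D : RootDatum g t)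

lemma trdeg_polyFun : Algebra.trdeg ℂ (polyFun t) = Cardinal.mk D.ι := by
  rw [← (polyFunEquiv D.h).trdeg_eq, MvPolynomial.trdeg_of_isDomain, Cardinal.lift_id]

lemma mk_eq_finrank : Cardinal.mk D.ι = finrank ℂ t := by
  rw [Module.finrank_eq_card_basis D.h, Cardinal.mk_fintype]

/-- Coordinates of `toSlice`. -/
def sliceCoord (l : Dual ℂ g) : polyFun t := ⟨fun H => l (D.toSlice H), D.isPolyMap_toSlice l⟩

variable {I : Type} [Finite I] (b : Module.Basis I ℂ D.slice) {l : I → Dual ℂ g}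

lemma exists_dual_basis : ∃ l : I → Dual ℂ g, ∀ i (s : D.slice), l i s = b.coord i s := by
  choose l hl using fun i => LinearMap.exists_extend (b.coord i)
  exact ⟨l, fun i s => congrArg (fun m => m s) (hl i)⟩

lemma aeval_sliceCoord (hl : ∀ i (s : D.slice), l i s = b.coord i s) (P : MvPolynomial I ℂ) (H : t) :
    (aeval (fun i => D.sliceCoord (l i)) P : t → ℂ) H = coordEval b P ⟨_, D.toSlice_mem H⟩ := by
  rw [coordEval_apply]
  have : ((Pi.evalAlgHom ℂ (fun _ : t => ℂ) H).comp (polyFun t).val).comp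
      (aeval fun i => D.sliceCoord (l i)) = aeval fun i => b.coord i ⟨_, D.toSlice_mem H⟩ := by
    ext i
    simp [sliceCoord, ← hl]
  exact congrArg (fun m => m P) this

lemma algebraicIndependent_sliceCoord (hl : ∀ i (s : D.slice), l i s = b.coord i s) :
    AlgebraicIndependent ℂ fun i => D.sliceCoord (l i) := by
  have := Fintype.ofFinite I
  refine algebraicIndependent_of_sum_pow_mem _ ?_ (fun i => lin (D.wt i)) D.adjoin_wt fun k => ?_
  · rw [D.trdeg_polyFun, D.mk_eq_finrank, ← D.finrank_slice, Module.finrank_eq_card_basis b,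
      Cardinal.mk_fintype]
  · obtain ⟨p, hp, h⟩ := D.exists_invariant_wt k
    have hF : (fun s : D.slice => evalAt g (D.e₀ + s) p) ∈ polyFun D.slice :=
      IsPolyMap.comp_mem ((IsPolyMap.const D.e₀).add (IsPolyMap.of_linear D.slice.subtype))
        (evalAt_mem_polyFun p)
    rw [← coordEval_range b] at hF
    obtain ⟨P, hP⟩ := hF
    rw [Algebra.adjoin_range_eq_range_aeval]
    refine ⟨P, Subtype.ext (funext fun H => ?_)⟩
    refine (D.aeval_sliceCoord b hl P H).trans ?_
    refine (congrFun hP _).trans ?_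
    refine (D.evalAt_toSlice hp H).trans ?_
    rw [h]
    simp [lin]

variable [LieAlgebra.IsSemisimple ℂ g]

lemma exists_invariant_slice (m : Dual ℂ g) :
    ∃ p ∈ invariantPolynomials g, ∀ s ∈ D.slice, evalAt g (D.e₀ + s) p = m s := by
  obtain ⟨p, hp, h⟩ := D.exists_invariant_of_refl (D.isPolyMap_toSlice m)
    fun k H => by rw [D.toSlice_refl]
  refine ⟨p, hp, fun s hs => ?_⟩
  let b := Module.finBasis ℂ D.slice
  obtain ⟨l, hl⟩ := D.exists_dual_basis b
  have hF : (fun s : D.slice => evalAt g (D.e₀ + s) p - m s) ∈ polyFun D.slice :=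
    (polyFun D.slice).sub_mem
      (IsPolyMap.comp_mem ((IsPolyMap.const D.e₀).add (IsPolyMap.of_linear D.slice.subtype))
        (evalAt_mem_polyFun p)) (dual_mem_polyFun (m ∘ₗ D.slice.subtype))
  rw [← coordEval_range b] at hF
  obtain ⟨P, hP⟩ := hF
  have hP0 : P = 0 := by
    refine (D.algebraicIndependent_sliceCoord b hl).eq_zero_of_aeval_eq_zero P ?_
    refine Subtype.ext (funext fun H => ?_)
    refine (D.aeval_sliceCoord b hl P H).trans ((congrFun hP _).trans ?_)
    simp [D.evalAt_toSlice hp, h]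
  have := congrFun hP ⟨s, hs⟩
  rw [hP0, map_zero] at this
  exact sub_eq_zero.mp this.symm

lemma exists_invariant_diffAt (m : Dual ℂ g) :
    ∃ p ∈ invariantPolynomials g, ∀ s ∈ D.slice, diffAt g D.e₀ p s = m s := by
  obtain ⟨p, hp, h⟩ := D.exists_invariant_slice m
  refine ⟨p, hp, fun s hs => ?_⟩
  have h1 := hasDerivAt_evalAt_line p D.e₀ s 0
  have h2 : (fun c : ℂ => evalAt g (D.e₀ + c • s) p) = fun c => c * m s := by
    funext c
    rw [h _ (D.slice.smul_mem c hs), map_smul, smul_eq_mul]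
  rw [h2, zero_smul, add_zero] at h1
  simpa using h1.unique ((hasDerivAt_id (0 : ℂ)).mul_const (m s))

theorem exists_homogeneous_invariants : ∃ f : Fin (finrank ℂ t) → PolyAlg g,
    (∀ i, f i ∈ invariantPolynomials g) ∧ (∀ i, ∃ d, (f i).IsHomogeneous d) ∧
      LinearIndependent ℂ fun i => diffAt g D.e₀ (f i) := by
  rw [← D.finrank_slice]
  let b := Module.finBasis ℂ D.slice
  obtain ⟨l, hl⟩ := D.exists_dual_basis b
  choose p hp hdiff using fun i => D.exists_invariant_diffAt (l i)
  refine exists_homogeneous_linearIndependent D.e₀ hp ?_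
  refine LinearIndependent.of_comp (LinearMap.lcomp ℂ ℂ D.slice.subtype) ?_
  have : (LinearMap.lcomp ℂ ℂ D.slice.subtype ∘ fun i => diffAt g D.e₀ (p i)) = b.coord := by
    funext i
    ext s
    exact (hdiff i s s.2).trans (hl i s)
  rw [this]
  exact b.linearIndependent_coord

end RootDatum

end Kostant

namespace Kostant

section Derivations

lemma dvd_derivation_of_pow {M : Type*} [CommRing M] [IsDomain M] [Algebra ℂ M]
    (d : Derivation ℂ M M) {q a b : M} (hq : Prime q) {m : ℕ} (hm : m ≠ 0) (ha : a = q ^ m * b)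
    (hb : ¬ q ∣ b) (hd : q ^ m ∣ d a) : q ∣ d q := by
  obtain ⟨n, rfl⟩ := Nat.exists_eq_succ_of_ne_zero hm
  rw [ha, Derivation.leibniz, Derivation.leibniz_pow, Nat.succ_sub_one] at hd
  simp only [smul_eq_mul, nsmul_eq_mul] at hd
  rw [dvd_add_right (dvd_mul_right _ _)] at hd
  obtain ⟨c, hc⟩ := hd
  have hne : q ^ n ≠ 0 := pow_ne_zero _ hq.ne_zero
  have h1 : b * (((n.succ : ℕ) : M) * d q) = q * c := by
    apply mul_left_cancel₀ hne
    rw [← mul_assoc (q ^ n) q c, ← pow_succ, ← hc]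
    ring
  have h2 : q ∣ ((n.succ : ℕ) : M) * d q := (hq.dvd_or_dvd (Dvd.intro _ h1.symm)).resolve_left hb
  have hu : IsUnit ((n.succ : ℕ) : M) := by
    rw [← map_natCast (algebraMap ℂ M)]
    exact (IsUnit.mk0 _ (Nat.cast_ne_zero.mpr n.succ_ne_zero)).map _
  exact (hu.dvd_mul_left).mp h2

variable {κ : Type*} [Fintype κ]

lemma totalDegree_derivation_le {d : Derivation ℂ (MvPolynomial κ ℂ) (MvPolynomial κ ℂ)}
    (hd : ∀ i, (d (X i)).totalDegree ≤ 1) (p : MvPolynomial κ ℂ) :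
    (d p).totalDegree ≤ p.totalDegree := by
  rcases hn : p.totalDegree with _ | n
  · rw [totalDegree_eq_zero_iff_eq_C.mp hn, ← algebraMap_eq, Derivation.map_algebraMap]
    simp
  · rw [derivation_eq_sum]
    refine totalDegree_finsetSum_le fun i _ => (totalDegree_mul _ _).trans ?_
    exact add_le_add (totalDegree_pderiv_le hn.le i) (hd i)

lemma exists_derivation_eq_smul {d : Derivation ℂ (MvPolynomial κ ℂ) (MvPolynomial κ ℂ)}
    (hd : ∀ i, (d (X i)).totalDegree ≤ 1) {q : MvPolynomial κ ℂ} (hq : q ≠ 0) (h : q ∣ d q) :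
    ∃ c : ℂ, d q = c • q := by
  obtain ⟨a, ha⟩ := h
  have hdeg := totalDegree_derivation_le hd q
  by_cases ha0 : a = 0
  · exact ⟨0, by rw [ha, ha0, mul_zero, zero_smul]⟩
  · rw [ha, totalDegree_mul_of_isDomain hq ha0] at hdeg
    have : a.totalDegree = 0 := by omega
    refine ⟨a.coeff 0, ?_⟩
    rw [ha, smul_eq_C_mul, ← totalDegree_eq_zero_iff_eq_C.mp this, mul_comm]

/-- The Euler derivation. -/
def euler : Derivation ℂ (MvPolynomial κ ℂ) (MvPolynomial κ ℂ) := mkDerivation ℂ X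

lemma euler_of_isHomogeneous {p : MvPolynomial κ ℂ} {n : ℕ} (hp : p.IsHomogeneous n) :
    euler p = n • p := by
  rw [derivation_eq_sum, ← hp.sum_X_mul_pderiv]
  exact Finset.sum_congr rfl fun i _ => by rw [euler, mkDerivation_X, mul_comm]

lemma eq_C_of_euler_eq_zero {p : MvPolynomial κ ℂ} (hp : euler p = 0) : ∃ c, p = C c := by
  have h : ∀ n, n ≠ 0 → homogeneousComponent n p = 0 := by
    intro n hn
    have h1 := congrArg (homogeneousComponent n) (congrArg (euler (κ := κ))
      (sum_homogeneousComponent p))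
    rw [hp, map_zero, map_sum, map_sum, Finset.sum_congr rfl fun m _ => by
      rw [euler_of_isHomogeneous (homogeneousComponent_isHomogeneous m p), map_nsmul,
        homogeneousComponent_of_mem (homogeneousComponent_isHomogeneous m p)]] at h1
    by_cases hm : n ∈ Finset.range (p.totalDegree + 1)
    · rw [Finset.sum_eq_single n (fun m _ hne => by rw [if_neg hne.symm, smul_zero])
        (fun h => absurd hm h), if_pos rfl] at h1
      exact (smul_eq_zero.mp h1).resolve_left hn
    · exact homogeneousComponent_eq_zero _ _ (by simpa using hm)
  refine ⟨p.coeff 0, ?_⟩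
  rw [← homogeneousComponent_zero, ← sum_homogeneousComponent p, map_sum]
  refine Finset.sum_congr rfl fun n _ => ?_
  rcases eq_or_ne n 0 with rfl | hn
  · rw [homogeneousComponent_of_mem (homogeneousComponent_isHomogeneous 0 p), if_pos rfl]
  · rw [h n hn, map_zero]

end Derivations

section Directional

variable {g}

/-- The derivative in the direction of a vector. -/
def dirDer (v : g) : Derivation ℂ (PolyAlg g) (PolyAlg g) :=
  mkDerivation ℂ fun i => C ((gBasis g).coord i v)

lemma dirDer_X (v : g) (i) : dirDer v (X i) = C ((gBasis g).coord i v) := mkDerivation_X _ _ _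

lemma evalAt_dirDer (z v : g) (p : PolyAlg g) : evalAt g z (dirDer v p) = diffAt g z p v := by
  rw [derivation_eq_sum, map_sum, diffAt_apply]
  refine Finset.sum_congr rfl fun i _ => ?_
  rw [map_mul, dirDer_X, ← algebraMap_eq, AlgHom.commutes]
  rfl

/-- A linear form as a polynomial. -/
def linPoly (l : Dual ℂ g) : PolyAlg g := ∑ i, l (gBasis g i) • X i

lemma evalAt_linPoly (l : Dual ℂ g) (z : g) : evalAt g z (linPoly l) = l z := by
  conv_rhs => rw [← (gBasis g).sum_repr z, map_sum]
  rw [linPoly, map_sum]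
  exact Finset.sum_congr rfl fun i _ => by
    rw [map_smul, map_smul, evalAt_X, smul_eq_mul, smul_eq_mul, mul_comm]; rfl

lemma diffAt_linPoly (l : Dual ℂ g) (z : g) : diffAt g z (linPoly l) = l := by
  refine (gBasis g).ext fun j => ?_
  rw [linPoly, ← diffAtₗ_apply, map_sum, LinearMap.sum_apply]
  simp only [map_smul, diffAtₗ_apply, diffAt_X, LinearMap.smul_apply, Basis.coord_apply,
    Basis.repr_self, smul_eq_mul]
  rw [Finset.sum_eq_single j]
  · simp
  · intro i _ hi; simp [hi.symm]
  · simp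

lemma coadjointDerivation_linPoly (y : g) (l : Dual ℂ g) :
    coadjointDerivation g y (linPoly l) = -linPoly (l ∘ₗ (ad ℂ g y : g →ₗ[ℂ] g)) := by
  refine evalAt_ext fun z => ?_
  rw [evalAt_coadjointDerivation, map_neg, evalAt_linPoly, diffAt_linPoly]
  rfl

lemma X_eq_linPoly (i) : (X i : PolyAlg g) = linPoly ((gBasis g).coord i) :=
  evalAt_ext fun z => by rw [evalAt_linPoly, evalAt_X]

lemma coadjointDerivation_lie (y z : g) :
    coadjointDerivation g ⁅y, z⁆ = ⁅coadjointDerivation g y, coadjointDerivation g z⁆ := by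
  refine derivation_ext fun i => ?_
  rw [Derivation.commutator_apply, X_eq_linPoly]
  simp only [coadjointDerivation_linPoly, map_neg, neg_neg]
  refine evalAt_ext fun x => ?_
  rw [map_sub, map_neg, evalAt_linPoly, evalAt_linPoly, evalAt_linPoly]
  simp only [LinearMap.comp_apply, ad_apply ℂ g]
  rw [lie_lie, map_sub]
  ring

lemma coadjointDerivation_smul (c : ℂ) (y : g) (p : PolyAlg g) :
    coadjointDerivation g (c • y) p = c • coadjointDerivation g y p := by
  refine evalAt_ext fun z => ?_
  rw [evalAt_coadjointDerivation, map_smul, evalAt_coadjointDerivation, smul_lie, map_smul,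
    smul_neg]

lemma commutator_dirDer (y v : g) :
    ⁅coadjointDerivation g y, dirDer v⁆ = dirDer ⁅y, v⁆ := by
  refine derivation_ext fun i => evalAt_ext fun z => ?_
  rw [Derivation.commutator_apply, dirDer_X, dirDer_X, ← algebraMap_eq,
    Derivation.map_algebraMap, zero_sub, map_neg, evalAt_dirDer, X_eq_linPoly,
    coadjointDerivation_linPoly, ← diffAtₗ_apply, map_neg, diffAtₗ_apply, diffAt_linPoly,
    AlgHom.commutes]
  simp

lemma coadjointDerivation_dirDer {p : PolyAlg g} (hp : p ∈ invariantPolynomials g) (y v : g) :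
    coadjointDerivation g y (dirDer v p) = dirDer ⁅y, v⁆ p := by
  rw [← commutator_dirDer, Derivation.commutator_apply,
    show coadjointDerivation g y p = 0 from hp y, map_zero, sub_zero]

lemma dirDer_isHomogeneous (v : g) {p : PolyAlg g} {n : ℕ} (hp : p.IsHomogeneous n) :
    (dirDer v p).IsHomogeneous (n - 1) := by
  rw [derivation_eq_sum]
  refine IsHomogeneous.sum _ _ _ fun i _ => ?_
  rw [dirDer_X, mul_comm]
  exact (hp.pderiv (i := i)).C_mul _

lemma dirDer_eq_sum {σ : Type*} [Fintype σ] (c : Module.Basis σ ℂ g) (v : g) (p : PolyAlg g) :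
    dirDer v p = ∑ a, C (c.coord a v) * dirDer (c a) p := by
  refine evalAt_ext fun z => ?_
  rw [evalAt_dirDer, map_sum]
  conv_lhs => rw [← c.sum_repr v, map_sum]
  refine Finset.sum_congr rfl fun a _ => ?_
  rw [map_smul, map_mul, evalAt_dirDer, ← algebraMap_eq, AlgHom.commutes]
  rfl

lemma sum_dirDer_linPoly {σ : Type*} [Fintype σ] (c : Module.Basis σ ℂ g) {p : PolyAlg g}
    (hp : p ∈ invariantPolynomials g) (u : g) :
    ∑ a, dirDer (c a) p * linPoly (c.coord a ∘ₗ (ad ℂ g u : g →ₗ[ℂ] g)) = 0 := by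
  refine evalAt_ext fun z => ?_
  rw [map_zero, map_sum, ← mem_invariantPolynomials_iff.mp hp z u]
  conv_rhs => rw [← c.sum_repr ⁅u, z⁆, map_sum]
  refine Finset.sum_congr rfl fun a _ => ?_
  rw [map_mul, map_smul, evalAt_dirDer, evalAt_linPoly, smul_eq_mul, mul_comm]
  rfl

end Directional

section Minors

variable {g} {r : ℕ} (f : Fin r → PolyAlg g)

/-- The minors of the Jacobian matrix. -/
def minor (v : Fin r → g) : PolyAlg g := (Matrix.of fun i j => dirDer (v j) (f i)).det

lemma evalAt_minor (v : Fin r → g) (z : g) :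
    evalAt g z (minor f v) = (Matrix.of fun i j => diffAt g z (f i) (v j)).det := by
  rw [minor, AlgHom.map_det]
  congr 1
  ext i j
  exact evalAt_dirDer _ _ _

lemma coadjointDerivation_minor {f : Fin r → PolyAlg g} (hf : ∀ i, f i ∈ invariantPolynomials g)
    (y : g) (v : Fin r → g) :
    coadjointDerivation g y (minor f v) = ∑ j, minor f (Function.update v j ⁅y, v j⁆) := by
  rw [minor, derivation_det]
  refine Finset.sum_congr rfl fun j _ => ?_
  rw [minor]
  congr 1
  ext i k
  rw [Matrix.updateCol_apply, Matrix.of_apply, Matrix.of_apply, Matrix.of_apply]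
  split_ifs with h
  · subst h
    rw [Function.update_self, coadjointDerivation_dirDer (hf i)]
  · rw [Function.update_of_ne h]

lemma minor_isHomogeneous {f : Fin r → PolyAlg g} (hf : ∀ i, ∃ d, (f i).IsHomogeneous d)
    (v : Fin r → g) : ∃ d, (minor f v).IsHomogeneous d := by
  choose d hd using hf
  refine ⟨∑ i, (d i - 1), ?_⟩
  rw [minor, Matrix.det_apply']
  refine IsHomogeneous.sum _ _ _ fun σ _ => ?_
  have e : (((Equiv.Perm.sign σ : ℤˣ) : ℤ) : PolyAlg g) = C (((Equiv.Perm.sign σ : ℤˣ) : ℤ) : ℂ) :=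
    (map_intCast (C : ℂ →+* PolyAlg g) _).symm
  rw [e, ← Equiv.sum_comp σ]
  exact (IsHomogeneous.prod Finset.univ (fun i => dirDer (v i) (f (σ i))) (fun i => d (σ i) - 1)
    fun i _ => dirDer_isHomogeneous (v i) (hd (σ i))).C_mul _

lemma exists_apply_eq_one {φ : Fin r → Dual ℂ g} (h : LinearIndependent ℂ φ) :
    ∃ v : Fin r → g, Matrix.of (fun i j => φ i (v j)) = 1 := by
  have hs : LinearMap.range (LinearMap.pi φ) = ⊤ := by
    by_contra hne
    obtain ⟨F, hF, hle⟩ := Submodule.exists_le_ker_of_lt_top _ (lt_top_iff_ne_top.mpr hne)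
    apply hF
    have hzero : ∑ i, F (Pi.single i 1) • φ i = 0 := by
      ext v
      have h1 : F (LinearMap.pi φ v) = 0 := hle (LinearMap.mem_range_self _ v)
      rw [LinearMap.pi_apply_eq_sum_univ] at h1
      rw [LinearMap.sum_apply, LinearMap.zero_apply, ← h1]
      refine Finset.sum_congr rfl fun i _ => ?_
      rw [LinearMap.smul_apply, smul_eq_mul, smul_eq_mul, mul_comm]
      congr 2
      ext j
      simp [Pi.single_apply, eq_comm]
    have h0 := Fintype.linearIndependent_iff.mp h _ hzero
    exact LinearMap.pi_ext' fun i => LinearMap.ext_ring (by simpa using h0 i)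
  choose v hv using fun j => LinearMap.range_eq_top.mp hs (Pi.single j 1)
  refine ⟨v, ?_⟩
  ext i j
  rw [Matrix.one_apply, Matrix.of_apply, ← Pi.single_apply, ← hv j]
  rfl

lemma exists_minor_ne_zero {z : g} (h : LinearIndependent ℂ fun i => diffAt g z (f i)) :
    ∃ v, evalAt g z (minor f v) ≠ 0 := by
  obtain ⟨v, hv⟩ := exists_apply_eq_one h
  refine ⟨v, ?_⟩
  rw [evalAt_minor, hv, Matrix.det_one]
  exact one_ne_zero

lemma exists_minor_relation {f : Fin r → PolyAlg g} (hf : ∀ i, f i ∈ invariantPolynomials g) {x : g}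
    (hx : finrank ℂ (LinearMap.ker (ad ℂ g x : g →ₗ[ℂ] g)) = r) :
    ∃ (P : PolyAlg g) (w : Fin r → g), evalAt g x P ≠ 0 ∧
      ∀ v, ∃ β, P * minor f v = minor f w * β := by
  classical
  obtain ⟨W, hW⟩ := Submodule.exists_isCompl (LinearMap.range (ad ℂ g x : g →ₗ[ℂ] g))
  have hWr : finrank ℂ W = r := by
    have h1 := Submodule.finrank_add_eq_of_isCompl hW
    have h2 := LinearMap.finrank_range_add_finrank_ker (ad ℂ g x : g →ₗ[ℂ] g)
    omega
  let bK := Module.finBasis ℂ (LinearMap.range (ad ℂ g x : g →ₗ[ℂ] g))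
  let bW := Module.finBasisOfFinrankEq ℂ W hWr
  let c := (bK.prod bW).map (Submodule.prodEquivOfIsCompl _ _ hW)
  choose u hu using fun k => (bK k).2
  have hcl : ∀ k, c (Sum.inl k) = ⁅x, u k⁆ := fun k => by
    simp [c, ← hu]
  let M : Matrix _ _ (PolyAlg g) := Matrix.of fun a =>
    Sum.elim (fun k => -linPoly (c.coord a ∘ₗ (ad ℂ g (u k) : g →ₗ[ℂ] g)))
      (fun j => C (c.coord a (c (Sum.inr j))))
  have hMx : (evalAt g x).mapMatrix M = 1 := by
    ext a b
    rcases b with k | j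
    · simp only [M, AlgHom.mapMatrix_apply, Matrix.map_apply, Matrix.of_apply, Sum.elim_inl, map_neg,
        evalAt_linPoly, LinearMap.comp_apply]
      rw [← map_neg, ad_apply ℂ g, lie_skew, ← hcl]
      simp [Matrix.one_apply, Finsupp.single_apply, eq_comm]
    · simp only [M, AlgHom.mapMatrix_apply, Matrix.map_apply, Matrix.of_apply, Sum.elim_inr]
      rw [← algebraMap_eq, AlgHom.commutes]
      simp [Matrix.one_apply, Finsupp.single_apply, eq_comm]
  refine ⟨M.det ^ r, fun j => c (Sum.inr j), ?_, fun v => ?_⟩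
  · rw [map_pow, AlgHom.map_det, hMx, Matrix.det_one, one_pow]
    exact one_ne_zero
  · let V : Matrix _ (Fin r) (PolyAlg g) := Matrix.of fun a l => C (c.coord a (v l))
    let Θ : Matrix (Fin r) _ (PolyAlg g) := Matrix.of fun i a => dirDer (c a) (f i)
    have h1 : Θ * V = Matrix.of fun i j => dirDer (v j) (f i) := by
      ext1 i j
      rw [Matrix.mul_apply, Matrix.of_apply, dirDer_eq_sum c]
      exact Finset.sum_congr rfl fun a _ => mul_comm _ _
    have h2 : Θ * M = Matrix.of fun i => Sum.elim (fun _ => 0)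
        fun j => dirDer (c (Sum.inr j)) (f i) := by
      ext1 i b
      rw [Matrix.mul_apply]
      rcases b with k | j
      · have := sum_dirDer_linPoly c (hf i) (u k)
        simp only [Θ, M, Matrix.of_apply, Sum.elim_inl, mul_neg, Finset.sum_neg_distrib, this,
          neg_zero]
      · simp only [Θ, M, Matrix.of_apply, Sum.elim_inr]
        rw [dirDer_eq_sum c (c (Sum.inr j))]
        exact Finset.sum_congr rfl fun a _ => mul_comm _ _
    let T := (M.adjugate * V).submatrix Sum.inr id
    have h3 : M.det • (Θ * V) = (Matrix.of fun i j => dirDer (c (Sum.inr j)) (f i)) * T := by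
      have e : M.det • (Θ * V) = (Θ * M) * (M.adjugate * V) := by
        rw [Matrix.mul_assoc, ← Matrix.mul_assoc M, Matrix.mul_adjugate, Matrix.smul_mul,
          Matrix.one_mul, Matrix.mul_smul]
      rw [e, h2]
      ext1 i l
      rw [Matrix.mul_apply, Fintype.sum_sum_type, Matrix.mul_apply]
      simp only [Matrix.of_apply, Sum.elim_inl, Sum.elim_inr, zero_mul, Finset.sum_const_zero,
        zero_add]
      rfl
    refine ⟨T.det, ?_⟩
    have h4 := congrArg Matrix.det h3
    rw [Matrix.det_smul, Matrix.det_mul, h1, Fintype.card_fin] at h4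
    exact h4

end Minors

end Kostant

namespace Kostant

lemma exists_prime_dvd_of_map_eq_zero {M K : Type*} [CommRing M] [IsDomain M]
    [UniqueFactorizationMonoid M] [Field K] (φ : M →+* K) {a : M} (ha : a ≠ 0) (h : φ a = 0) :
    ∃ q, Prime q ∧ q ∣ a ∧ φ q = 0 := by
  induction a using UniqueFactorizationMonoid.induction_on_prime with
  | h₁ => exact absurd rfl ha
  | h₂ x hx => exact absurd h (hx.map φ).ne_zero
  | h₃ a p ha0 hp ih =>
    rw [map_mul, mul_eq_zero] at h
    rcases h with h | h
    · exact ⟨p, hp, dvd_mul_right _ _, h⟩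
    · obtain ⟨q, hq, hqa, hq0⟩ := ih ha0 h
      exact ⟨q, hq, hqa.mul_left _, hq0⟩

section Regular

variable {g} {t : LieSubalgebra ℂ g}

lemma coadjointDerivation_X_totalDegree_le (y : g) (i) :
    (coadjointDerivation g y (X i)).totalDegree ≤ 1 :=
  (coadjointDerivation_isHomogeneous y (isHomogeneous_X ℂ i)).totalDegree_le

lemma finrank_ker_ad {x : g} (hx : IsRegularElement t x) :
    finrank ℂ (LinearMap.ker (ad ℂ g x : g →ₗ[ℂ] g)) = finrank ℂ t := hx

/-- A family of homogeneous invariants whose differentials are independent at the principal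
nilpotent element has independent differentials at all regular elements. -/
theorem RootDatum.linearIndependent_diffAt (D : RootDatum g t)
    {f : Fin (finrank ℂ t) → PolyAlg g} (hf : ∀ i, f i ∈ invariantPolynomials g)
    (hd : ∀ i, ∃ d, (f i).IsHomogeneous d)
    (he : LinearIndependent ℂ fun i => diffAt g D.e₀ (f i)) {x : g} (hx : IsRegularElement t x) :
    ∃ v, evalAt g x (minor f v) ≠ 0 := by
  by_contra! hcon
  obtain ⟨P, w, hP, hPw⟩ := exists_minor_relation hf (finrank_ker_ad hx)
  obtain ⟨v₀, hv₀⟩ := exists_minor_ne_zero f he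
  have hP0 : P ≠ 0 := fun h => hP (by rw [h, map_zero])
  have hw0 : minor f w ≠ 0 := by
    intro h
    obtain ⟨β, hβ⟩ := hPw v₀
    rw [h, zero_mul, mul_eq_zero, or_iff_right hP0] at hβ
    exact hv₀ (by rw [hβ, map_zero])
  obtain ⟨q, hq, hqw, hqx⟩ := exists_prime_dvd_of_map_eq_zero (evalAt g x).toRingHom hw0 (hcon w)
  replace hqx : evalAt g x q = 0 := hqx
  have hqP : ¬ q ∣ P := fun ⟨c, hc⟩ => hP (by rw [hc, map_mul, hqx, zero_mul])
  obtain ⟨m, b, hb, hm⟩ := WfDvdMonoid.max_power_factor' hw0 hq.not_isUnit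
  have hm0 : m ≠ 0 := by
    rintro rfl
    rw [pow_zero, one_mul] at hm
    exact hb (hm ▸ hqw)
  have hall : ∀ v, q ^ m ∣ minor f v := by
    intro v
    obtain ⟨β, hβ⟩ := hPw v
    refine hq.pow_dvd_of_dvd_mul_left m hqP ?_
    rw [hβ, hm, mul_assoc]
    exact dvd_mul_right _ _
  have hqe : evalAt g D.e₀ q ≠ 0 := by
    intro h
    obtain ⟨c, hc⟩ := (dvd_pow_self q hm0).trans (hall v₀)
    exact hv₀ (by rw [hc, map_mul, h, zero_mul])
  have hχ : ∀ y, ∃ c : ℂ, coadjointDerivation g y q = c • q := by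
    intro y
    refine exists_derivation_eq_smul (coadjointDerivation_X_totalDegree_le y) hq.ne_zero ?_
    refine dvd_derivation_of_pow _ hq hm0 hm hb ?_
    rw [coadjointDerivation_minor hf]
    exact Finset.dvd_sum fun j _ => hall _
  obtain ⟨c, hc⟩ : ∃ c : ℂ, euler q = c • q := by
    refine exists_derivation_eq_smul (fun i => ?_) hq.ne_zero ?_
    · rw [euler, mkDerivation_X, totalDegree_X]
    · refine dvd_derivation_of_pow _ hq hm0 hm hb ?_
      obtain ⟨d, hd⟩ := minor_isHomogeneous hd w
      rw [euler_of_isHomogeneous hd, nsmul_eq_mul]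
      exact (hall w).mul_left _
  have hh : coadjointDerivation g (D.h₀ : g) q = 0 := by
    obtain ⟨f₀, -, hf₀⟩ := D.exists_f₀
    obtain ⟨c₁, h₁⟩ := hχ D.e₀
    obtain ⟨c₂, h₂⟩ := hχ f₀
    have h2 : (2 : ℂ) • coadjointDerivation g (D.h₀ : g) q = 0 := by
      rw [← coadjointDerivation_smul, ← hf₀, coadjointDerivation_lie,
        Derivation.commutator_apply, h₂, h₁, Derivation.map_smul, Derivation.map_smul, h₁, h₂, smul_smul, smul_smul,
        mul_comm, sub_self]
    exact (smul_eq_zero.mp h2).resolve_left two_ne_zero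
  have hle : ⁅(D.h₀ : g), D.e₀⁆ = D.e₀ := by
    have := D.proj_eq_self_iff.mp D.proj_e₀
    rwa [Int.cast_one, one_smul] at this
  have hdiff : evalAt g D.e₀ (euler q) = 0 := by
    have h1 := evalAt_coadjointDerivation D.e₀ (D.h₀ : g) q
    rw [hh, map_zero, hle, eq_comm, neg_eq_zero] at h1
    rw [derivation_eq_sum, map_sum, ← h1, diffAt_apply]
    refine Finset.sum_congr rfl fun i _ => ?_
    rw [map_mul, euler, mkDerivation_X, evalAt_X]
  rw [hc, map_smul, smul_eq_mul, mul_eq_zero, or_iff_left hqe] at hdiff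
  rw [hdiff, zero_smul] at hc
  obtain ⟨a, rfl⟩ := eq_C_of_euler_eq_zero hc
  rw [← algebraMap_eq, AlgHom.commutes] at hqx
  have ha : a = 0 := hqx
  exact hq.ne_zero (by rw [ha, map_zero])

lemma linearIndependent_of_minor {r : ℕ} {f : Fin r → PolyAlg g} {v : Fin r → g} {x : g}
    (h : evalAt g x (minor f v) ≠ 0) : LinearIndependent ℂ fun i => diffAt g x (f i) := by
  rw [evalAt_minor] at h
  have h1 := Matrix.linearIndependent_rows_of_det_ne_zero h
  exact LinearIndependent.of_comp (LinearMap.pi fun j => LinearMap.applyₗ (v j)) h1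

lemma finrank_dualAnnihilator_range_ad {x : g} (hx : IsRegularElement t x) :
    finrank ℂ (LinearMap.range (ad ℂ g x : g →ₗ[ℂ] g)).dualAnnihilator = finrank ℂ t := by
  have h1 := Subspace.finrank_add_finrank_dualAnnihilator_eq
    (LinearMap.range (ad ℂ g x : g →ₗ[ℂ] g))
  have h2 := LinearMap.finrank_range_add_finrank_ker (ad ℂ g x : g →ₗ[ℂ] g)
  rw [finrank_ker_ad hx] at h2
  omega

lemma span_diffAt_le (x : g) :
    Submodule.span ℂ (diffAt g x '' (invariantPolynomials g : Set (PolyAlg g))) ≤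
      (LinearMap.range (ad ℂ g x : g →ₗ[ℂ] g)).dualAnnihilator := by
  rw [Submodule.span_le]
  rintro _ ⟨p, hp, rfl⟩
  rw [SetLike.mem_coe, Submodule.mem_dualAnnihilator]
  rintro _ ⟨y, rfl⟩
  have := mem_invariantPolynomials_iff.mp hp x (-y)
  rwa [neg_lie, lie_skew] at this

theorem finrank_span_diffAt [IsSemisimple ℂ g] [t.IsCartanSubalgebra] {x : g}
    (hx : IsRegularElement t x) :
    finrank ℂ (Submodule.span ℂ (diffAt g x '' (invariantPolynomials g : Set (PolyAlg g)))) =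
      finrank ℂ t := by
  refine le_antisymm ?_ ?_
  · rw [← finrank_dualAnnihilator_range_ad hx]
    exact Submodule.finrank_mono (span_diffAt_le x)
  · obtain ⟨D⟩ := nonempty_rootDatum g t
    obtain ⟨f, hf, hd, he⟩ := D.exists_homogeneous_invariants
    obtain ⟨v, hv⟩ := D.linearIndependent_diffAt hf hd he hx
    have h1 := finrank_span_eq_card (linearIndependent_of_minor hv)
    rw [Fintype.card_fin] at h1
    conv_lhs => rw [← h1]
    refine Submodule.finrank_mono (Submodule.span_mono ?_)
    rintro _ ⟨i, rfl⟩
    exact ⟨f i, hf i, rfl⟩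

/-- Differentials of the elements of a subalgebra are spanned by those of generators. -/
lemma diffAt_mem_span_of_mem_adjoin {s : Set (PolyAlg g)} (x : g) {p : PolyAlg g}
    (hp : p ∈ Algebra.adjoin ℂ s) : diffAt g x p ∈ Submodule.span ℂ (diffAt g x '' s) := by
  induction hp using Algebra.adjoin_induction with
  | mem p hp => exact Submodule.subset_span ⟨p, hp, rfl⟩
  | algebraMap c =>
    rw [algebraMap_eq, diffAt_C]
    exact zero_mem _
  | add p q _ _ h₁ h₂ =>
    rw [← diffAtₗ_apply, map_add]
    exact add_mem h₁ h₂
  | mul p q _ _ h₁ h₂ =>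
    rw [diffAt_mul]
    exact add_mem (Submodule.smul_mem _ _ h₂) (Submodule.smul_mem _ _ h₁)

theorem linearIndependent_diffAt_of_adjoin_eq [IsSemisimple ℂ g] [t.IsCartanSubalgebra]
    {F : Fin (finrank ℂ t) → PolyAlg g}
    (hF : Algebra.adjoin ℂ (Set.range F) = invariantPolynomials g) {x : g}
    (hx : IsRegularElement t x) : LinearIndependent ℂ fun i => diffAt g x (F i) := by
  rw [linearIndependent_iff_card_le_finrank_span, Fintype.card_fin, Set.finrank]
  refine (finrank_span_diffAt hx).ge.trans ?_
  refine Submodule.finrank_mono (Submodule.span_le.mpr ?_)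
  rintro _ ⟨p, hp, rfl⟩
  rw [← hF] at hp
  have := diffAt_mem_span_of_mem_adjoin x hp
  rwa [← Set.range_comp] at this

end Regular

end Kostant

namespace Kostant

section Generators

variable {g} {t : LieSubalgebra ℂ g}

/-- The invariant algebra is generated by `rk g` elements: the invariants lifting linear
coordinates on the slice. -/
theorem RootDatum.exists_adjoin_eq [IsSemisimple ℂ g] (D : RootDatum g t) :
    ∃ p : Fin (finrank ℂ t) → PolyAlg g,
      Algebra.adjoin ℂ (Set.range p) = invariantPolynomials g := by
  rw [← D.finrank_slice]
  let b := Module.finBasis ℂ D.slice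
  obtain ⟨l, hl⟩ := D.exists_dual_basis b
  choose p hp hps using fun i => D.exists_invariant_slice (l i)
  refine ⟨p, le_antisymm (Algebra.adjoin_le ?_) fun q hq => ?_⟩
  · rintro _ ⟨i, rfl⟩
    exact hp i
  · have hF : (fun s : D.slice => evalAt g (D.e₀ + s) q) ∈ polyFun D.slice :=
      IsPolyMap.comp_mem ((IsPolyMap.const D.e₀).add (IsPolyMap.of_linear D.slice.subtype))
        (evalAt_mem_polyFun q)
    rw [← coordEval_range b] at hF
    obtain ⟨P, hP⟩ := hF
    have hmem : aeval p P ∈ invariantPolynomials g := by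
      have h1 : Algebra.adjoin ℂ (Set.range p) ≤ invariantPolynomials g := by
        refine Algebra.adjoin_le ?_
        rintro _ ⟨i, rfl⟩
        exact hp i
      refine h1 ?_
      rw [Algebra.adjoin_range_eq_range_aeval]
      exact ⟨P, rfl⟩
    have heq : (⟨q, hq⟩ : invariantPolynomials g) = ⟨aeval p P, hmem⟩ := by
      refine restr_injective D (Subtype.ext (funext fun H => ?_))
      rw [restr_apply, restr_apply]
      change evalAt g H q = evalAt g H (aeval p P)
      rw [← D.evalAt_toSlice hq, ← D.evalAt_toSlice hmem]
      refine (congrFun hP ⟨_, D.toSlice_mem H⟩).symm.trans ?_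
      refine (coordEval_apply b P _).trans ?_
      have : (evalAt g (D.e₀ + D.toSlice H)).comp (aeval p) =
          aeval fun i => b.coord i ⟨_, D.toSlice_mem H⟩ := by
        ext i
        simp [hps i _ (D.toSlice_mem H), ← hl]
      exact (congrArg (fun m => m P) this).symm
    rw [show q = aeval p P from congrArg Subtype.val heq, Algebra.adjoin_range_eq_range_aeval]
    exact ⟨P, rfl⟩

end Generators

end Kostant

namespace Kostant

section Smooth

variable {κ B : Type} [Fintype κ] [CommRing B]

lemma eval₂_add_of_sq_eq_bot {I : Ideal B} (hI : I ^ 2 = ⊥) (κ₀ : ℂ →+* B) (b δ : κ → B)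
    (hδ : ∀ i, δ i ∈ I) (p : MvPolynomial κ ℂ) :
    eval₂ κ₀ (b + δ) p = eval₂ κ₀ b p + ∑ i, eval₂ κ₀ b (pderiv i p) * δ i := by
  classical
  have hmul : ∀ i j, δ i * δ j = 0 := fun i j => by
    rw [← Ideal.mem_bot, ← hI, pow_two]
    exact Ideal.mul_mem_mul (hδ i) (hδ j)
  induction p using MvPolynomial.induction_on with
  | C c => simp
  | add p q hp hq =>
    simp only [map_add, eval₂_add, hp, hq, add_mul, Finset.sum_add_distrib]
    ring
  | mul_X p j hp =>
    have h1 : (∑ i, eval₂ κ₀ b (pderiv i p) * δ i) * δ j = 0 := by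
      rw [Finset.sum_mul]
      exact Finset.sum_eq_zero fun i _ => by rw [mul_assoc, hmul, mul_zero]
    have h2 : ∑ i, eval₂ κ₀ b (pderiv i (p * X j)) * δ i =
        eval₂ κ₀ b p * δ j + (∑ i, eval₂ κ₀ b (pderiv i p) * δ i) * b j := by
      have h3 : ∑ i, eval₂ κ₀ b (p * pderiv i (X j)) * δ i = eval₂ κ₀ b p * δ j := by
        rw [Finset.sum_eq_single j]
        · rw [pderiv_X_self, mul_one]
        · intro i _ hij
          rw [pderiv_X_of_ne hij.symm, mul_zero, eval₂_zero, zero_mul]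
        · simp
      rw [← h3, Finset.sum_mul, ← Finset.sum_add_distrib]
      refine Finset.sum_congr rfl fun i _ => ?_
      rw [Derivation.leibniz, smul_eq_mul, smul_eq_mul, eval₂_add, eval₂_mul (p := X j), eval₂_X]
      ring
    rw [eval₂_mul, eval₂_mul, eval₂_X, eval₂_X, hp, h2, Pi.add_apply]
    linear_combination h1

/-- The Jacobian criterion for a localized polynomial algebra over a finitely generated
`ℂ`-algebra. -/
theorem formallySmooth_of_jacobian {A S : Type} [CommRing A] [Algebra ℂ A] [CommRing S]
    [Algebra (MvPolynomial κ ℂ) S] (M : Submonoid (MvPolynomial κ ℂ)) [IsLocalization M S]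
    [Algebra A S] (ι : A →ₐ[ℂ] MvPolynomial κ ℂ)
    (hι : ∀ a, algebraMap A S a = algebraMap (MvPolynomial κ ℂ) S (ι a)) {r : ℕ} (p : Fin r → A)
    (hp : Algebra.adjoin ℂ (Set.range p) = ⊤) (v : Fin r → κ → ℂ)
    (hdet : (Matrix.of fun k j => ∑ i, pderiv i (ι (p k)) * C (v j i)).det ∈ M) :
    Algebra.FormallySmooth A S := by
  refine Algebra.FormallySmooth.of_comp_surjective fun B _ _ I hI f => ?_
  let κ₀ : ℂ →+* B := (algebraMap A B).comp (algebraMap ℂ A)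
  choose b hb using fun i => Ideal.Quotient.mk_surjective (f (algebraMap (MvPolynomial κ ℂ) S (X i)))
  have hmk : ∀ q, Ideal.Quotient.mk I (eval₂ κ₀ b q) = f (algebraMap _ S q) := by
    have : (Ideal.Quotient.mk I).comp (eval₂Hom κ₀ b) =
        (f : S →+* B ⧸ I).comp (algebraMap (MvPolynomial κ ℂ) S) := by
      refine ringHom_ext (fun c => ?_) fun i => ?_
      · have h1 := f.commutes (algebraMap ℂ A c)
        rw [hι, AlgHom.commutes, algebraMap_eq] at h1
        simp only [RingHom.comp_apply, coe_eval₂Hom, eval₂_C, RingHom.coe_coe]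
        exact h1.symm
      · simp [hb]
    exact fun q => congrArg (fun m => m q) this
  have hnil : IsNilpotent I := ⟨2, hI⟩
  set J : Matrix (Fin r) (Fin r) (MvPolynomial κ ℂ) :=
    Matrix.of fun k j => ∑ i, pderiv i (ι (p k)) * C (v j i) with hJ
  let JB : Matrix (Fin r) (Fin r) B := J.map (eval₂Hom κ₀ b)
  have hdetB : IsUnit JB.det := by
    have h1 : JB.det = eval₂ κ₀ b J.det := ((eval₂Hom κ₀ b).map_det J).symm
    rw [← hnil.isUnit_quotient_mk_iff, h1, hmk]
    exact (IsLocalization.map_units S ⟨_, hdet⟩).map f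
  let e : Fin r → B := fun k => algebraMap A B (p k) - eval₂ κ₀ b (ι (p k))
  have he : ∀ k, e k ∈ I := by
    intro k
    rw [← Ideal.Quotient.eq_zero_iff_mem, map_sub, hmk, ← hι, f.commutes]
    exact sub_self _
  let c : Fin r → B := JB⁻¹.mulVec e
  have hc : ∀ j, c j ∈ I := by
    intro j
    simp only [c, Matrix.mulVec, dotProduct]
    exact I.sum_mem fun k _ => I.mul_mem_left _ (he k)
  have hJc : JB.mulVec c = e := by
    rw [Matrix.mulVec_mulVec, Matrix.mul_nonsing_inv _ hdetB, Matrix.one_mulVec]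
  let δ : κ → B := fun i => ∑ j, κ₀ (v j i) * c j
  have hδ : ∀ i, δ i ∈ I := fun i => I.sum_mem fun j _ => I.mul_mem_left _ (hc j)
  let φ : MvPolynomial κ ℂ →+* B := eval₂Hom κ₀ (b + δ)
  have hφp : ∀ k, φ (ι (p k)) = algebraMap A B (p k) := by
    intro k
    refine (eval₂_add_of_sq_eq_bot hI κ₀ b δ hδ _).trans ?_
    have h1 : ∑ i, eval₂ κ₀ b (pderiv i (ι (p k))) * δ i = e k := by
      rw [← hJc, Matrix.mulVec, dotProduct]
      simp only [δ, Finset.mul_sum]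
      rw [Finset.sum_comm]
      refine Finset.sum_congr rfl fun j _ => ?_
      have h2 : JB k j = ∑ i, eval₂ κ₀ b (pderiv i (ι (p k))) * κ₀ (v j i) := by
        change eval₂Hom κ₀ b (∑ i, pderiv i (ι (p k)) * C (v j i)) = _
        rw [map_sum]
        refine Finset.sum_congr rfl fun i _ => ?_
        rw [coe_eval₂Hom, eval₂_mul, eval₂_C]
      rw [h2, Finset.sum_mul]
      exact Finset.sum_congr rfl fun i _ => (mul_assoc _ _ _).symm
    rw [h1, add_sub_cancel]
  have hφ : ∀ a, φ (ι a) = algebraMap A B a := by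
    intro a
    have ha : a ∈ Algebra.adjoin ℂ (Set.range p) := by rw [hp]; trivial
    induction ha using Algebra.adjoin_induction with
    | mem a ha => obtain ⟨k, rfl⟩ := ha; exact hφp k
    | algebraMap z =>
      rw [AlgHom.commutes, algebraMap_eq]
      exact eval₂_C _ _ _
    | add x y _ _ hx hy => rw [map_add, map_add, map_add, hx, hy]
    | mul x y _ _ hx hy => rw [map_mul, map_mul, map_mul, hx, hy]
  have hmkφ : ∀ q, Ideal.Quotient.mk I (φ q) = f (algebraMap _ S q) := by
    intro q
    rw [← hmk, Ideal.Quotient.eq]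
    refine (congrArg (· ∈ I) (?_ : _ = ∑ i, eval₂ κ₀ b (pderiv i q) * δ i)).mpr
      (I.sum_mem fun i _ => I.mul_mem_left _ (hδ i))
    rw [sub_eq_iff_eq_add']
    exact eval₂_add_of_sq_eq_bot hI κ₀ b δ hδ q
  have hunit : ∀ y : M, IsUnit (φ y) := by
    intro y
    rw [← hnil.isUnit_quotient_mk_iff, hmkφ]
    exact (IsLocalization.map_units S y).map f
  refine ⟨⟨IsLocalization.lift hunit, fun a => ?_⟩, ?_⟩
  · change IsLocalization.lift hunit (algebraMap A S a) = _
    rw [hι, IsLocalization.lift_eq, hφ]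
  · refine AlgHom.coe_ringHom_injective (IsLocalization.ringHom_ext M ?_)
    refine RingHom.ext fun q => ?_
    change Ideal.Quotient.mk I (IsLocalization.lift hunit (algebraMap _ S q)) = f (algebraMap _ S q)
    rw [IsLocalization.lift_eq, hmkφ]

end Smooth

section Quotient

variable {g} {t : LieSubalgebra ℂ g}

theorem formallySmooth_localization [IsSemisimple ℂ g] [t.IsCartanSubalgebra] {x : g}
    (hx : IsRegularElement t x)
    [Algebra (invariantPolynomials g) (Localization.AtPrime (pointIdeal g x))]
    (hι : ∀ a : invariantPolynomials g,
      algebraMap (invariantPolynomials g) (Localization.AtPrime (pointIdeal g x)) a =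
        algebraMap (PolyAlg g) _ (a : PolyAlg g)) :
    Algebra.FormallySmooth (invariantPolynomials g) (Localization.AtPrime (pointIdeal g x)) := by
  obtain ⟨D⟩ := nonempty_rootDatum g t
  obtain ⟨p, hp⟩ := D.exists_adjoin_eq
  have hmem : ∀ i, p i ∈ invariantPolynomials g := fun i =>
    hp ▸ Algebra.subset_adjoin (Set.mem_range_self i)
  obtain ⟨v, hv⟩ := exists_minor_ne_zero p (linearIndependent_diffAt_of_adjoin_eq hp hx)
  refine formallySmooth_of_jacobian (pointIdeal g x).primeCompl (invariantPolynomials g).val hι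
    (fun i => ⟨p i, hmem i⟩) ?_ (fun j i => (gBasis g).coord i (v j)) ?_
  · refine Subalgebra.map_injective (f := (invariantPolynomials g).val) Subtype.val_injective ?_
    rw [AlgHom.map_adjoin, Algebra.map_top, Subalgebra.range_val, ← Set.range_comp]
    exact hp
  · have h1 : (Matrix.of fun k j => ∑ i, pderiv i ((invariantPolynomials g).val ⟨p k, hmem k⟩) *
        C ((gBasis g).coord i (v j))).det = minor p v := by
      rw [minor]
      congr 1
      ext1 k j
      rw [Matrix.of_apply, Matrix.of_apply, derivation_eq_sum]
      exact Finset.sum_congr rfl fun i _ => by rw [dirDer_X]; rfl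
    rw [h1]
    exact hv

end Quotient

end Kostant

theorem differentials_of_invariants_at_regular_points [LieAlgebra.IsSemisimple ℂ g]
    (t : LieSubalgebra ℂ g) [t.IsCartanSubalgebra] :
    -- the differentials of the invariants at a regular point span a subspace of dimension
    -- rk g = dim t :
    (∀ x : g, IsRegularElement t x →
      finrank ℂ (Submodule.span ℂ (diffAt g x '' (invariantPolynomials g : Set (PolyAlg g)))) =
        finrank ℂ t) ∧
    -- equivalently, the differentials of r = rk g homogeneous generators of ℂ[g]^G are
    -- linearly independent at every regular point :
    (∀ F : Fin (finrank ℂ t) → PolyAlg g,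
      (∀ i, F i ∈ invariantPolynomials g) →
      (∀ i, ∃ d : ℕ, (F i).IsHomogeneous d) →
      Algebra.adjoin ℂ (Set.range F) = invariantPolynomials g →
      ∀ x : g, IsRegularElement t x → LinearIndependent ℂ fun i => diffAt g x (F i)) ∧
    -- consequently, the adjoint quotient map is smooth along the regular locus: the local
    -- ring at each regular point is formally smooth over the invariant algebra :
    (∀ x : g, IsRegularElement t x →
      letI : Algebra (invariantPolynomials g) (Localization.AtPrime (pointIdeal g x)) :=
        ((algebraMap (PolyAlg g) (Localization.AtPrime (pointIdeal g x))).comp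
          (invariantPolynomials g).subtype).toAlgebra
      Algebra.FormallySmooth (invariantPolynomials g)
        (Localization.AtPrime (pointIdeal g x))) := by
  refine ⟨fun x hx => Kostant.finrank_span_diffAt hx, fun F _ _ hF x hx =>
    Kostant.linearIndependent_diffAt_of_adjoin_eq hF hx, fun x hx => ?_⟩
  let : Algebra (invariantPolynomials g) (Localization.AtPrime (pointIdeal g x)) :=
    ((algebraMap (PolyAlg g) (Localization.AtPrime (pointIdeal g x))).comp
      (invariantPolynomials g).subtype).toAlgebra
  exact Kostant.formallySmooth_localization hx fun _ => rfl

end
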